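/- arXiv:2008.08768 — 6 statements merged into one kernel-verified Lean document; each statement's English description precedes it below -/
import Mathlib

section
/- Let N ≥ 1, m, n be integers and let s be a complex number with Re(s) > 3/2. Then (∑_{c ≥ 1, gcd(c,N)=1} c^{-s}) · (∑_{c ≥ 1, gcd(c,N)=1} c^{-(1+s)} ∑_{a=0}^{c-1} S(m, a², c) e(an/c)) = ∑_{c ≥ 1, gcd(c,N)=1} ρ(c, n² − 4m) c^{-s}, where all three series converge absolutely. (Equivalently, in the paper's notation, ∑_{gcd(c,N)=1} c^{-(1+s)} ∑_{a mod c} S(m,a²;c) e(an/c) = L^{(N)}(s, n²−4m)/ζ^{(N)}(2s), where ζ^{(N)}(s) = ∑_{gcd(c,N)=1} c^{-s} and L^{(N)}(s,Δ) = (ζ^{(N)}(2s)/ζ^{(N)}(s)) ∑_{gcd(c,N)=1} ρ(c,Δ) c^{-s}.) -/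
open Complex Finset

/-- `e(x) = exp(2πix)`. -/
noncomputable def eC (x : ℂ) : ℂ := Complex.exp (2 * Real.pi * Complex.I * x)

/-- The Kloosterman sum `S(m, n; c) = ∑_{a mod c, (a,c)=1} e((ma + n a⁻¹)/c)`. -/
noncomputable def kloosterman (m n : ℤ) (c : ℕ) : ℂ :=
  ∑ a ∈ (Finset.range c).filter (fun a => Nat.gcd a c = 1),
    eC ((m * a + n * (((a : ZMod c)⁻¹).val : ℕ)) / c)

/-- `ρ(c, Δ) = #{a (mod 2c) : a² ≡ Δ (mod 4c)}`. -/
def rho (c : ℕ) (Δ : ℤ) : ℕ :=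
  ((Finset.range (2 * c)).filter (fun (a : ℕ) => ((a : ℤ) ^ 2 - Δ) % (4 * (c : ℤ)) = 0)).card

/-- If `f` is dominated by `g` in norm, absolute convergence of `L(g, s)` gives that of `L(f, s)`. -/
theorem lseriesSummable_of_norm_le {f g : ℕ → ℂ} {s : ℂ} (h : ∀ c ≠ 0, ‖f c‖ ≤ ‖g c‖)
    (hg : LSeriesSummable g s) : LSeriesSummable f s := by
  refine (summable_norm_iff.mpr hg).of_norm_bounded fun c => ?_
  rcases eq_or_ne c 0 with rfl | hc
  · simp
  · exact LSeries.norm_term_le s (h c hc)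

theorem eC_intCast_div (c : ℕ) [NeZero c] (j : ℤ) :
    eC ((j : ℂ) / c) = ZMod.stdAddChar (j : ZMod c) := by
  rw [ZMod.stdAddChar_coe, eC]
  congr 1
  ring

theorem sum_range_natCast_zmod {M : Type*} [AddCommMonoid M] (c : ℕ) [NeZero c]
    (F : ZMod c → M) : ∑ a ∈ range c, F (a : ZMod c) = ∑ x : ZMod c, F x := by
  refine Finset.sum_bij' (fun a _ => (a : ZMod c)) (fun x _ => x.val) ?_ ?_ ?_ ?_ ?_
  · simp
  · intro x _
    simpa using ZMod.val_lt x
  · intro a ha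
    exact ZMod.val_cast_of_lt (by simpa using ha)
  · simp
  · simp

theorem sum_coprime_range_natCast_zmod {M : Type*} [AddCommMonoid M] (c : ℕ) [NeZero c]
    (F : ZMod c → M) :
    ∑ a ∈ (range c).filter (fun a => Nat.gcd a c = 1), F (a : ZMod c) =
      ∑ x : (ZMod c)ˣ, F x := by
  symm
  refine Finset.sum_bij (fun x _ => (x : ZMod c).val) ?_ ?_ ?_ ?_
  · intro x _
    simpa using ⟨ZMod.val_lt _, ZMod.val_coe_unit_coprime x⟩
  · intro x _ y _ h
    exact Units.ext (ZMod.val_injective c h)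
  · intro a ha
    rw [Finset.mem_filter, Finset.mem_range] at ha
    refine ⟨ZMod.unitOfCoprime a ha.2, Finset.mem_univ _, ?_⟩
    rw [ZMod.coe_unitOfCoprime, ZMod.val_cast_of_lt ha.1]
  · simp

theorem kloosterman_eq_sum_units (m n : ℤ) (c : ℕ) [NeZero c] :
    kloosterman m n c =
      ∑ x : (ZMod c)ˣ, ZMod.stdAddChar
        ((m : ZMod c) * (x : ZMod c) + (n : ZMod c) * ((x⁻¹ : (ZMod c)ˣ) : ZMod c)) := by
  simp_rw [← ZMod.inv_coe_unit]
  rw [← sum_coprime_range_natCast_zmod c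
    (fun x => ZMod.stdAddChar ((m : ZMod c) * x + (n : ZMod c) * x⁻¹)), kloosterman]
  refine Finset.sum_congr rfl fun a _ => ?_
  have := eC_intCast_div c (m * a + n * (((a : ZMod c)⁻¹).val : ℕ))
  push_cast at this
  rw [this, ZMod.natCast_zmod_val]

/-- The exponential sum `∑_{a mod c} e(y (a² + n a + m) / c)`. -/
noncomputable def quadExpSum (m n : ℤ) (y c : ℕ) : ℂ :=
  ∑ a ∈ range c, eC (((y * ((a : ℤ) ^ 2 + n * a + m) : ℤ) : ℂ) / c)

theorem quadExpSum_eq_sum_zmod (m n : ℤ) (y c : ℕ) [NeZero c] :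
    quadExpSum m n y c =
      ∑ a : ZMod c, ZMod.stdAddChar ((y : ZMod c) * (a ^ 2 + (n : ZMod c) * a + (m : ZMod c))) := by
  rw [quadExpSum, ← sum_range_natCast_zmod]
  refine Finset.sum_congr rfl fun a _ => ?_
  rw [eC_intCast_div]
  push_cast
  rfl

/-- The sum `∑_{a mod c} S(m, a²; c) e(an/c)`. -/
noncomputable def kloostermanTwist (m n : ℤ) (c : ℕ) : ℂ :=
  ∑ a ∈ range c, kloosterman m ((a : ℤ) ^ 2) c * eC ((a : ℂ) * (n : ℂ) / (c : ℂ))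

theorem kloostermanTwist_eq_sum_quadExpSum (m n : ℤ) (c : ℕ) [NeZero c] :
    kloostermanTwist m n c =
      ∑ y ∈ (range c).filter (fun y => Nat.gcd y c = 1), quadExpSum m n y c := by
  simp_rw [quadExpSum_eq_sum_zmod]
  rw [sum_coprime_range_natCast_zmod c
    (fun y => ∑ a : ZMod c, ZMod.stdAddChar (y * (a ^ 2 + (n : ZMod c) * a + (m : ZMod c))))]
  have key : kloostermanTwist m n c = ∑ a : ZMod c, ∑ x : (ZMod c)ˣ,
      ZMod.stdAddChar ((m : ZMod c) * (x : ZMod c) +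
        a ^ 2 * ((x⁻¹ : (ZMod c)ˣ) : ZMod c) + a * (n : ZMod c)) := by
    rw [kloostermanTwist, ← sum_range_natCast_zmod]
    refine Finset.sum_congr rfl fun a _ => ?_
    have := eC_intCast_div c (a * n)
    push_cast at this
    rw [this, kloosterman_eq_sum_units, Finset.sum_mul]
    refine Finset.sum_congr rfl fun x _ => ?_
    rw [← AddChar.map_add_eq_mul]
    push_cast
    rfl
  rw [key, Finset.sum_comm]
  refine Finset.sum_congr rfl fun x _ => ?_
  rw [← Equiv.sum_comp x.mulRight]
  refine Finset.sum_congr rfl fun a _ => ?_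
  congr 1
  rw [Units.mulRight_apply]
  linear_combination (a ^ 2 * (x : ZMod c)) * x.mul_inv

theorem quadExpSum_mul_mul (m n : ℤ) (y g d : ℕ) [NeZero g] [NeZero d] :
    quadExpSum m n (g * y) (g * d) = g * quadExpSum m n y d := by
  have hg : (g : ℂ) ≠ 0 := NeZero.ne _
  have hd : (d : ℂ) ≠ 0 := NeZero.ne _
  have h1 : quadExpSum m n (g * y) (g * d) =
      ∑ a ∈ range (g * d), ZMod.stdAddChar
        ((y : ZMod d) * ((a : ZMod d) ^ 2 + (n : ZMod d) * (a : ZMod d) + (m : ZMod d))) := by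
    refine Finset.sum_congr rfl fun a _ => ?_
    have := eC_intCast_div d (y * ((a : ℤ) ^ 2 + n * a + m))
    push_cast at this
    rw [← this]
    congr 1
    push_cast
    field_simp
  rw [h1, quadExpSum_eq_sum_zmod, ← sum_range_natCast_zmod]
  generalize g = k
  induction k with
  | zero => simp
  | succ k ih =>
    rw [add_mul, one_mul, Finset.sum_range_add, ih]
    push_cast
    simp [add_mul]

theorem sum_quadExpSum_range (m n : ℤ) (c : ℕ) [NeZero c] :
    ∑ x ∈ range c, quadExpSum m n x c =
      ∑ p ∈ c.divisorsAntidiagonal, (p.1 : ℂ) * kloostermanTwist m n p.2 := by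
  have h : ∑ p ∈ c.divisorsAntidiagonal, (p.1 : ℂ) * kloostermanTwist m n p.2 =
      ∑ p ∈ c.divisorsAntidiagonal, ∑ y ∈ (range p.2).filter (fun y => Nat.gcd y p.2 = 1),
        quadExpSum m n (p.1 * y) c := by
    refine Finset.sum_congr rfl fun p hp => ?_
    obtain ⟨hpc, hc⟩ := Nat.mem_divisorsAntidiagonal.mp hp
    have : NeZero p.1 := ⟨by rintro h; simp [h] at hpc; exact hc hpc.symm⟩
    have : NeZero p.2 := ⟨by rintro h; simp [h] at hpc; exact hc hpc.symm⟩
    rw [kloostermanTwist_eq_sum_quadExpSum, Finset.mul_sum]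
    refine Finset.sum_congr rfl fun y _ => ?_
    rw [← hpc, quadExpSum_mul_mul]
  have hc := NeZero.pos c
  rw [h, Finset.sum_sigma']
  refine Finset.sum_bij' (fun x _ => ⟨(Nat.gcd x c, c / Nat.gcd x c), x / Nat.gcd x c⟩)
    (fun p _ => p.1.1 * p.2) ?_ ?_ ?_ ?_ ?_
  · intro x hx
    rw [Finset.mem_range] at hx
    have hg : 0 < Nat.gcd x c := Nat.gcd_pos_of_pos_right _ hc
    simp only [Finset.mem_sigma, Nat.mem_divisorsAntidiagonal, Finset.mem_filter, Finset.mem_range]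
    refine ⟨⟨Nat.mul_div_cancel' (Nat.gcd_dvd_right _ _), hc.ne'⟩, ?_,
      Nat.coprime_div_gcd_div_gcd hg⟩
    exact Nat.div_lt_div_of_lt_of_dvd (Nat.gcd_dvd_right _ _) hx
  · rintro ⟨⟨g, d⟩, y⟩ hp
    simp only [Finset.mem_sigma, Nat.mem_divisorsAntidiagonal, Finset.mem_filter,
      Finset.mem_range] at hp ⊢
    obtain ⟨⟨rfl, hne⟩, hy, -⟩ := hp
    exact Nat.mul_lt_mul_of_pos_left hy (Nat.pos_of_ne_zero (left_ne_zero_of_mul hne))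
  · intro x hx
    exact Nat.mul_div_cancel' (Nat.gcd_dvd_left _ _)
  · rintro ⟨⟨g, d⟩, y⟩ hp
    simp only [Finset.mem_sigma, Nat.mem_divisorsAntidiagonal, Finset.mem_filter,
      Finset.mem_range] at hp ⊢
    obtain ⟨⟨rfl, hne⟩, hy, hyd⟩ := hp
    have hg := Nat.pos_of_ne_zero (left_ne_zero_of_mul hne)
    rw [Nat.gcd_mul_left, hyd, mul_one, Nat.mul_div_cancel_left _ hg, Nat.mul_div_cancel_left _ hg]
  · intro x hx
    simp only [Nat.mul_div_cancel' (Nat.gcd_dvd_left x c)]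

/-- The number of roots of `a² + n a + m` modulo `c`. -/
def quadRootCount (m n : ℤ) (c : ℕ) : ℕ :=
  ((range c).filter (fun a : ℕ => (c : ℤ) ∣ (a : ℤ) ^ 2 + n * a + m)).card

theorem sum_quadExpSum_eq_mul_quadRootCount (m n : ℤ) (c : ℕ) [NeZero c] :
    ∑ x ∈ range c, quadExpSum m n x c = c * quadRootCount m n c := by
  simp_rw [quadExpSum_eq_sum_zmod]
  rw [sum_range_natCast_zmod c
    (fun y => ∑ a : ZMod c, ZMod.stdAddChar (y * (a ^ 2 + (n : ZMod c) * a + (m : ZMod c)))),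
    Finset.sum_comm]
  simp_rw [AddChar.sum_mulShift _ (ZMod.isPrimitive_stdAddChar c), ZMod.card]
  rw [← sum_range_natCast_zmod c
    (fun a => ((if a ^ 2 + (n : ZMod c) * a + (m : ZMod c) = 0 then c else 0 : ℕ) : ℂ)),
    quadRootCount, Finset.card_filter, Nat.cast_sum, Finset.mul_sum]
  refine Finset.sum_congr rfl fun a _ => ?_
  have : (c : ℤ) ∣ (a : ℤ) ^ 2 + n * a + m ↔
      (a : ZMod c) ^ 2 + (n : ZMod c) * (a : ZMod c) + (m : ZMod c) = 0 := by
    rw [← ZMod.intCast_zmod_eq_zero_iff_dvd]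
    push_cast
    rfl
  simp [this]

theorem quadRootCount_eq_sum_kloostermanTwist (m n : ℤ) (c : ℕ) (hc : c ≠ 0) :
    (quadRootCount m n c : ℂ) = ∑ d ∈ c.divisors, kloostermanTwist m n d / d := by
  have : NeZero c := ⟨hc⟩
  have hc' : (c : ℂ) ≠ 0 := NeZero.ne _
  have h := (sum_quadExpSum_eq_mul_quadRootCount m n c).symm.trans (sum_quadExpSum_range m n c)
  rw [← mul_right_inj' hc', h, ← Nat.sum_divisorsAntidiagonal'
    (fun _ d => kloostermanTwist m n d / (d : ℂ)), Finset.mul_sum]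
  refine Finset.sum_congr rfl fun p hp => ?_
  obtain ⟨hpc, -⟩ := Nat.mem_divisorsAntidiagonal.mp hp
  have hp2 : (p.2 : ℂ) ≠ 0 := by
    rw [← hpc, Nat.cast_mul] at hc'
    exact right_ne_zero_of_mul hc'
  rw [← hpc, Nat.cast_mul]
  field_simp

theorem rho_eq_quadRootCount (m n : ℤ) (c : ℕ) (hc : c ≠ 0) :
    rho c (n ^ 2 - 4 * m) = quadRootCount m n c := by
  have hc0 : (0 : ℤ) < c := by exact_mod_cast Nat.pos_of_ne_zero hc
  symm
  refine Finset.card_bij (fun a _ => ((2 * (a : ℤ) + n) % (2 * c)).toNat) ?_ ?_ ?_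
  · intro a ha
    rw [Finset.mem_filter, Finset.mem_range] at ha
    obtain ⟨-, k, hk⟩ := ha
    have h0 := Int.emod_nonneg (2 * (a : ℤ) + n) (by omega : (2 * (c : ℤ)) ≠ 0)
    have h1 := Int.emod_lt_of_pos (2 * (a : ℤ) + n) (by omega : 0 < (2 * (c : ℤ)))
    have h2 := Int.emod_add_mul_ediv (2 * (a : ℤ) + n) (2 * c)
    rw [Finset.mem_filter, Finset.mem_range, Int.toNat_of_nonneg h0]
    refine ⟨by omega, Int.emod_eq_zero_of_dvd ?_⟩
    set r := (2 * (a : ℤ) + n) % (2 * c)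
    set q := (2 * (a : ℤ) + n) / (2 * c)
    have hr : r = 2 * a + n - 2 * c * q := by linarith
    refine ⟨k - q * (2 * a + n) + c * q ^ 2, ?_⟩
    rw [hr]
    linear_combination 4 * hk
  · intro a ha b hb h
    rw [Finset.mem_filter, Finset.mem_range] at ha hb
    have h0 := Int.emod_nonneg (2 * (a : ℤ) + n) (by omega : (2 * (c : ℤ)) ≠ 0)
    have h1 := Int.emod_nonneg (2 * (b : ℤ) + n) (by omega : (2 * (c : ℤ)) ≠ 0)
    have h2 : (2 * (a : ℤ) + n) % (2 * c) = (2 * (b : ℤ) + n) % (2 * c) := by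
      have := congrArg (Nat.cast : ℕ → ℤ) h
      simpa only [Int.toNat_of_nonneg h0, Int.toNat_of_nonneg h1] using this
    obtain ⟨k, hk⟩ := Int.ModEq.dvd h2
    have hk' : (b : ℤ) - a = c * k := by linarith
    have h3 : ((b : ℤ) - a) = 0 := Int.eq_zero_of_abs_lt_dvd ⟨k, hk'⟩ (by rw [abs_lt]; omega)
    omega
  · intro b hb
    rw [Finset.mem_filter, Finset.mem_range] at hb
    obtain ⟨k, hk⟩ := Int.dvd_of_emod_eq_zero hb.2
    obtain ⟨t, ht⟩ : (2 : ℤ) ∣ b - n := by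
      have h : (2 : ℤ) ∣ (b - n) ^ 2 := ⟨2 * c * k - 2 * m + n ^ 2 - b * n, by linear_combination hk⟩
      exact Int.prime_two.dvd_of_dvd_pow h
    have h0 := Int.emod_nonneg t hc0.ne'
    have h1 := Int.emod_lt_of_pos t hc0
    have h2 := Int.emod_add_mul_ediv t c
    set r := t % c
    set q := t / c
    have hr : r = t - c * q := by linarith
    refine ⟨r.toNat, ?_, ?_⟩
    · rw [Finset.mem_filter, Finset.mem_range, Int.toNat_of_nonneg h0]
      refine ⟨by omega, k - q * b + c * q ^ 2, ?_⟩
      have hb' : (b : ℤ) = 2 * t + n := by linarith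
      rw [hb'] at hk ⊢
      rw [hr]
      linarith
    · rw [Int.toNat_of_nonneg h0]
      have : 2 * r + n = b + 2 * c * (-q) := by rw [hr]; linarith
      rw [this, Int.add_mul_emod_self_left, Int.emod_eq_of_lt (by omega) (by omega)]
      simp

theorem card_filter_range_mul_dvd_sub_le (d e : ℕ) (r : ℤ) (P : ℕ → Prop)
    [DecidablePred P] (hP : ∀ a, P a → (d : ℤ) ∣ a - r) :
    ((range (d * e)).filter P).card ≤ e := by
  conv_rhs => rw [← Finset.card_range e]
  refine Finset.card_le_card_of_injOn (fun a => a / d) ?_ ?_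
  · intro a ha
    simp only [Finset.coe_filter, Finset.mem_range, Set.mem_ofPred_eq] at ha
    simpa using Nat.div_lt_of_lt_mul ha.1
  · intro a ha b hb h
    simp only [Finset.coe_filter, Finset.mem_range, Set.mem_ofPred_eq] at ha hb
    have h1 : (d : ℤ) ∣ b - a := by simpa using dvd_sub (hP b hb.2) (hP a ha.2)
    have h2 : a % d = b % d := (Nat.modEq_iff_dvd.mpr h1)
    rw [← Nat.div_add_mod a d, ← Nat.div_add_mod b d, h2]
    simp only at h
    rw [h]

/-- If `a₀` is a root, the other roots `a` satisfy `c ∣ (a - a₀) (a + a₀ + n)`; sorting them by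
`gcd (a - a₀, c)` bounds their number. -/
theorem quadRootCount_le (m n : ℤ) (c : ℕ) (hc : c ≠ 0) :
    (quadRootCount m n c : ℝ) ≤ ∑ p ∈ c.divisorsAntidiagonal, √(p.1 : ℝ) * √(p.2 : ℝ) := by
  rcases Finset.eq_empty_or_nonempty
    ((range c).filter (fun a : ℕ => (c : ℤ) ∣ (a : ℤ) ^ 2 + n * a + m)) with h | ⟨a₀, h₀⟩
  · rw [quadRootCount, h]
    simpa using Finset.sum_nonneg fun p _ => by positivity
  rw [Finset.mem_filter] at h₀
  have hsub : (range c).filter (fun a : ℕ => (c : ℤ) ∣ (a : ℤ) ^ 2 + n * a + m) ⊆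
      c.divisorsAntidiagonal.biUnion fun p => (range c).filter
        (fun a : ℕ => (p.1 : ℤ) ∣ a - a₀ ∧ (p.2 : ℤ) ∣ a - (-a₀ - n)) := by
    intro a ha
    rw [Finset.mem_filter] at ha
    have hdvd : (c : ℤ) ∣ ((a : ℤ) - a₀) * (a - (-a₀ - n)) := by
      have := dvd_sub ha.2 h₀.2
      convert! this using 1
      ring
    obtain ⟨u, v, hu, hv, huv⟩ := exists_dvd_and_dvd_of_dvd_mul hdvd
    rw [Finset.mem_biUnion]
    refine ⟨(u.natAbs, v.natAbs), ?_, ?_⟩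
    · rw [Nat.mem_divisorsAntidiagonal, ← Int.natAbs_mul, ← huv]
      exact ⟨Int.natAbs_natCast c, hc⟩
    · rw [Finset.mem_filter]
      exact ⟨ha.1, Int.natAbs_dvd.mpr hu, Int.natAbs_dvd.mpr hv⟩
  have hcard : quadRootCount m n c ≤ ∑ p ∈ c.divisorsAntidiagonal, ((range c).filter
      (fun a : ℕ => (p.1 : ℤ) ∣ a - a₀ ∧ (p.2 : ℤ) ∣ a - (-a₀ - n))).card :=
    (Finset.card_le_card hsub).trans Finset.card_biUnion_le
  refine (Nat.cast_le.mpr hcard).trans ?_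
  rw [Nat.cast_sum]
  refine Finset.sum_le_sum fun p hp => ?_
  obtain ⟨hpc, -⟩ := Nat.mem_divisorsAntidiagonal.mp hp
  subst hpc
  have h1 := card_filter_range_mul_dvd_sub_le p.1 p.2 a₀ _
    (fun a (h : (p.1 : ℤ) ∣ a - a₀ ∧ (p.2 : ℤ) ∣ a - (-a₀ - n)) => h.1)
  have h2 := card_filter_range_mul_dvd_sub_le p.2 p.1 (-a₀ - n) _
    (fun a (h : (p.1 : ℤ) ∣ a - a₀ ∧ (p.2 : ℤ) ∣ a - (-a₀ - n)) => h.2)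
  rw [mul_comm p.2 p.1] at h2
  rw [← Real.sqrt_mul (Nat.cast_nonneg _)]
  apply Real.le_sqrt_of_sq_le
  rw [sq]
  exact_mod_cast Nat.mul_le_mul h2 h1

theorem lseriesSummable_quadRootCount (m n : ℤ) {s : ℂ} (hs : 3 / 2 < s.re) :
    LSeriesSummable (fun c => (quadRootCount m n c : ℂ)) s := by
  have h : LSeriesSummable (fun c : ℕ => ((√(c : ℝ) : ℝ) : ℂ)) s := by
    refine LSeriesSummable_of_le_const_mul_rpow hs ⟨1, fun c _ => le_of_eq ?_⟩
    rw [Complex.norm_real, Real.norm_of_nonneg (Real.sqrt_nonneg _), Real.sqrt_eq_rpow]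
    norm_num
  refine lseriesSummable_of_norm_le (fun c hc => ?_) (h.convolution h)
  rw [LSeries.convolution_def, Complex.norm_natCast]
  refine (quadRootCount_le m n c hc).trans (le_trans (le_of_eq ?_) (Complex.re_le_norm _))
  rw [← Complex.ofReal_re (∑ p ∈ c.divisorsAntidiagonal, _)]
  push_cast
  rfl

theorem lseriesSummable_kloostermanTwist (m n : ℤ) {s : ℂ} (hs : 3 / 2 < s.re) :
    LSeriesSummable (fun c => kloostermanTwist m n c / c) s := by
  have hμ : LSeriesSummable (fun c => (ArithmeticFunction.moebius c : ℂ)) s :=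
    ArithmeticFunction.LSeriesSummable_moebius_iff.mpr (by linarith)
  refine (LSeriesSummable_congr s fun {c} hc => ?_).mp
    (hμ.convolution (lseriesSummable_quadRootCount m n hs))
  rw [LSeries.convolution_def]
  exact ArithmeticFunction.sum_eq_iff_sum_mul_moebius_eq.mp
    (fun c hc => (quadRootCount_eq_sum_kloostermanTwist m n c hc.ne').symm) c
    (Nat.pos_of_ne_zero hc)

/-- Restricting to `c` coprime to `N` is compatible with Dirichlet convolution. -/
theorem convolution_coprime_apply {R : Type*} [Semiring R] (N : ℕ) (f g : ℕ → R) (c : ℕ) :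
    LSeries.convolution (fun c => if Nat.gcd c N = 1 then f c else 0)
      (fun c => if Nat.gcd c N = 1 then g c else 0) c =
      if Nat.gcd c N = 1 then LSeries.convolution f g c else 0 := by
  simp only [LSeries.convolution_def]
  split_ifs with h
  · refine Finset.sum_congr rfl fun p hp => ?_
    rw [← (Nat.mem_divisorsAntidiagonal.mp hp).1] at h
    obtain ⟨h1, h2⟩ := Nat.coprime_mul_iff_left.mp h
    rw [if_pos h1, if_pos h2]
  · refine Finset.sum_eq_zero fun p hp => ?_
    rw [← (Nat.mem_divisorsAntidiagonal.mp hp).1] at h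
    by_cases h1 : Nat.gcd p.1 N = 1
    · rw [if_neg fun h2 => h (Nat.coprime_mul_iff_left.mpr ⟨h1, h2⟩), mul_zero]
    · rw [if_neg h1, zero_mul]

theorem ite_coprime_mul_cpow_eq_term (N : ℕ) (f : ℕ → ℂ) {s : ℂ} (hs : s ≠ 0) (c : ℕ) :
    (if Nat.gcd c N = 1 then f c * (c : ℂ) ^ (-s) else 0) =
      LSeries.term (fun c => if Nat.gcd c N = 1 then f c else 0) s c := by
  rw [LSeries.term_of_ne_zero' hs, Complex.cpow_neg, ← div_eq_mul_inv, ite_div, zero_div]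

/-- for `Re s > 3/2`,
`ζ^{(N)}(s) · ∑_{(c,N)=1} c^{-(1+s)} ∑_{a mod c} S(m,a²;c) e(an/c) = ∑_{(c,N)=1} ρ(c, n²-4m) c^{-s}`,
all three series converging absolutely. -/
theorem statement_0 (N : ℕ) (hN : 1 ≤ N) (m n : ℤ) (s : ℂ) (hs : 3 / 2 < s.re) :
    Summable (fun c : ℕ => if Nat.gcd c N = 1 then (c : ℂ) ^ (-s) else 0) ∧
    Summable (fun c : ℕ => if Nat.gcd c N = 1 then
      (c : ℂ) ^ (-(1 + s)) *
        ∑ a ∈ Finset.range c, kloosterman m ((a : ℤ) ^ 2) c * eC ((a : ℂ) * (n : ℂ) / (c : ℂ))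
      else 0) ∧
    Summable (fun c : ℕ => if Nat.gcd c N = 1 then
      (rho c (n ^ 2 - 4 * m) : ℂ) * (c : ℂ) ^ (-s) else 0) ∧
    (∑' c : ℕ, if Nat.gcd c N = 1 then (c : ℂ) ^ (-s) else 0) *
      (∑' c : ℕ, if Nat.gcd c N = 1 then
        (c : ℂ) ^ (-(1 + s)) *
          ∑ a ∈ Finset.range c, kloosterman m ((a : ℤ) ^ 2) c * eC ((a : ℂ) * (n : ℂ) / (c : ℂ))
        else 0) =
      ∑' c : ℕ, if Nat.gcd c N = 1 then
        (rho c (n ^ 2 - 4 * m) : ℂ) * (c : ℂ) ^ (-s) else 0 := by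
  have hs0 : s ≠ 0 := by
    rintro rfl
    norm_num at hs
  have norm_ite_le (f : ℕ → ℂ) (c : ℕ) :
      ‖if Nat.gcd c N = 1 then f c else 0‖ ≤ ‖f c‖ := by
    split_ifs <;> simp
  have hζ : (fun c : ℕ => if Nat.gcd c N = 1 then (c : ℂ) ^ (-s) else 0) =
      LSeries.term (fun c => if Nat.gcd c N = 1 then 1 else 0) s := by
    funext c
    rw [← ite_coprime_mul_cpow_eq_term N (fun _ => 1) hs0, one_mul]
  have hK : (fun c : ℕ => if Nat.gcd c N = 1 then
      (c : ℂ) ^ (-(1 + s)) *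
        ∑ a ∈ Finset.range c, kloosterman m ((a : ℤ) ^ 2) c * eC ((a : ℂ) * (n : ℂ) / (c : ℂ))
      else 0) =
      LSeries.term (fun c => if Nat.gcd c N = 1 then kloostermanTwist m n c / c else 0) s := by
    funext c
    rw [← ite_coprime_mul_cpow_eq_term N (fun c => kloostermanTwist m n c / c) hs0]
    congr 1
    rcases eq_or_ne c 0 with rfl | hc
    · simp
    · rw [neg_add, Complex.cpow_add _ _ (Nat.cast_ne_zero.mpr hc), Complex.cpow_neg_one,
        kloostermanTwist]
      ring
  have hρ : (fun c : ℕ => if Nat.gcd c N = 1 then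
      (rho c (n ^ 2 - 4 * m) : ℂ) * (c : ℂ) ^ (-s) else 0) =
      LSeries.term (fun c => if Nat.gcd c N = 1 then (quadRootCount m n c : ℂ) else 0) s := by
    funext c
    rw [← ite_coprime_mul_cpow_eq_term N (fun c => (quadRootCount m n c : ℂ)) hs0]
    rcases eq_or_ne c 0 with rfl | hc
    · simp [Complex.zero_cpow (neg_ne_zero.mpr hs0)]
    · rw [rho_eq_quadRootCount m n c hc]
  have hζs : LSeriesSummable (fun c => if Nat.gcd c N = 1 then 1 else 0) s :=
    lseriesSummable_of_norm_le (fun c _ => norm_ite_le (fun _ => 1) c)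
      (LSeriesSummable_one_iff.mpr (by linarith))
  have hKs : LSeriesSummable
      (fun c => if Nat.gcd c N = 1 then kloostermanTwist m n c / c else 0) s :=
    lseriesSummable_of_norm_le (fun c _ => norm_ite_le (fun c => kloostermanTwist m n c / c) c)
      (lseriesSummable_kloostermanTwist m n hs)
  have hρs : LSeriesSummable
      (fun c => if Nat.gcd c N = 1 then (quadRootCount m n c : ℂ) else 0) s :=
    lseriesSummable_of_norm_le (fun c _ => norm_ite_le (fun c => (quadRootCount m n c : ℂ)) c)
      (lseriesSummable_quadRootCount m n hs)
  rw [hζ, hK, hρ]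
  refine ⟨hζs, hKs, hρs, ?_⟩
  refine (LSeries_convolution' hζs hKs).symm.trans (LSeries_congr (fun {c} hc => ?_) s)
  rw [convolution_coprime_apply N (fun _ => 1) (fun c => kloostermanTwist m n c / c),
    quadRootCount_eq_sum_kloostermanTwist m n c hc, LSeries.convolution_def]
  simp only [one_mul]
  rw [Nat.sum_divisorsAntidiagonal' (fun _ d => kloostermanTwist m n d / (d : ℂ))]
end

section
/- Let c ≥ 1 and m, n be integers. Then ∑_{a=0}^{c-1} S(m, a², c) e(an/c) = c · ∑_{d | c} μ(d) ρ(c/d, n² − 4m), where μ is the Möbius function. -/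
open Complex Finset

theorem eC_div_eq_stdAddChar (N : ℕ) [NeZero N] (j : ℤ) :
    eC ((j : ℂ) / N) = ZMod.stdAddChar (j : ZMod N) := by
  rw [ZMod.stdAddChar_coe, eC]
  congr 1
  ring

theorem sum_range_eq_sum_zmod {M : Type*} [AddCommMonoid M] (N : ℕ) [NeZero N] (f : ZMod N → M) :
    ∑ a ∈ range N, f a = ∑ a : ZMod N, f a := by
  refine sum_nbij' (fun a => (a : ZMod N)) ZMod.val ?_ ?_ ?_ ?_ ?_
  · simp
  · intro a _
    simpa using ZMod.val_lt a
  · intro a ha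
    exact ZMod.val_cast_of_lt (mem_range.mp ha)
  · simp
  · simp

/-- Orthogonality of the additive characters modulo `N`. -/
theorem sum_range_eC (N : ℕ) (hN : 0 < N) (k : ℤ) :
    ∑ y ∈ range N, eC (((y * k : ℤ) : ℂ) / N) = if (N : ℤ) ∣ k then (N : ℂ) else 0 := by
  have : NeZero N := ⟨hN.ne'⟩
  simp_rw [eC_div_eq_stdAddChar]
  push_cast
  rw [sum_range_eq_sum_zmod N (fun y => ZMod.stdAddChar (y * (k : ZMod N))),
    AddChar.sum_mulShift _ (ZMod.isPrimitive_stdAddChar N), ZMod.card]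
  simp only [ZMod.intCast_zmod_eq_zero_iff_dvd]
  push_cast
  rfl

theorem sum_divisors_moebius (n : ℕ) :
    ∑ d ∈ n.divisors, ArithmeticFunction.moebius d = if n = 1 then 1 else 0 := by
  rw [← ArithmeticFunction.coe_mul_zeta_apply, ArithmeticFunction.moebius_mul_coe_zeta,
    ArithmeticFunction.one_apply]

theorem sum_range_mul_ite_dvd {M : Type*} [AddCommMonoid M] (d N : ℕ) (hd : 0 < d) (g : ℕ → M) :
    ∑ x ∈ range (d * N), (if d ∣ x then g x else 0) = ∑ y ∈ range N, g (d * y) := by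
  rw [← sum_filter]
  symm
  refine sum_nbij' (fun y => d * y) (fun x => x / d) ?_ ?_ ?_ ?_ ?_
  · intro y hy
    simpa [hd] using hy
  · intro x hx
    rw [mem_filter, mem_range] at hx
    exact mem_range.mpr (Nat.div_lt_of_lt_mul hx.1)
  · intro y _
    exact Nat.mul_div_cancel_left y hd
  · intro x hx
    exact Nat.mul_div_cancel' (mem_filter.mp hx).2
  · simp

theorem sum_coprime_eq_sum_moebius (c : ℕ) (hc : 0 < c) (g : ℕ → ℂ) :
    ∑ x ∈ (range c).filter (fun x => Nat.gcd x c = 1), g x =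
      ∑ d ∈ c.divisors, (ArithmeticFunction.moebius d : ℂ) * ∑ y ∈ range (c / d), g (d * y) := by
  have key (x : ℕ) : (if Nat.gcd x c = 1 then g x else 0) =
      ∑ d ∈ c.divisors, (ArithmeticFunction.moebius d : ℂ) * (if d ∣ x then g x else 0) := by
    have hg : Nat.gcd x c ≠ 0 := (Nat.gcd_pos_of_pos_right x hc).ne'
    have hdiv : (Nat.gcd x c).divisors = c.divisors.filter (fun d => d ∣ x) := by
      ext d
      simp only [Nat.mem_divisors, mem_filter, Nat.dvd_gcd_iff, hg, hc.ne', ne_eq, not_false_eq_true,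
        and_true]
      exact and_comm
    have h := congrArg (fun z : ℤ => (z : ℂ) * g x) (sum_divisors_moebius (Nat.gcd x c))
    rw [hdiv] at h
    simp only [sum_filter] at h
    push_cast [sum_mul, ite_mul, mul_ite] at h
    simpa using h.symm
  rw [sum_filter]
  simp_rw [key]
  rw [sum_comm]
  refine sum_congr rfl fun d hd => ?_
  have hdc := Nat.dvd_of_mem_divisors hd
  rw [← mul_sum, ← sum_range_mul_ite_dvd d (c / d) (Nat.pos_of_dvd_of_pos hdc hc) g,
    Nat.mul_div_cancel' hdc]

theorem sum_range_mul_of_periodic {M : Type*} [AddCommMonoid M] (d N : ℕ) (g : ℕ → M)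
    (hg : Function.Periodic g N) :
    ∑ x ∈ range (d * N), g x = d • ∑ x ∈ range N, g x := by
  induction d with
  | zero => simp
  | succ d ih =>
    rw [Nat.succ_mul, sum_range_add, ih, succ_nsmul]
    congr 1
    refine sum_congr rfl fun x _ => ?_
    rw [add_comm]
    exact hg.nat_mul d x

/-- Completing the square: `b = 2a + n` matches the square roots of the discriminant modulo `4N`
with the roots of `a² + an + m` modulo `N`. -/
theorem rho_discriminant (N : ℕ) (hN : 0 < N) (m n : ℤ) :
    rho N (n ^ 2 - 4 * m) =
      ((range N).filter (fun a : ℕ => (N : ℤ) ∣ (a : ℤ) ^ 2 + a * n + m)).card := by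
  have hN' : (0 : ℤ) < 2 * N := by positivity
  rw [rho]
  symm
  refine card_bij (fun a _ => ((2 * (a : ℤ) + n) % (2 * N)).toNat) ?_ ?_ ?_
  · intro a ha
    rw [mem_filter, mem_range] at ha ⊢
    obtain ⟨k, hk⟩ := ha.2
    have h0 := Int.emod_nonneg (2 * (a : ℤ) + n) hN'.ne'
    have h1 := Int.emod_lt_of_pos (2 * (a : ℤ) + n) hN'
    have h2 := Int.emod_add_mul_ediv (2 * (a : ℤ) + n) (2 * N)
    refine ⟨by omega, ?_⟩
    rw [Int.toNat_of_nonneg h0]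
    apply Int.emod_eq_zero_of_dvd
    set q := (2 * (a : ℤ) + n) / (2 * N)
    set r := (2 * (a : ℤ) + n) % (2 * N)
    have hr : r = 2 * a + n - 2 * N * q := by linarith
    refine ⟨k - (2 * a + n) * q + N * q ^ 2, ?_⟩
    rw [hr]
    linear_combination 4 * hk
  · intro a ha b hb hab
    rw [mem_filter, mem_range] at ha hb
    have h0 := Int.emod_nonneg (2 * (a : ℤ) + n) hN'.ne'
    have h1 := Int.emod_nonneg (2 * (b : ℤ) + n) hN'.ne'
    have hab' : (2 * (a : ℤ) + n) % (2 * N) = (2 * (b : ℤ) + n) % (2 * N) := by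
      omega
    have hmod : 2 * (a : ℤ) ≡ 2 * b [ZMOD 2 * N] := Int.ModEq.add_right_cancel' n hab'
    have hmod' : (a : ℤ) ≡ b [ZMOD N] := Int.ModEq.mul_left_cancel' two_ne_zero hmod
    exact Nat.ModEq.eq_of_lt_of_lt (Int.natCast_modEq_iff.mp hmod') ha.1 hb.1
  · intro b hb
    rw [mem_filter, mem_range] at hb
    obtain ⟨hb1, hb2⟩ := hb
    obtain ⟨k, hk⟩ := Int.dvd_of_emod_eq_zero hb2
    have hpar : Even ((b : ℤ) - n) := by
      have : Even (((b : ℤ) - n) * (b + n)) := ⟨2 * (N * k - m), by linear_combination hk⟩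
      rcases Int.even_mul.mp this with h | h
      · exact h
      · simpa [Int.even_add, Int.even_sub] using h
    obtain ⟨t, ht⟩ := hpar
    have hN0 : (0 : ℤ) < N := by exact_mod_cast hN
    have h0 := Int.emod_nonneg t hN0.ne'
    have h1 := Int.emod_lt_of_pos t hN0
    have h2 := Int.emod_add_mul_ediv t N
    set q := t / (N : ℤ)
    have hr : t % N = t - N * q := by linarith
    refine ⟨(t % N).toNat, ?_, ?_⟩
    · rw [mem_filter, mem_range, Int.toNat_of_nonneg h0]
      refine ⟨by omega, k - q * (2 * t + n) + N * q ^ 2, ?_⟩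
      rw [hr]
      have hb' : (b : ℤ) = 2 * t + n := by linarith
      rw [hb'] at hk
      linarith
    · rw [Int.toNat_of_nonneg h0]
      have : (2 * (t % N) + n) % (2 * N) = (b : ℤ) := by
        have : 2 * (t % N) + n = b + 2 * N * (-q) := by rw [hr]; linarith
        rw [this, Int.add_mul_emod_self_left]
        exact Int.emod_eq_of_lt (by positivity) (by exact_mod_cast hb1)
      rw [this, Int.toNat_natCast]

/-- Substituting `a ↦ ax` in the sum over `a` removes the inverse of the unit `x`. -/
theorem sum_eC_inv (c : ℕ) (hc : 0 < c) (m n : ℤ) (x : ℕ) (hx : Nat.gcd x c = 1) :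
    ∑ a ∈ range c, eC (((m : ℂ) * x + ((a : ℤ) ^ 2 : ℤ) * (((x : ZMod c)⁻¹).val : ℕ)) / c) *
        eC ((a : ℂ) * (n : ℂ) / (c : ℂ)) =
      ∑ a ∈ range c, eC (((x * ((a : ℤ) ^ 2 + a * n + m) : ℤ) : ℂ) / c) := by
  have : NeZero c := ⟨hc.ne'⟩
  have hxu : (x : ZMod c) * (x : ZMod c)⁻¹ = 1 := ZMod.coe_mul_inv_eq_one x hx
  have hl (a : ℕ) : eC (((m : ℂ) * x + ((a : ℤ) ^ 2 : ℤ) * (((x : ZMod c)⁻¹).val : ℕ)) / c) *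
        eC ((a : ℂ) * (n : ℂ) / (c : ℂ)) =
      ZMod.stdAddChar ((m : ZMod c) * (x : ZMod c) + (a : ZMod c) ^ 2 * (x : ZMod c)⁻¹ +
        (a : ZMod c) * (n : ZMod c)) := by
    have h1 := eC_div_eq_stdAddChar c (m * x + (a : ℤ) ^ 2 * (((x : ZMod c)⁻¹).val : ℕ))
    have h2 := eC_div_eq_stdAddChar c (a * n)
    push_cast at h1 h2 ⊢
    rw [h1, h2, ← AddChar.map_add_eq_mul, ZMod.natCast_zmod_val]
  simp_rw [hl, eC_div_eq_stdAddChar]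
  push_cast
  rw [sum_range_eq_sum_zmod c (fun a : ZMod c =>
      ZMod.stdAddChar ((m : ZMod c) * (x : ZMod c) + a ^ 2 * (x : ZMod c)⁻¹ + a * (n : ZMod c))),
    sum_range_eq_sum_zmod c (fun a : ZMod c =>
      ZMod.stdAddChar ((x : ZMod c) * (a ^ 2 + a * (n : ZMod c) + (m : ZMod c))))]
  refine (Fintype.sum_equiv (Units.mulRight (ZMod.unitOfCoprime x hx)) _ _ fun a => ?_).symm
  rw [Units.mulRight_apply, ZMod.coe_unitOfCoprime]
  congr 1
  linear_combination (-(a ^ 2 * x)) * hxu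

open ArithmeticFunction in
/-- `∑_{a mod c} S(m, a²; c) e(an/c) = c ∑_{d|c} μ(d) ρ(c/d, n² - 4m)`. -/
theorem statement_1 (c : ℕ) (hc : 1 ≤ c) (m n : ℤ) :
    ∑ a ∈ Finset.range c, kloosterman m ((a : ℤ) ^ 2) c * eC ((a : ℂ) * (n : ℂ) / (c : ℂ)) =
      (c : ℂ) * ∑ d ∈ c.divisors, (moebius d : ℂ) * (rho (c / d) (n ^ 2 - 4 * m) : ℂ) := by
  have hmain : ∑ a ∈ range c, kloosterman m ((a : ℤ) ^ 2) c * eC ((a : ℂ) * (n : ℂ) / (c : ℂ)) =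
      ∑ x ∈ (range c).filter (fun x => Nat.gcd x c = 1),
        ∑ a ∈ range c, eC (((x * ((a : ℤ) ^ 2 + a * n + m) : ℤ) : ℂ) / c) := by
    simp_rw [kloosterman, sum_mul]
    rw [sum_comm]
    exact sum_congr rfl fun x hx => sum_eC_inv c hc m n x (mem_filter.mp hx).2
  rw [hmain, sum_coprime_eq_sum_moebius c hc, mul_sum]
  refine sum_congr rfl fun d hd => ?_
  obtain ⟨N, rfl⟩ := Nat.dvd_of_mem_divisors hd
  have hd0 : 0 < d := Nat.pos_of_mul_pos_right hc
  have hN0 : 0 < N := Nat.pos_of_mul_pos_left hc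
  have hd0' : (d : ℂ) ≠ 0 := by exact_mod_cast hd0.ne'
  rw [Nat.mul_div_cancel_left N hd0, rho_discriminant N hN0, sum_comm]
  have hinner (a : ℕ) : ∑ y ∈ range N,
      eC ((((d * y : ℕ) * ((a : ℤ) ^ 2 + a * n + m) : ℤ) : ℂ) / (d * N : ℕ)) =
      if (N : ℤ) ∣ (a : ℤ) ^ 2 + a * n + m then (N : ℂ) else 0 := by
    rw [← sum_range_eC N hN0]
    refine sum_congr rfl fun y _ => ?_
    congr 1
    push_cast
    rw [mul_assoc, mul_div_mul_left _ _ hd0']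
  simp_rw [hinner]
  rw [sum_range_mul_of_periodic, ← sum_filter, sum_const, nsmul_eq_mul, nsmul_eq_mul]
  · push_cast
    ring
  · intro a
    have : (N : ℤ) ∣ ((a + N : ℕ) : ℤ) ^ 2 + ((a + N : ℕ) : ℤ) * n + m ↔
        (N : ℤ) ∣ (a : ℤ) ^ 2 + a * n + m := by
      rw [show ((a + N : ℕ) : ℤ) ^ 2 + ((a + N : ℕ) : ℤ) * n + m =
        ((a : ℤ) ^ 2 + a * n + m) + N * (2 * a + N + n) by push_cast; ring]
      exact dvd_add_left (dvd_mul_right _ _)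
    simp only [this]
end

section
/- Fix a complex number s with σ = Re(s), and fix ε > 0. There exists a constant C > 0 with the following property: for every integer Δ that is not the square of an integer, and for every entire function F : ℂ → ℂ satisfying F(z) = (ζ(2z)/ζ(z)) · ∑_{c ≥ 1} ρ(c, Δ) c^{-z} for all z with Re(z) > 3/2 (ζ denoting the Riemann zeta function), one has |F(s)| ≤ C · |Δ|^{max{0, 1/2 − σ/2, 1/2 − σ} + ε}. -/
open Complex Finset

lemma exists_two_mul_add_one_le_mul_rpow {ε : ℝ} (hε : 0 < ε) :
    ∃ K : ℝ, 1 ≤ K ∧ ∀ p m : ℕ, 2 ≤ p → (2 * m + 1 : ℝ) ≤ K * ((p : ℝ) ^ m) ^ ε := by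
  have hl : 0 < Real.log 2 := Real.log_pos one_lt_two
  refine ⟨max 1 (2 / (ε * Real.log 2)), le_max_left _ _, fun p m hp => ?_⟩
  set K := max 1 (2 / (ε * Real.log 2)) with hK
  have h1 : 1 + ε * Real.log 2 * m ≤ ((p : ℝ) ^ m) ^ ε := by
    have hp' : (2 : ℝ) ≤ p := by exact_mod_cast hp
    have : ((2 : ℝ) ^ m) ^ ε ≤ ((p : ℝ) ^ m) ^ ε := by gcongr
    refine le_trans ?_ this
    rw [← Real.rpow_natCast, ← Real.rpow_mul (by norm_num), Real.rpow_def_of_pos (by norm_num)]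
    have := Real.add_one_le_exp (Real.log 2 * (m * ε))
    linarith
  have hK1 : 1 ≤ K := le_max_left _ _
  have hK2 : 2 ≤ K * (ε * Real.log 2) := by
    rw [← div_le_iff₀ (by positivity)]; exact le_max_right _ _
  have hm : (0 : ℝ) ≤ m := by positivity
  calc (2 * m + 1 : ℝ) ≤ K * (1 + ε * Real.log 2 * m) := by nlinarith
    _ ≤ _ := by gcongr

/-- A form of the divisor bound: the left-hand side is the number of divisors of `n ^ 2`. -/
lemma exists_prod_two_mul_factorization_add_one_le {ε : ℝ} (hε : 0 < ε) :
    ∃ C : ℝ, 1 ≤ C ∧ ∀ n : ℕ, n ≠ 0 →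
      ∏ p ∈ n.primeFactors, (2 * n.factorization p + 1 : ℝ) ≤ C * (n : ℝ) ^ ε := by
  obtain ⟨K, hK, hKm⟩ := exists_two_mul_add_one_le_mul_rpow hε
  obtain ⟨P, hP⟩ : ∃ P : ℕ, ∀ p : ℕ, P ≤ p → (3 : ℝ) ≤ (p : ℝ) ^ ε := by
    have := ((tendsto_rpow_atTop hε).comp tendsto_natCast_atTop_atTop).eventually_ge_atTop 3
    simpa using Filter.eventually_atTop.1 this
  refine ⟨K ^ P, one_le_pow₀ hK, fun n hn => ?_⟩
  have hloc : ∀ p ∈ n.primeFactors, (2 * n.factorization p + 1 : ℝ) ≤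
      (if p < P then K else 1) * ((p : ℝ) ^ n.factorization p) ^ ε := by
    intro p hp
    split_ifs with h
    · exact hKm p _ (Nat.prime_of_mem_primeFactors hp).two_le
    · rw [one_mul, ← Real.rpow_natCast, ← Real.rpow_mul (by positivity), mul_comm (_ : ℝ) ε,
        Real.rpow_mul (by positivity), Real.rpow_natCast]
      have h3 := hP p (not_lt.1 h)
      calc (2 * n.factorization p + 1 : ℝ) ≤ (1 + 2) ^ n.factorization p := by
            have := one_add_mul_le_pow (show (-2 : ℝ) ≤ 2 by norm_num) (n.factorization p)
            linarith
        _ ≤ _ := by gcongr; linarith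
  refine (prod_le_prod (fun _ _ => by positivity) hloc).trans ?_
  rw [prod_mul_distrib, Real.finsetProd_rpow _ _ (fun _ _ => by positivity)]
  have hn' : (∏ p ∈ n.primeFactors, (p : ℝ) ^ n.factorization p) = n := by
    have := Nat.prod_factorization_pow_eq_self hn
    rw [Nat.prod_factorization_eq_prod_primeFactors] at this
    exact_mod_cast this
  rw [hn']
  gcongr
  rw [prod_ite, prod_const_one, mul_one, prod_const]
  refine pow_le_pow_right₀ hK ?_
  refine (card_le_card (t := range P) fun p hp => ?_).trans (card_range P).le
  exact mem_range.2 (mem_filter.1 hp).2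

lemma DirichletCharacter.IsPrimitive.norm_gaussSum {N : ℕ} [NeZero N]
    {χ : DirichletCharacter ℂ N} (hχ : χ.IsPrimitive) :
    ‖gaussSum χ ZMod.stdAddChar‖ = √N := by
  set g := gaussSum χ ZMod.stdAddChar with hg
  have hF : ZMod.dft (fun j => χ j) = fun k => (χ⁻¹ (-1) * g) * χ⁻¹ k := by
    ext k
    rw [hχ.fourierTransform_eq_inv_mul_gaussSum, ← neg_one_mul k, map_mul]
    ring
  have h1 : ZMod.dft (fun k => χ⁻¹ k) 1 = star g := by
    rw [DirichletCharacter.fourierTransform_eq_gaussSum_mulShift, hg, star_gaussSum_eq]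
    congr 1
    ext x
    simp [AddChar.mulShift_apply, AddChar.inv_apply]
  have h2 : ZMod.dft (ZMod.dft (fun j => χ j)) 1 = (χ⁻¹ (-1) * g) * star g := by
    rw [hF, ZMod.dft_const_mul, ← h1]
  rw [ZMod.dft_dft] at h2
  have hunit : IsUnit (-1 : ZMod N) := isUnit_one.neg
  have h3 := congrArg norm h2
  rw [norm_smul, norm_mul, norm_mul, norm_star, Complex.norm_natCast] at h3
  have e1 : ‖χ (-1)‖ = 1 := by simpa using χ.unit_norm_eq_one hunit.unit
  have e2 : ‖χ⁻¹ (-1)‖ = 1 := by simpa using (χ⁻¹).unit_norm_eq_one hunit.unit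
  rw [e1, e2, mul_one, one_mul] at h3
  rw [h3, Real.sqrt_mul_self (norm_nonneg _)]

lemma norm_sum_range_pow_le {w : ℂ} (hw : ‖w‖ = 1) (h1 : w ≠ 1) (M : ℕ) :
    ‖∑ n ∈ range M, w ^ n‖ ≤ 2 / ‖w - 1‖ := by
  rw [geom_sum_eq h1, norm_div]
  gcongr
  calc ‖w ^ M - 1‖ ≤ ‖w ^ M‖ + ‖(1 : ℂ)‖ := norm_sub_le _ _
    _ = 2 := by rw [norm_pow, hw]; norm_num

lemma two_div_norm_exp_sub_one_le {N k : ℕ} (hk : 0 < k) (hkN : k < N) :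
    2 / ‖exp (2 * Real.pi * I * k / N) - 1‖ ≤ (N / 2 : ℝ) * ((k : ℝ)⁻¹ + ((N - k : ℕ) : ℝ)⁻¹) := by
  have hN : (0 : ℝ) < N := by exact_mod_cast hk.trans hkN
  have hk' : (0 : ℝ) < k := by exact_mod_cast hk
  have hkN' : (0 : ℝ) < (N : ℝ) - k := by rw [sub_pos]; exact_mod_cast hkN
  have e : exp (2 * Real.pi * I * k / N) = exp (I * ((2 * (Real.pi * (k / N)) : ℝ) : ℂ)) := by
    congr 1; push_cast; ring
  rw [e, Complex.norm_exp_I_mul_ofReal_sub_one, Nat.cast_sub hkN.le]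
  have e2 : 2 * (Real.pi * ((k : ℝ) / N)) / 2 = Real.pi * (k / N) := by ring
  rw [e2, Real.norm_eq_abs, abs_mul, abs_two]
  have hpi := Real.pi_pos
  have main : ∀ x : ℝ, 0 < x → x ≤ N / 2 →
      2 / (2 * |Real.sin (Real.pi * (x / N))|) ≤ (N / 2 : ℝ) * x⁻¹ := by
    intro x hx hx2
    have h := Real.mul_le_sin (x := Real.pi * (x / N)) (by positivity) (by
      have : x / N ≤ 1 / 2 := by rw [div_le_iff₀ hN]; linarith
      nlinarith)
    have e3 : 2 / Real.pi * (Real.pi * (x / N)) = 2 * x / N := by field_simp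
    rw [e3] at h
    have h' := h.trans (le_abs_self _)
    calc 2 / (2 * |Real.sin (Real.pi * (x / N))|) ≤ 2 / (2 * (2 * x / N)) := by gcongr
      _ = _ := by field_simp
  rcases le_total (k : ℝ) (N / 2) with h | h
  · refine (main k hk' h).trans ?_
    have : 0 < ((N : ℝ) - k)⁻¹ := by positivity
    gcongr; linarith
  · have h2 := main (N - k) hkN' (by linarith)
    have e4 : Real.sin (Real.pi * (((N : ℝ) - k) / N)) = Real.sin (Real.pi * (k / N)) := by
      rw [← Real.sin_pi_sub]; congr 1; field_simp; ring
    rw [e4] at h2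
    refine h2.trans ?_
    have : 0 < (k : ℝ)⁻¹ := by positivity
    gcongr; linarith

lemma sum_two_div_norm_exp_sub_one_le (N : ℕ) :
    ∑ k ∈ Ico 1 N, 2 / ‖exp (2 * Real.pi * I * k / N) - 1‖ ≤ N * (1 + Real.log N) := by
  have hharm : ∑ k ∈ Ico 1 N, (k : ℝ)⁻¹ ≤ 1 + Real.log N := by
    have h := harmonic_le_one_add_log N
    rw [harmonic_eq_sum_Icc] at h
    push_cast at h
    refine le_trans (sum_le_sum_of_subset_of_nonneg ?_ fun _ _ _ => by positivity) h
    intro k hk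
    rw [mem_Ico] at hk; rw [mem_Icc]; omega
  have hrefl : ∑ k ∈ Ico 1 N, ((N - k : ℕ) : ℝ)⁻¹ = ∑ k ∈ Ico 1 N, (k : ℝ)⁻¹ := by
    refine sum_bij' (fun k _ => N - k) (fun k _ => N - k) ?_ ?_ ?_ ?_ ?_ <;>
      intro k hk <;> rw [mem_Ico] at * <;> omega
  calc _ ≤ ∑ k ∈ Ico 1 N, (N / 2 : ℝ) * ((k : ℝ)⁻¹ + ((N - k : ℕ) : ℝ)⁻¹) :=
        sum_le_sum fun k hk => two_div_norm_exp_sub_one_le (mem_Ico.1 hk).1 (mem_Ico.1 hk).2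
    _ = N * ∑ k ∈ Ico 1 N, (k : ℝ)⁻¹ := by
        rw [← mul_sum, sum_add_distrib, hrefl]; ring
    _ ≤ _ := by gcongr

/-- The **Pólya–Vinogradov inequality** for primitive characters. -/
lemma DirichletCharacter.IsPrimitive.norm_sum_range_le {N : ℕ} [NeZero N]
    {χ : DirichletCharacter ℂ N} (hχ : χ.IsPrimitive) (hN : N ≠ 1) (M : ℕ) :
    ‖∑ n ∈ range M, χ n‖ ≤ √N * (1 + Real.log N) := by
  have hN0 : (0 : ℝ) < N := by exact_mod_cast NeZero.pos N
  set g := gaussSum χ ZMod.stdAddChar with hg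
  have hunit : IsUnit (-1 : ZMod N) := isUnit_one.neg
  have hneg : ‖χ (-1)‖ = 1 := by simpa using χ.unit_norm_eq_one hunit.unit
  have key : ∀ n : ℕ, (N : ℂ) * (χ (-1) * χ n) =
      ∑ k : ZMod N, ZMod.stdAddChar (-k) ^ n * (χ⁻¹ (-k) * g) := by
    intro n
    have h := congrFun (ZMod.dft_dft (fun j => χ j)) (n : ZMod N)
    rw [ZMod.dft_apply] at h
    simp only [smul_eq_mul, hχ.fourierTransform_eq_inv_mul_gaussSum] at h
    rw [← map_mul, neg_one_mul, ← h]
    refine sum_congr rfl fun k _ => ?_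
    rw [← AddChar.map_nsmul_eq_pow, nsmul_eq_mul, mul_neg, mul_comm k]
  have key2 : (N : ℂ) * (χ (-1) * ∑ n ∈ range M, χ n) =
      ∑ k : ZMod N, (∑ n ∈ range M, ZMod.stdAddChar (-k) ^ n) * (χ⁻¹ (-k) * g) := by
    rw [mul_sum, mul_sum, sum_congr rfl fun n _ => key n, sum_comm]
    exact sum_congr rfl fun k _ => (sum_mul _ _ _).symm
  have bound : ∀ k : ZMod N, ‖(∑ n ∈ range M, ZMod.stdAddChar (-k) ^ n) * (χ⁻¹ (-k) * g)‖ ≤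
      √N * if k = 0 then 0 else 2 / ‖ZMod.stdAddChar (-k) - 1‖ := by
    intro k
    split_ifs with hk
    · have : Nontrivial (ZMod N) := ZMod.nontrivial_iff.2 hN
      simp [hk, MulChar.map_zero]
    · rw [norm_mul, norm_mul, hg, hχ.norm_gaussSum, mul_comm]
      have h1 : ‖χ⁻¹ (-k)‖ ≤ 1 := (χ⁻¹).norm_le_one _
      have h2 := norm_sum_range_pow_le (w := ZMod.stdAddChar (-k)) (by simp) (by
        rw [← (ZMod.stdAddChar (N := N)).map_zero_eq_one, ZMod.injective_stdAddChar.ne_iff]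
        simpa using hk) M
      gcongr
      exact mul_le_of_le_one_left (by positivity) h1
  have h3 : (N : ℝ) * ‖∑ n ∈ range M, χ n‖ ≤ √N * (N * (1 + Real.log N)) := by
    have := congrArg norm key2
    rw [norm_mul, norm_mul, hneg, one_mul, Complex.norm_natCast] at this
    rw [this]
    refine (norm_sum_le _ _).trans ((sum_le_sum fun k _ => bound k).trans ?_)
    rw [← mul_sum]
    gcongr
    rw [← Equiv.sum_comp (Equiv.neg (ZMod N))]
    simp only [Equiv.neg_apply, neg_neg, neg_eq_zero]
    refine le_trans (le_of_eq ?_) (sum_two_div_norm_exp_sub_one_le N)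
    rw [sum_ite, sum_const_zero, zero_add]
    refine sum_bij (fun k _ => k.val) ?_ ?_ ?_ ?_
    · intro k hk
      rw [mem_filter] at hk
      exact mem_Ico.2 ⟨Nat.pos_of_ne_zero ((ZMod.val_ne_zero k).2 hk.2), k.val_lt⟩
    · intro a _ b _ h
      exact ZMod.val_injective N h
    · intro b hb
      rw [mem_Ico] at hb
      refine ⟨b, ?_, ZMod.val_cast_of_lt hb.2⟩
      rw [mem_filter]
      refine ⟨mem_univ _, fun h => ?_⟩
      rw [ZMod.natCast_eq_zero_iff] at h
      exact absurd (Nat.le_of_dvd hb.1 h) (by omega)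
    · intro k _
      have := ZMod.stdAddChar_coe (N := N) (k.val : ℤ)
      simp only [Int.cast_natCast, ZMod.natCast_zmod_val] at this
      rw [this]
  have h4 : (N : ℝ) * ‖∑ n ∈ range M, χ n‖ ≤ N * (√N * (1 + Real.log N)) := by linarith
  exact le_of_mul_le_mul_left h4 hN0

lemma norm_natCast_cpow_neg_sub_le (s : ℂ) (hs : 0 ≤ s.re) {n : ℕ} (hn : 0 < n) :
    ‖(n : ℂ) ^ (-s) - ((n + 1 : ℕ) : ℂ) ^ (-s)‖ ≤ ‖s‖ * (n : ℝ) ^ (-s.re - 1) := by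
  rcases eq_or_ne s 0 with rfl | h0
  · simp
  have hn' : (0 : ℝ) < n := by exact_mod_cast hn
  have h := Convex.norm_image_sub_le_of_norm_hasDerivWithin_le
    (f := fun x : ℝ => (x : ℂ) ^ (-s)) (f' := fun x : ℝ => (-s) * (x : ℂ) ^ (-s - 1))
    (s := Set.Icc (n : ℝ) (n + 1)) (C := ‖s‖ * (n : ℝ) ^ (-s.re - 1)) (x := (n + 1 : ℝ))
    (y := (n : ℝ)) ?_ ?_ (convex_Icc _ _) (by simp) (by simp)
  · simpa using h
  · intro x hx
    have hx0 : 0 < x := hn'.trans_le hx.1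
    exact (hasDerivAt_ofReal_cpow_const hx0.ne' (neg_ne_zero.2 h0)).hasDerivWithinAt
  · intro x hx
    have hx0 : 0 < x := hn'.trans_le hx.1
    rw [norm_mul, norm_neg, norm_cpow_eq_rpow_re_of_pos hx0]
    gcongr
    simp only [sub_re, neg_re, one_re]
    exact Real.rpow_le_rpow_of_nonpos hn' hx.1 (by linarith)

section

variable {N : ℕ} (χ : DirichletCharacter ℂ N)

/-- The summand of the series obtained from a Dirichlet series by summation by parts. -/
noncomputable def partialSummand (n : ℕ) (s : ℂ) : ℂ :=
  (∑ k ∈ range (n + 2), χ k) * (((n + 1 : ℕ) : ℂ) ^ (-s) - ((n + 2 : ℕ) : ℂ) ^ (-s))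

lemma norm_partialSummand_le {B : ℝ} (hB : ∀ M, ‖∑ k ∈ range M, χ k‖ ≤ B) (n : ℕ) {s : ℂ}
    (hs : 0 ≤ s.re) :
    ‖partialSummand χ n s‖ ≤ B * (‖s‖ * ((n + 1 : ℕ) : ℝ) ^ (-s.re - 1)) := by
  rw [partialSummand, norm_mul]
  have := norm_natCast_cpow_neg_sub_le s hs n.succ_pos
  have h0 := (norm_nonneg _).trans (hB 0)
  exact mul_le_mul (hB _) this (norm_nonneg _) h0

lemma sum_range_char_mul_cpow (h0 : χ 0 = 0) (s : ℂ) (M : ℕ) :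
    ∑ n ∈ range (M + 1), χ n * (n : ℂ) ^ (-s) =
      (∑ k ∈ range (M + 1), χ k) * ((M + 1 : ℕ) : ℂ) ^ (-s) +
        ∑ n ∈ range M, partialSummand χ n s := by
  induction M with
  | zero => simp [h0]
  | succ M ih =>
    rw [sum_range_succ, ih, sum_range_succ (partialSummand χ · s), partialSummand,
      sum_range_succ _ (M + 1)]
    push_cast
    ring_nf

lemma summable_natCast_succ_rpow {a : ℝ} (ha : a < -1) :
    Summable fun n : ℕ => ((n + 1 : ℕ) : ℝ) ^ a :=
  (summable_nat_add_iff 1).2 (Real.summable_nat_rpow.2 ha)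

variable [NeZero N]

lemma LFunction_eq_tsum_partialSummand_of_one_lt_re (hχ : χ ≠ 1) {B : ℝ}
    (hB : ∀ M, ‖∑ k ∈ range M, χ k‖ ≤ B) {s : ℂ} (hs : 1 < s.re) :
    χ.LFunction s = ∑' n, partialSummand χ n s := by
  have hN : N ≠ 1 := hχ ∘ DirichletCharacter.level_one' _
  have : Nontrivial (ZMod N) := ZMod.nontrivial_iff.2 hN
  have h0 : χ 0 = 0 := MulChar.map_zero χ
  have hs0 : s ≠ 0 := by rintro rfl; norm_num at hs
  have hsum : Summable fun n => partialSummand χ n s := by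
    refine Summable.of_norm_bounded (((summable_natCast_succ_rpow (a := -s.re - 1)
      (by linarith)).mul_left ‖s‖).mul_left B) fun n => norm_partialSummand_le χ hB n (by linarith)
  have h1 : Filter.Tendsto (fun M : ℕ => ∑ n ∈ range (M + 1), χ n * (n : ℂ) ^ (-s)) Filter.atTop
      (nhds (χ.LFunction s)) := by
    rw [DirichletCharacter.LFunction_eq_LSeries χ hs]
    have := (DirichletCharacter.LSeriesSummable_of_one_lt_re χ hs).hasSum.tendsto_sum_nat
    refine ((Filter.tendsto_add_atTop_iff_nat 1).2 this).congr fun M => sum_congr rfl fun n _ => ?_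
    rcases eq_or_ne n 0 with rfl | hn
    · simp [h0]
    · rw [LSeries.term_of_ne_zero hn, cpow_neg, div_eq_mul_inv]
  have h2 : Filter.Tendsto (fun M : ℕ => (∑ k ∈ range (M + 1), χ k) * ((M + 1 : ℕ) : ℂ) ^ (-s))
      Filter.atTop (nhds 0) := by
    have h3 : Filter.Tendsto (fun M : ℕ => B * ((M + 1 : ℕ) : ℝ) ^ (-s.re)) Filter.atTop
        (nhds 0) := by
      have := (tendsto_rpow_neg_atTop (y := s.re) (by linarith)).comp
        (tendsto_natCast_atTop_atTop.comp (Filter.tendsto_add_atTop_nat 1))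
      simpa using this.const_mul B
    refine squeeze_zero_norm (fun M => ?_) h3
    rw [norm_mul, norm_natCast_cpow_of_pos M.succ_pos, neg_re]
    gcongr
    exact hB _
  have h4 := h2.add hsum.hasSum.tendsto_sum_nat
  rw [zero_add] at h4
  exact tendsto_nhds_unique h1 (h4.congr fun M => (sum_range_char_mul_cpow χ h0 s M).symm)

lemma LFunction_eq_tsum_partialSummand (hχ : χ ≠ 1) {B : ℝ}
    (hB : ∀ M, ‖∑ k ∈ range M, χ k‖ ≤ B) {s : ℂ} (hs : 0 < s.re) :
    χ.LFunction s = ∑' n, partialSummand χ n s := by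
  set U : Set ℂ := {z | s.re / 2 < z.re} ∩ Metric.ball 0 (‖s‖ + 3) with hU
  have hUo : IsOpen U := (isOpen_lt continuous_const continuous_re).inter Metric.isOpen_ball
  have hUc : Convex ℝ U := (convex_halfSpace_re_gt _).inter (convex_ball _ _)
  have hB0 := (norm_nonneg _).trans (hB 0)
  have hd : DifferentiableOn ℂ (fun z => ∑' n, partialSummand χ n z) U := by
    refine differentiableOn_tsum_of_summable_norm
      (u := fun n : ℕ => B * ((‖s‖ + 3) * ((n + 1 : ℕ) : ℝ) ^ (-(s.re / 2) - 1))) ?_ ?_ hUo ?_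
    · exact ((summable_natCast_succ_rpow (by linarith)).mul_left _).mul_left _
    · intro n
      have h1 : NeZero (((n + 1 : ℕ) : ℂ)) := ⟨by exact_mod_cast n.succ_ne_zero⟩
      have h2 : NeZero (((n + 2 : ℕ) : ℂ)) := ⟨by exact_mod_cast (n + 1).succ_ne_zero⟩
      unfold partialSummand
      fun_prop
    · intro n z hz
      have hz1 : s.re / 2 < z.re := hz.1
      have hz2 : ‖z‖ < ‖s‖ + 3 := by simpa using hz.2
      refine (norm_partialSummand_le χ hB n (by linarith)).trans ?_
      gcongr
      exact_mod_cast Nat.le_add_left 1 n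
  have hs2 : s + 2 ∈ U := by
    refine ⟨by simp; linarith, ?_⟩
    simp only [mem_ball_zero_iff]
    refine (norm_add_le _ _).trans_lt ?_
    norm_num
  have hsU : s ∈ U := ⟨by simp; linarith, by simp⟩
  refine AnalyticOnNhd.eqOn_of_preconnected_of_eventuallyEq
    ((DirichletCharacter.differentiable_LFunction hχ).differentiableOn.analyticOnNhd hUo)
    (hd.analyticOnNhd hUo) hUc.isPreconnected hs2 ?_ hsU
  have : {z : ℂ | 1 < z.re} ∈ nhds (s + 2) :=
    (isOpen_lt continuous_const continuous_re).mem_nhds (by simp; linarith)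
  filter_upwards [this] with z hz
  exact LFunction_eq_tsum_partialSummand_of_one_lt_re χ hχ hB hz

lemma norm_LFunction_le_of_norm_sum_le (hχ : χ ≠ 1) {B : ℝ}
    (hB : ∀ M, ‖∑ k ∈ range M, χ k‖ ≤ B) {s : ℂ} {θ : ℝ} (h0 : 0 ≤ θ)
    (h1 : θ ≤ 1) (hθ : θ < s.re) :
    ‖χ.LFunction s‖ ≤
      B ^ (1 - θ) * (2 * ‖s‖ * ∑' n : ℕ, ((n + 1 : ℕ) : ℝ) ^ (θ - s.re - 1)) := by
  have hN : N ≠ 1 := hχ ∘ DirichletCharacter.level_one' _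
  have : Nontrivial (ZMod N) := ZMod.nontrivial_iff.2 hN
  have hz : χ 0 = 0 := MulChar.map_zero χ
  rw [LFunction_eq_tsum_partialSummand χ hχ hB (h0.trans_lt hθ)]
  have hB0 := (norm_nonneg _).trans (hB 0)
  have hS : Summable fun n : ℕ => ((n + 1 : ℕ) : ℝ) ^ (θ - s.re - 1) :=
    summable_natCast_succ_rpow (by linarith)
  rw [← tsum_mul_left, ← tsum_mul_left]
  refine tsum_of_norm_bounded ((hS.mul_left _).mul_left _).hasSum fun n => ?_
  rw [partialSummand, norm_mul]
  have hn : (0 : ℝ) < ((n + 1 : ℕ) : ℝ) := by positivity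
  have htriv : ‖∑ k ∈ range (n + 2), χ k‖ ≤ ((n + 2 : ℕ) : ℝ) := by
    refine (norm_sum_le _ _).trans ((sum_le_sum fun (k : ℕ) _ => χ.norm_le_one (k : ZMod N)).trans ?_)
    simp
  have hS1 : ‖∑ k ∈ range (n + 2), χ k‖ ≤ B ^ (1 - θ) * (2 * ((n + 1 : ℕ) : ℝ) ^ θ) := by
    set S := ‖∑ k ∈ range (n + 2), χ k‖ with hSdef
    have hS0 : 0 ≤ S := norm_nonneg _
    have e : S = S ^ (1 - θ) * S ^ θ := by
      rcases hS0.eq_or_lt with h | h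
      · rw [← h]
        rcases h0.eq_or_lt with h' | h'
        · simp [← h']
        · rw [Real.zero_rpow h'.ne', mul_zero]
      · rw [← Real.rpow_add h]; simp
    rw [e]
    have h2 : ((n + 2 : ℕ) : ℝ) ^ θ ≤ 2 * ((n + 1 : ℕ) : ℝ) ^ θ := by
      calc ((n + 2 : ℕ) : ℝ) ^ θ ≤ (2 * ((n + 1 : ℕ) : ℝ)) ^ θ := by
            gcongr; push_cast; linarith [n.cast_nonneg (α := ℝ)]
        _ = 2 ^ θ * ((n + 1 : ℕ) : ℝ) ^ θ := Real.mul_rpow (by norm_num) hn.le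
        _ ≤ _ := by
          gcongr
          calc (2 : ℝ) ^ θ ≤ 2 ^ (1 : ℝ) := by gcongr; norm_num
            _ = 2 := by simp
    refine mul_le_mul (Real.rpow_le_rpow hS0 (hB _) (by linarith))
      ((Real.rpow_le_rpow hS0 htriv h0).trans h2) (by positivity) (by positivity)
  have hS2 := norm_natCast_cpow_neg_sub_le s (h0.trans hθ.le) n.succ_pos
  calc _ ≤ (B ^ (1 - θ) * (2 * ((n + 1 : ℕ) : ℝ) ^ θ)) *
        (‖s‖ * ((n + 1 : ℕ) : ℝ) ^ (-s.re - 1)) :=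
        mul_le_mul hS1 hS2 (norm_nonneg _) (by positivity)
    _ = B ^ (1 - θ) * (2 * ‖s‖ *
        (((n + 1 : ℕ) : ℝ) ^ θ * ((n + 1 : ℕ) : ℝ) ^ (-s.re - 1))) := by ring
    _ = _ := by rw [← Real.rpow_add hn]; ring_nf

end

lemma exists_sqrt_mul_one_add_log_le {ε : ℝ} (hε : 0 < ε) :
    ∃ K : ℝ, 1 ≤ K ∧ ∀ N : ℕ, 1 ≤ N → √N * (1 + Real.log N) ≤ K * (N : ℝ) ^ (1 / 2 + ε) := by
  refine ⟨1 + 1 / ε, by have := one_div_pos.2 hε; linarith, fun N hN => ?_⟩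
  have hN0 : (0 : ℝ) < N := by exact_mod_cast hN
  have h1 : 1 ≤ (N : ℝ) ^ ε := Real.one_le_rpow (by exact_mod_cast hN) hε.le
  have h2 := Real.log_le_rpow_div hN0.le hε
  rw [Real.rpow_add hN0, Real.sqrt_eq_rpow]
  have h3 : 1 + Real.log N ≤ (1 + 1 / ε) * (N : ℝ) ^ ε := by
    have : (1 + 1 / ε) * (N : ℝ) ^ ε = (N : ℝ) ^ ε + (N : ℝ) ^ ε / ε := by ring
    linarith
  calc (N : ℝ) ^ (1 / 2 : ℝ) * (1 + Real.log N) ≤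
        (N : ℝ) ^ (1 / 2 : ℝ) * ((1 + 1 / ε) * (N : ℝ) ^ ε) := by gcongr
    _ = _ := by ring

lemma exists_norm_LFunction_le_of_re_pos (s : ℂ) (hs : 0 < s.re) {ε : ℝ} (hε : 0 < ε) :
    ∃ C : ℝ, 0 ≤ C ∧ ∀ (N : ℕ) [NeZero N] (χ : DirichletCharacter ℂ N), χ.IsPrimitive → χ ≠ 1 →
      ‖χ.LFunction s‖ ≤ C * (N : ℝ) ^ (max 0 ((1 - s.re) / 2) + ε) := by
  obtain ⟨K, hK, hKN⟩ := exists_sqrt_mul_one_add_log_le (half_pos hε)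
  set δ := min s.re ε with hδ
  have hδ0 : 0 < δ := lt_min hs hε
  have hδ1 : δ ≤ s.re := min_le_left _ _
  have hδ2 : δ ≤ ε := min_le_right _ _
  set θ := min 1 (s.re - δ) with hθ
  have hθ0 : 0 ≤ θ := le_min zero_le_one (by linarith)
  have hθ1 : θ ≤ 1 := min_le_left _ _
  have hθs : θ < s.re := (min_le_right _ _).trans_lt (by linarith)
  have hexp : (1 / 2 + ε / 2) * (1 - θ) ≤ max 0 ((1 - s.re) / 2) + ε := by
    have h1 : 1 - θ ≤ 2 * max 0 ((1 - s.re) / 2) + ε := by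
      have ha := le_max_left 0 ((1 - s.re) / 2)
      have hb := le_max_right 0 ((1 - s.re) / 2)
      rcases min_choice 1 (s.re - δ) with h | h <;> rw [hθ, h] <;> linarith
    nlinarith
  refine ⟨K ^ (1 - θ) * (2 * ‖s‖ * ∑' n : ℕ, ((n + 1 : ℕ) : ℝ) ^ (θ - s.re - 1)), ?_, ?_⟩
  · have : 0 ≤ ∑' n : ℕ, ((n + 1 : ℕ) : ℝ) ^ (θ - s.re - 1) :=
      tsum_nonneg fun n => by positivity
    positivity
  intro N _ χ hχ h1
  have hN : N ≠ 1 := h1 ∘ DirichletCharacter.level_one' _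
  have hN1 : 1 ≤ N := NeZero.one_le
  have hN0 : (1 : ℝ) ≤ N := by exact_mod_cast hN1
  have hB := fun M => (hχ.norm_sum_range_le hN M).trans (hKN N hN1)
  refine (norm_LFunction_le_of_norm_sum_le χ h1 hB hθ0 hθ1 hθs).trans ?_
  rw [Real.mul_rpow (by positivity) (by positivity), ← Real.rpow_mul (by positivity),
    mul_right_comm]
  have h0 : 0 ≤ ∑' n : ℕ, ((n + 1 : ℕ) : ℝ) ^ (θ - s.re - 1) :=
    tsum_nonneg fun n => by positivity
  gcongr

lemma norm_rootNumber {N : ℕ} [NeZero N] {χ : DirichletCharacter ℂ N} (hχ : χ.IsPrimitive) :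
    ‖χ.rootNumber‖ = 1 := by
  have hN : (0 : ℝ) < N := by exact_mod_cast NeZero.pos N
  have hI : ∀ k : ℕ, ‖(I : ℂ) ^ k‖ = 1 := fun k => by simp
  rw [DirichletCharacter.rootNumber, norm_div, norm_div, hχ.norm_gaussSum, hI, div_one,
    norm_natCast_cpow_of_pos (NeZero.pos N), Real.sqrt_eq_rpow]
  have h : (1 / 2 : ℂ).re = 1 / 2 := by norm_num
  rw [h]
  exact div_self (Real.rpow_pos_of_pos hN _).ne'

lemma norm_LFunction_eq_norm_LFunction_inv_one_sub {N : ℕ} [NeZero N]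
    {χ : DirichletCharacter ℂ N} (hχ : χ.IsPrimitive) (h1 : χ ≠ 1) {s : ℂ} (hs : s.re ≤ 0) :
    ‖χ.LFunction s‖ = (N : ℝ) ^ (1 / 2 - s.re) * ‖χ⁻¹.LFunction (1 - s)‖ *
      (‖χ⁻¹.gammaFactor (1 - s)‖ / ‖χ.gammaFactor s‖) := by
  have hN : N ≠ 1 := h1 ∘ DirichletCharacter.level_one' _
  have hγ : χ⁻¹.gammaFactor (1 - s) ≠ 0 := by
    rcases χ⁻¹.even_or_odd with h | h
    · rw [h.gammaFactor_def]
      exact Gammaℝ_ne_zero_of_re_pos (by simp; linarith)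
    · rw [h.gammaFactor_def]
      exact Gammaℝ_ne_zero_of_re_pos (by simp; linarith)
  have hfe := hχ.completedLFunction_one_sub (1 - s)
  rw [sub_sub_cancel] at hfe
  rw [DirichletCharacter.LFunction_eq_completed_div_gammaFactor χ s (.inr hN),
    DirichletCharacter.LFunction_eq_completed_div_gammaFactor χ⁻¹ (1 - s) (.inr hN), hfe]
  simp only [norm_div, norm_mul, norm_rootNumber hχ, norm_natCast_cpow_of_pos (NeZero.pos N)]
  have e : (1 - s - 1 / 2 : ℂ).re = 1 / 2 - s.re := by norm_num; ring
  have hγ' : ‖χ⁻¹.gammaFactor (1 - s)‖ ≠ 0 := norm_ne_zero_iff.2 hγ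
  rw [e]
  field_simp

lemma exists_norm_LFunction_le_of_re_nonpos (s : ℂ) (hs : s.re ≤ 0) {ε : ℝ} (hε : 0 < ε) :
    ∃ C : ℝ, 0 ≤ C ∧ ∀ (N : ℕ) [NeZero N] (χ : DirichletCharacter ℂ N), χ.IsPrimitive → χ ≠ 1 →
      ‖χ.LFunction s‖ ≤ C * (N : ℝ) ^ (1 / 2 - s.re + ε) := by
  obtain ⟨C, hC, hCN⟩ := exists_norm_LFunction_le_of_re_pos (1 - s) (by simp; linarith) hε
  have hmax : max 0 ((1 - (1 - s).re) / 2) = 0 := max_eq_left (by simp; linarith)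
  rw [hmax, zero_add] at hCN
  set G := ‖Gammaℝ (1 - s)‖ / ‖Gammaℝ s‖ + ‖Gammaℝ (1 - s + 1)‖ / ‖Gammaℝ (s + 1)‖ with hG
  have hG0 : 0 ≤ G := by positivity
  refine ⟨C * G, by positivity, fun N _ χ hχ h1 => ?_⟩
  have hN0 : (0 : ℝ) < N := by exact_mod_cast NeZero.pos N
  rw [norm_LFunction_eq_norm_LFunction_inv_one_sub hχ h1 hs]
  have hinv : χ⁻¹.IsPrimitive := by
    rw [DirichletCharacter.isPrimitive_def, DirichletCharacter.conductor_inv]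
    exact hχ
  have hL := hCN N χ⁻¹ hinv (inv_ne_one.2 h1)
  have hγ : ‖χ⁻¹.gammaFactor (1 - s)‖ / ‖χ.gammaFactor s‖ ≤ G := by
    have hneg : χ⁻¹ (-1) = χ (-1) := by
      rw [MulChar.inv_apply_eq_inv, Ring.inverse_eq_inv']
      rcases χ.even_or_odd with h | h
      · rw [show χ (-1) = 1 from h, inv_one]
      · rw [show χ (-1) = -1 from h]
        norm_num
    rcases χ.even_or_odd with h | h
    · have h' : χ⁻¹.Even := hneg.trans h
      rw [h.gammaFactor_def, h'.gammaFactor_def]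
      exact le_add_of_nonneg_right (by positivity)
    · have h' : χ⁻¹.Odd := hneg.trans h
      rw [h.gammaFactor_def, h'.gammaFactor_def]
      exact le_add_of_nonneg_left (by positivity)
  calc _ ≤ (N : ℝ) ^ (1 / 2 - s.re) * (C * (N : ℝ) ^ ε) * G := by gcongr
    _ = _ := by rw [Real.rpow_add hN0 (1 / 2 - s.re)]; ring

/-- The exponent in the convexity bound. -/
noncomputable def convexityExponent (σ : ℝ) : ℝ := max 0 (max (1 / 2 - σ / 2) (1 / 2 - σ))

lemma exists_norm_LFunction_le_of_isPrimitive (s : ℂ) {ε : ℝ} (hε : 0 < ε) :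
    ∃ C : ℝ, 0 ≤ C ∧ ∀ (N : ℕ) [NeZero N] (χ : DirichletCharacter ℂ N), χ.IsPrimitive → χ ≠ 1 →
      ‖χ.LFunction s‖ ≤ C * (N : ℝ) ^ (convexityExponent s.re + ε) := by
  have key : ∀ a ≤ convexityExponent s.re, (∃ C : ℝ, 0 ≤ C ∧ ∀ (N : ℕ) [NeZero N]
      (χ : DirichletCharacter ℂ N), χ.IsPrimitive → χ ≠ 1 →
      ‖χ.LFunction s‖ ≤ C * (N : ℝ) ^ (a + ε)) → ∃ C : ℝ, 0 ≤ C ∧ ∀ (N : ℕ) [NeZero N]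
      (χ : DirichletCharacter ℂ N), χ.IsPrimitive → χ ≠ 1 →
      ‖χ.LFunction s‖ ≤ C * (N : ℝ) ^ (convexityExponent s.re + ε) := by
    rintro a ha ⟨C, hC, h⟩
    refine ⟨C, hC, fun N _ χ hχ h1 => (h N χ hχ h1).trans ?_⟩
    have hN1 : (1 : ℝ) ≤ N := by exact_mod_cast NeZero.one_le (n := N)
    gcongr
  rcases le_or_gt s.re 0 with hs | hs
  · exact key _ ((le_max_right _ _).trans (le_max_right _ _))
      (exists_norm_LFunction_le_of_re_nonpos s hs hε)
  · refine key _ (max_le (le_max_left _ _) ?_) (exists_norm_LFunction_le_of_re_pos s hs hε)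
    rw [sub_div]
    exact (le_max_left _ _).trans (le_max_right _ _)

lemma norm_one_sub_mul_natCast_cpow_le {a : ℂ} (ha : ‖a‖ ≤ 1) (s : ℂ) {p : ℕ} (hp : 1 ≤ p) :
    ‖1 - a * (p : ℂ) ^ (-s)‖ ≤ 2 * (p : ℝ) ^ convexityExponent s.re := by
  have hp1 : (1 : ℝ) ≤ p := by exact_mod_cast hp
  have h0 : 0 ≤ convexityExponent s.re := le_max_left _ _
  have h1 : -s.re ≤ convexityExponent s.re :=
    le_trans (by linarith) ((le_max_right (1 / 2 - s.re / 2) (1 / 2 - s.re)).trans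
      (le_max_right 0 _))
  have h2 : ‖a * (p : ℂ) ^ (-s)‖ ≤ (p : ℝ) ^ convexityExponent s.re := by
    rw [norm_mul, norm_natCast_cpow_of_pos hp, neg_re]
    calc ‖a‖ * (p : ℝ) ^ (-s.re) ≤ 1 * (p : ℝ) ^ convexityExponent s.re := by gcongr
      _ = _ := one_mul _
  have h3 : 1 ≤ (p : ℝ) ^ convexityExponent s.re := Real.one_le_rpow hp1 h0
  calc _ ≤ ‖(1 : ℂ)‖ + ‖a * (p : ℂ) ^ (-s)‖ := norm_sub_le _ _
    _ ≤ _ := by rw [norm_one]; linarith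

lemma mul_prod_primeFactors_not_dvd_le {f N : ℕ} (hN : N ≠ 0) (hf : f ∣ N) :
    f * ∏ p ∈ N.primeFactors with ¬ p ∣ f, p ≤ N := by
  refine Nat.le_of_dvd (Nat.pos_of_ne_zero hN) (Nat.Coprime.mul_dvd_of_dvd_of_dvd ?_ hf ?_)
  · refine Nat.Coprime.prod_right fun p hp => ?_
    rw [mem_filter] at hp
    exact (((Nat.prime_of_mem_primeFactors hp.1).coprime_iff_not_dvd).2 hp.2).symm
  · exact (prod_dvd_prod_of_subset _ _ _ (filter_subset _ _)).trans (Nat.prod_primeFactors_dvd N)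

/-- The convexity bound, in the level aspect, for Dirichlet `L`-functions. -/
lemma exists_norm_LFunction_le (s : ℂ) {ε : ℝ} (hε : 0 < ε) :
    ∃ C : ℝ, 0 ≤ C ∧ ∀ (N : ℕ) [NeZero N] (χ : DirichletCharacter ℂ N), χ ≠ 1 →
      ‖χ.LFunction s‖ ≤ C * (N : ℝ) ^ (convexityExponent s.re + ε) := by
  obtain ⟨C, hC, hL⟩ := exists_norm_LFunction_le_of_isPrimitive s (half_pos hε)
  obtain ⟨C', hC', hdiv⟩ := exists_prod_two_mul_factorization_add_one_le (half_pos hε)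
  set κ := convexityExponent s.re with hκ
  have hκ0 : 0 ≤ κ := le_max_left _ _
  refine ⟨C * C', by positivity, fun N _ χ h1 => ?_⟩
  have hN : N ≠ 0 := NeZero.ne N
  have hN1 : (1 : ℝ) ≤ N := by exact_mod_cast NeZero.one_le (n := N)
  have hf : χ.conductor ∣ N := χ.conductor_dvd_level
  set f := χ.conductor with hfdef
  have hf0 : NeZero f := ⟨fun h => hN (by simpa [h] using hf)⟩
  set ψ := χ.primitiveCharacter with hψ
  have hψp : ψ.IsPrimitive := χ.primitiveCharacter_isPrimitive
  have hχψ : DirichletCharacter.changeLevel hf ψ = χ := χ.changeLevel_primitiveCharacter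
  have hψ1 : ψ ≠ 1 := by
    intro h
    rw [h, map_one] at hχψ
    exact h1 hχψ.symm
  rw [← hχψ, DirichletCharacter.LFunction_changeLevel hf ψ (.inl hψ1), norm_mul, norm_prod]
  set S := {p ∈ N.primeFactors | ¬ p ∣ f} with hS
  have hprod : ∏ p ∈ N.primeFactors, ‖1 - ψ p * (p : ℂ) ^ (-s)‖ ≤
      C' * (N : ℝ) ^ (ε / 2) * ((∏ p ∈ S, p : ℕ) : ℝ) ^ κ := by
    have hloc : ∀ p ∈ N.primeFactors, ‖1 - ψ p * (p : ℂ) ^ (-s)‖ ≤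
        (2 * N.factorization p + 1 : ℝ) * if ¬ p ∣ f then (p : ℝ) ^ κ else 1 := by
      intro p hp
      have hpp := Nat.prime_of_mem_primeFactors hp
      have hv : (1 : ℝ) ≤ N.factorization p := by
        exact_mod_cast (hpp.dvd_iff_one_le_factorization hN).1 (Nat.dvd_of_mem_primeFactors hp)
      split_ifs with h
      · have : ψ (p : ZMod f) = 0 := by
          refine ψ.map_nonunit fun hu => ?_
          rw [ZMod.isUnit_iff_coprime] at hu
          exact (hpp.coprime_iff_not_dvd.1 hu) h
        rw [this, zero_mul, sub_zero, norm_one]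
        linarith
      · refine (norm_one_sub_mul_natCast_cpow_le (ψ.norm_le_one _) s hpp.one_le).trans ?_
        gcongr
        linarith
    refine (prod_le_prod (fun _ _ => norm_nonneg _) hloc).trans ?_
    rw [prod_mul_distrib, ← prod_filter, Nat.cast_prod,
      Real.finsetProd_rpow _ _ (fun _ _ => by positivity)]
    gcongr
    exact hdiv N hN
  have hfS : (f : ℝ) * ((∏ p ∈ S, p : ℕ) : ℝ) ≤ N := by
    exact_mod_cast mul_prod_primeFactors_not_dvd_le hN hf
  have hfN : (f : ℝ) ≤ N := by exact_mod_cast Nat.le_of_dvd (Nat.pos_of_ne_zero hN) hf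
  have hf1 : (0 : ℝ) < f := by exact_mod_cast NeZero.pos f
  calc _ ≤ (C * (f : ℝ) ^ (κ + ε / 2)) *
        (C' * (N : ℝ) ^ (ε / 2) * ((∏ p ∈ S, p : ℕ) : ℝ) ^ κ) :=
        mul_le_mul (hL f ψ hψp hψ1) hprod (prod_nonneg fun _ _ => norm_nonneg _) (by positivity)
    _ = C * C' * ((f * ((∏ p ∈ S, p : ℕ) : ℝ)) ^ κ * (f : ℝ) ^ (ε / 2) * (N : ℝ) ^ (ε / 2)) := by
        rw [Real.mul_rpow (by positivity) (by positivity), Real.rpow_add hf1]; ring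
    _ ≤ C * C' * ((N : ℝ) ^ κ * (N : ℝ) ^ (ε / 2) * (N : ℝ) ^ (ε / 2)) := by gcongr
    _ = _ := by rw [← Real.rpow_add (by linarith), ← Real.rpow_add (by linarith)]; ring_nf

/-- The roots of `X² + δX - t` in `ZMod c`. -/
def quadRoots (c : ℕ) [NeZero c] (δ t : ℤ) : Finset (ZMod c) :=
  {b | b ^ 2 + δ * b - t = 0}

lemma mem_quadRoots {c : ℕ} [NeZero c] {δ t : ℤ} {b : ZMod c} :
    b ∈ quadRoots c δ t ↔ b ^ 2 + δ * b - t = 0 := by simp [quadRoots]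

lemma intCast_mem_quadRoots {c : ℕ} [NeZero c] {δ t b : ℤ} :
    (b : ZMod c) ∈ quadRoots c δ t ↔ (c : ℤ) ∣ b ^ 2 + δ * b - t := by
  rw [mem_quadRoots, ← ZMod.intCast_zmod_eq_zero_iff_dvd]
  push_cast
  rfl

lemma natCast_mem_quadRoots {c : ℕ} [NeZero c] {δ t : ℤ} {b : ℕ} :
    (b : ZMod c) ∈ quadRoots c δ t ↔ (c : ℤ) ∣ (b : ℤ) ^ 2 + δ * b - t := by
  rw [← intCast_mem_quadRoots, Int.cast_natCast]

lemma rho_zero (Δ : ℤ) : rho 0 Δ = 0 := by simp [rho]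

lemma rho_eq_card_quadRoots (c : ℕ) [NeZero c] (δ t : ℤ) :
    rho c (δ ^ 2 + 4 * t) = #(quadRoots c δ t) := by
  have hc : (0 : ℤ) < c := by exact_mod_cast NeZero.pos c
  have hpar : ∀ a : ℤ, (a ^ 2 - (δ ^ 2 + 4 * t)) % (4 * (c : ℤ)) = 0 → ∃ b, a = 2 * b + δ ∧
      (c : ℤ) ∣ b ^ 2 + δ * b - t := by
    intro a ha
    obtain ⟨k, hk⟩ := Int.dvd_of_emod_eq_zero ha
    have h2 : Even (a - δ) := by
      have h3 : Even ((a - δ) * (a + δ)) := ⟨2 * (t + c * k), by linear_combination hk⟩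
      rcases Int.even_mul.1 h3 with h | h
      · exact h
      · have := h.sub (even_two_mul δ)
        rwa [two_mul, add_sub_add_right_eq_sub] at this
    obtain ⟨b, hb⟩ := h2
    have hab : a = 2 * b + δ := by linarith
    refine ⟨b, hab, k, ?_⟩
    subst hab
    linarith
  refine card_bij (fun a _ => ((((a : ℤ) - δ) / 2 : ℤ) : ZMod c)) ?_ ?_ ?_
  · intro a ha
    obtain ⟨b, hb, hd⟩ := hpar a (mem_filter.1 ha).2
    rw [hb, intCast_mem_quadRoots]
    simpa using hd
  · intro a ha a' ha' h
    obtain ⟨b, hb, -⟩ := hpar a (mem_filter.1 ha).2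
    obtain ⟨b', hb', -⟩ := hpar a' (mem_filter.1 ha').2
    rw [hb, hb', ZMod.intCast_eq_intCast_iff_dvd_sub] at h
    obtain ⟨k, hk⟩ := h
    simp at hk
    have h1 := mem_range.1 (mem_filter.1 ha).1
    have h2 := mem_range.1 (mem_filter.1 ha').1
    have h3 : (a' : ℤ) - a = 2 * c * k := by rw [hb, hb']; linear_combination 2 * hk
    have hk0 : k = 0 := by
      by_contra hk0
      rcases lt_or_gt_of_ne hk0 with h | h
      · nlinarith
      · nlinarith
    subst hk0
    omega
  · intro b hb
    obtain ⟨b, rfl⟩ := ZMod.intCast_surjective b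
    rw [intCast_mem_quadRoots] at hb
    obtain ⟨k, hk⟩ := hb
    have hnn := Int.emod_nonneg (2 * b + δ) (show (2 * c : ℤ) ≠ 0 by positivity)
    have hlt := Int.emod_lt_of_pos (2 * b + δ) (show (0 : ℤ) < 2 * c by positivity)
    have hdiv := Int.emod_add_mul_ediv (2 * b + δ) (2 * c)
    set r := (2 * b + δ) % (2 * c) with hr
    set q := (2 * b + δ) / (2 * c) with hq
    have hr' : r = 2 * (b - c * q) + δ := by linarith
    refine ⟨r.toNat, mem_filter.2 ⟨mem_range.2 (by omega), ?_⟩, ?_⟩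
    · rw [Int.toNat_of_nonneg hnn]
      apply Int.emod_eq_zero_of_dvd
      exact ⟨k - (2 * b + δ) * q + c * q ^ 2, by rw [hr']; linear_combination 4 * hk⟩
    · rw [Int.toNat_of_nonneg hnn, hr']
      simp

/-- A discriminant is an integer of the form `δ² + 4t`. -/
def IsDiscriminant (Δ : ℤ) : Prop := ∃ δ t : ℤ, Δ = δ ^ 2 + 4 * t

lemma isDiscriminant_iff {Δ : ℤ} : IsDiscriminant Δ ↔ Δ % 4 = 0 ∨ Δ % 4 = 1 := by
  constructor
  · rintro ⟨δ, t, rfl⟩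
    rcases Int.even_or_odd' δ with ⟨k, rfl | rfl⟩
    · left; ring_nf; omega
    · right; ring_nf; omega
  · rintro (h | h)
    · exact ⟨0, Δ / 4, by omega⟩
    · exact ⟨1, Δ / 4, by omega⟩

lemma rho_eq_zero {Δ : ℤ} (h : ¬ IsDiscriminant Δ) (c : ℕ) : rho c Δ = 0 := by
  refine card_eq_zero.2 (filter_eq_empty_iff.2 fun a _ ha => h ?_)
  obtain ⟨k, hk⟩ := Int.dvd_of_emod_eq_zero ha
  exact ⟨a, -(c * k), by linarith⟩

namespace IsDiscriminant

lemma mul_sq {Δ : ℤ} (h : IsDiscriminant Δ) (u : ℤ) : IsDiscriminant (Δ * u ^ 2) := by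
  obtain ⟨δ, t, rfl⟩ := h
  exact ⟨u * δ, u ^ 2 * t, by ring⟩

lemma rho_one {Δ : ℤ} (h : IsDiscriminant Δ) : rho 1 Δ = 1 := by
  obtain ⟨δ, t, rfl⟩ := h
  rw [rho_eq_card_quadRoots, card_eq_one]
  exact ⟨0, by ext b; simp [mem_quadRoots, Subsingleton.elim _ (0 : ZMod 1)]⟩

lemma rho_le {Δ : ℤ} (h : IsDiscriminant Δ) (c : ℕ) : rho c Δ ≤ c := by
  obtain ⟨δ, t, rfl⟩ := h
  rcases eq_or_ne c 0 with rfl | hc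
  · simp [rho_zero]
  · have : NeZero c := ⟨hc⟩
    rw [rho_eq_card_quadRoots]
    exact (card_le_univ _).trans (ZMod.card c).le

lemma rho_mul {Δ : ℤ} (h : IsDiscriminant Δ) {m n : ℕ} (hmn : m.Coprime n) :
    rho (m * n) Δ = rho m Δ * rho n Δ := by
  obtain ⟨δ, t, rfl⟩ := h
  rcases eq_or_ne m 0 with rfl | hm
  · simp [rho_zero]
  rcases eq_or_ne n 0 with rfl | hn
  · simp [rho_zero]
  have : NeZero m := ⟨hm⟩
  have : NeZero n := ⟨hn⟩
  rw [rho_eq_card_quadRoots, rho_eq_card_quadRoots, rho_eq_card_quadRoots, ← card_product]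
  refine card_equiv (ZMod.chineseRemainder hmn).toEquiv fun b => ?_
  rw [mem_product, mem_quadRoots, mem_quadRoots, mem_quadRoots,
    ← map_eq_zero_iff _ (ZMod.chineseRemainder hmn).injective]
  simp [Prod.ext_iff]

lemma rho_mul_sq_of_coprime {Δ : ℤ} (h : IsDiscriminant Δ) {c u : ℕ} (hu : u.Coprime c) :
    rho c (Δ * (u : ℤ) ^ 2) = rho c Δ := by
  obtain ⟨δ, t, rfl⟩ := h
  rcases eq_or_ne c 0 with rfl | hc
  · simp [rho_zero]
  have : NeZero c := ⟨hc⟩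
  have hu' : IsUnit (u : ZMod c) := (ZMod.isUnit_iff_coprime u c).2 hu
  rw [show (δ ^ 2 + 4 * t) * (u : ℤ) ^ 2 = (u * δ) ^ 2 + 4 * (u ^ 2 * t) by ring,
    rho_eq_card_quadRoots, rho_eq_card_quadRoots]
  symm
  refine card_equiv hu'.unit.mulLeft fun b => ?_
  rw [mem_quadRoots, mem_quadRoots]
  have : (hu'.unit.mulLeft b : ZMod c) = u * b := by simp
  rw [this]
  push_cast
  rw [show (u * b : ZMod c) ^ 2 + u * δ * (u * b) - u ^ 2 * t = u ^ 2 * (b ^ 2 + δ * b - t) by ring,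
    (hu'.pow 2).mul_right_eq_zero]

lemma rho_prime_mul_sq {Δ : ℤ} (h : IsDiscriminant Δ) {p : ℕ} (hp : p.Prime) :
    rho p (Δ * (p : ℤ) ^ 2) = 1 := by
  obtain ⟨δ, t, rfl⟩ := h
  have := Fact.mk hp
  rw [show (δ ^ 2 + 4 * t) * (p : ℤ) ^ 2 = (p * δ) ^ 2 + 4 * (p ^ 2 * t) by ring,
    rho_eq_card_quadRoots, card_eq_one]
  exact ⟨0, by ext b; simp [mem_quadRoots]⟩

lemma rho_prime_pow_add_two_mul_sq {Δ : ℤ} (h : IsDiscriminant Δ) {p : ℕ} (hp : p.Prime) (k : ℕ) :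
    rho (p ^ (k + 2)) (Δ * (p : ℤ) ^ 2) = p * rho (p ^ k) Δ := by
  obtain ⟨δ, t, rfl⟩ := h
  have := Fact.mk hp
  have hp0 : (p : ℤ) ≠ 0 := by exact_mod_cast hp.ne_zero
  rw [show (δ ^ 2 + 4 * t) * (p : ℤ) ^ 2 = (p * δ) ^ 2 + 4 * (p ^ 2 * t) by ring,
    rho_eq_card_quadRoots, rho_eq_card_quadRoots]
  have hcard : p * #(quadRoots (p ^ k) δ t) = #(range p ×ˢ quadRoots (p ^ k) δ t) := by
    rw [card_product, card_range]
  rw [hcard]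
  symm
  refine card_bij (fun x _ => ((p * (x.2.val + p ^ k * x.1) : ℕ) : ZMod (p ^ (k + 2)))) ?_ ?_ ?_
  · rintro ⟨j, b⟩ hx
    have hb := (mem_product.1 hx).2
    rw [← ZMod.natCast_zmod_val b, natCast_mem_quadRoots] at hb
    rw [natCast_mem_quadRoots]
    obtain ⟨m, hm⟩ := hb
    push_cast at hm ⊢
    exact ⟨m + 2 * b.val * j + p ^ k * j ^ 2 + δ * j, by linear_combination (p : ℤ) ^ 2 * hm⟩
  · rintro ⟨j, b⟩ hx ⟨j', b'⟩ hx' h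
    have hj := mem_range.1 (mem_product.1 hx).1
    have hj' := mem_range.1 (mem_product.1 hx').1
    have hlt : ∀ (j : ℕ) (b : ZMod (p ^ k)), j < p → p * (b.val + p ^ k * j) < p ^ (k + 2) := by
      intro j b hj
      have h1 := b.val_lt
      calc p * (b.val + p ^ k * j) < p * (p ^ k + p ^ k * j) := by
            gcongr
            exact hp.pos
        _ = p * p ^ k * (j + 1) := by ring
        _ ≤ p * p ^ k * p := by gcongr; exact hj
        _ = p ^ (k + 2) := by ring
    have h1 := (ZMod.natCast_eq_natCast_iff' _ _ _).1 h
    rw [Nat.mod_eq_of_lt (hlt j b hj), Nat.mod_eq_of_lt (hlt j' b' hj')] at h1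
    have h2 := Nat.eq_of_mul_eq_mul_left hp.pos h1
    have h3 : b.val = b'.val := by
      have := congrArg (· % p ^ k) h2
      simpa [Nat.mod_eq_of_lt b.val_lt, Nat.mod_eq_of_lt b'.val_lt] using this
    rw [h3] at h2
    have h4 := Nat.eq_of_mul_eq_mul_left (Nat.pos_of_neZero (p ^ k)) (Nat.add_left_cancel h2)
    exact Prod.ext h4 (ZMod.val_injective _ h3)
  · intro b hb
    rw [← ZMod.natCast_zmod_val b, natCast_mem_quadRoots] at hb
    have hlt := b.val_lt
    have hpb : p ∣ b.val := by
      have h1 : (p : ℤ) ∣ (p ^ (k + 2) : ℕ) := by exact_mod_cast dvd_pow_self p (by omega)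
      have h2 : (p : ℤ) ∣ (b.val : ℤ) ^ 2 := by
        rw [show (b.val : ℤ) ^ 2 = (b.val ^ 2 + p * δ * b.val - p ^ 2 * t) -
          p * (δ * b.val - p * t) by ring]
        exact (h1.trans hb).sub (dvd_mul_right _ _)
      exact_mod_cast (Nat.prime_iff_prime_int.1 hp).dvd_of_dvd_pow h2
    obtain ⟨n, hn⟩ := hpb
    rw [hn] at hb hlt
    have hn1 : n < p ^ k * p := by
      rw [show p ^ (k + 2) = p * (p ^ k * p) by ring] at hlt
      exact Nat.lt_of_mul_lt_mul_left hlt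
    refine ⟨(n / p ^ k, (n : ZMod (p ^ k))), mem_product.2 ⟨mem_range.2 ?_, ?_⟩, ?_⟩
    · exact Nat.div_lt_of_lt_mul hn1
    · rw [natCast_mem_quadRoots]
      obtain ⟨m, hm⟩ := hb
      refine ⟨m, mul_left_cancel₀ (pow_ne_zero 2 hp0) ?_⟩
      push_cast at hm ⊢
      linear_combination hm
    · rw [ZMod.val_natCast, Nat.mod_add_div, ← hn, ZMod.natCast_zmod_val]

lemma rho_prime_pow_succ {Δ : ℤ} (h : IsDiscriminant Δ) {p : ℕ} (hp : p.Prime)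
    (hpΔ : ¬ (p : ℤ) ∣ Δ) {k : ℕ} (hk : k ≠ 0) :
    rho (p ^ (k + 1)) Δ = rho (p ^ k) Δ := by
  obtain ⟨δ, t, rfl⟩ := h
  have := Fact.mk hp
  have hpZ : Prime (p : ℤ) := Nat.prime_iff_prime_int.1 hp
  rw [rho_eq_card_quadRoots, rho_eq_card_quadRoots]
  have hder : ∀ b : ℤ, (p : ℤ) ∣ b ^ 2 + δ * b - t → ¬ (p : ℤ) ∣ 2 * b + δ := by
    intro b hb h
    refine hpΔ ?_
    rw [show δ ^ 2 + 4 * t = (2 * b + δ) * (2 * b + δ) - 4 * (b ^ 2 + δ * b - t) by ring]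
    exact (h.mul_left _).sub (hb.mul_left 4)
  have hpk : (p : ℤ) ∣ (p ^ k : ℕ) := by exact_mod_cast dvd_pow_self p hk
  have hpk' : (p : ℤ) ∣ (p ^ (k + 1) : ℕ) := by exact_mod_cast dvd_pow_self p k.succ_ne_zero
  have hdvd : p ^ k ∣ p ^ (k + 1) := pow_dvd_pow p k.le_succ
  have hdvd' : ((p ^ k : ℕ) : ℤ) ∣ (p ^ (k + 1) : ℕ) := by exact_mod_cast hdvd
  refine card_bij (fun b _ => ZMod.castHom hdvd (ZMod (p ^ k)) b) ?_ ?_ ?_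
  · intro b hb
    obtain ⟨b, rfl⟩ := ZMod.intCast_surjective b
    rw [intCast_mem_quadRoots] at hb
    rw [map_intCast, intCast_mem_quadRoots]
    exact hdvd'.trans hb
  · intro b hb b' hb' h
    obtain ⟨b, rfl⟩ := ZMod.intCast_surjective b
    obtain ⟨b', rfl⟩ := ZMod.intCast_surjective b'
    rw [intCast_mem_quadRoots] at hb hb'
    rw [map_intCast, map_intCast, ZMod.intCast_eq_intCast_iff_dvd_sub] at h
    rw [ZMod.intCast_eq_intCast_iff_dvd_sub]
    have h1 : ¬ (p : ℤ) ∣ b' + b + δ := by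
      intro h2
      refine hder b (hpk'.trans hb) ?_
      rw [show 2 * b + δ = b' + b + δ - (b' - b) by ring]
      exact h2.sub (hpk.trans h)
    have h2 : IsCoprime ((p ^ (k + 1) : ℕ) : ℤ) (b' + b + δ) := by
      push_cast
      exact ((hpZ.coprime_iff_not_dvd).2 h1).pow_left
    refine h2.dvd_of_dvd_mul_right ?_
    rw [show (b' - b) * (b' + b + δ) = b' ^ 2 + δ * b' - t - (b ^ 2 + δ * b - t) by ring]
    exact hb'.sub hb
  · intro b hb
    obtain ⟨b, rfl⟩ := ZMod.intCast_surjective b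
    rw [intCast_mem_quadRoots] at hb
    have h1 : IsCoprime (p : ℤ) (2 * b + δ) :=
      (hpZ.coprime_iff_not_dvd).2 (hder b (hpk.trans hb))
    obtain ⟨x, y, hxy⟩ := h1
    obtain ⟨m, hm⟩ := hb
    obtain ⟨k, rfl⟩ := Nat.exists_eq_add_one_of_ne_zero hk
    refine ⟨((b - p ^ (k + 1) * (y * m) : ℤ) : ZMod _), ?_, ?_⟩
    · rw [intCast_mem_quadRoots]
      push_cast at hm ⊢
      exact ⟨m * x + p ^ k * (y * m) ^ 2, by
        linear_combination hm - p ^ (k + 1) * m * hxy⟩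
    · rw [map_intCast, ZMod.intCast_eq_intCast_iff_dvd_sub]
      exact ⟨y * m, by push_cast; ring⟩

lemma rho_prime_pow {Δ : ℤ} (h : IsDiscriminant Δ) {p : ℕ} (hp : p.Prime)
    (hpΔ : ¬ (p : ℤ) ∣ Δ) {k : ℕ} (hk : k ≠ 0) : rho (p ^ k) Δ = rho p Δ := by
  induction k with
  | zero => exact absurd rfl hk
  | succ k ih =>
    rcases eq_or_ne k 0 with rfl | hk0
    · simp
    · rw [h.rho_prime_pow_succ hp hpΔ hk0, ih hk0]

lemma rho_prime_pow_eq_zero {p : ℕ} (hp : p.Prime) {D : ℤ} (hpD : (p : ℤ) ∣ D)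
    (hD : ∀ E, D = E * (p : ℤ) ^ 2 → ¬ IsDiscriminant E) {k : ℕ} (hk : 2 ≤ k) :
    rho (p ^ k) D = 0 := by
  have hpZ : Prime (p : ℤ) := Nat.prime_iff_prime_int.1 hp
  refine card_eq_zero.2 (filter_eq_empty_iff.2 fun a _ ha => ?_)
  obtain ⟨m, hm⟩ := Int.dvd_of_emod_eq_zero ha
  obtain ⟨k, rfl⟩ := Nat.exists_eq_add_of_le hk
  push_cast at hm
  have h1 : (p : ℤ) ∣ a := by
    refine hpZ.dvd_of_dvd_pow (n := 2) ?_
    have : (p : ℤ) ∣ 4 * p ^ (2 + k) * m :=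
      ((dvd_pow_self _ (by omega)).mul_left 4).mul_right m
    have := (hm ▸ this).add hpD
    simpa using this
  obtain ⟨b, hb⟩ := h1
  refine hD (b ^ 2 - 4 * p ^ k * m) ?_ ⟨b, -(p ^ k * m), by ring⟩
  rw [hb] at hm
  linear_combination -hm

end IsDiscriminant

lemma rho_two_of_mod_eight_eq_one {Δ : ℤ} (h : Δ % 8 = 1) : rho 2 Δ = 2 := by
  have : (range (2 * 2)).filter (fun a : ℕ => ((a : ℤ) ^ 2 - Δ) % (4 * ((2 : ℕ) : ℤ)) = 0) =
      {1, 3} := by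
    ext a
    simp only [mem_filter, mem_range, mem_insert, mem_singleton]
    constructor
    · rintro ⟨h1, h2⟩
      interval_cases a <;> norm_num at h2 ⊢ <;> omega
    · rintro (rfl | rfl) <;> norm_num <;> omega
  rw [rho, this]
  rfl

lemma rho_two_of_mod_eight_eq_five {Δ : ℤ} (h : Δ % 8 = 5) : rho 2 Δ = 0 := by
  refine card_eq_zero.2 (filter_eq_empty_iff.2 fun a h1 h2 => ?_)
  rw [mem_range] at h1
  interval_cases a <;> norm_num at h2 <;> omega

lemma rho_two_of_mod_four_eq_zero {Δ : ℤ} (h : Δ % 4 = 0) : rho 2 Δ = 1 := by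
  rw [rho, card_eq_one]
  rcases (by omega : Δ % 8 = 0 ∨ Δ % 8 = 4) with h8 | h8
  · refine ⟨0, ?_⟩
    ext a
    simp only [mem_filter, mem_range, mem_singleton]
    constructor
    · rintro ⟨h1, h2⟩
      interval_cases a <;> norm_num at h2 ⊢ <;> omega
    · rintro rfl
      norm_num
      omega
  · refine ⟨2, ?_⟩
    ext a
    simp only [mem_filter, mem_range, mem_singleton]
    constructor
    · rintro ⟨h1, h2⟩
      interval_cases a <;> norm_num at h2 ⊢ <;> omega
    · rintro rfl
      norm_num
      omega

namespace IsDiscriminant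

lemma rho_prime {Δ : ℤ} (h : IsDiscriminant Δ) (p : ℕ) [Fact p.Prime] (hp2 : p ≠ 2) :
    (rho p Δ : ℤ) = legendreSym p Δ + 1 := by
  obtain ⟨δ, t, rfl⟩ := h
  rw [← legendreSym.card_sqrts p hp2, rho_eq_card_quadRoots]
  have h2 : (2 : ZMod p) ≠ 0 := by
    intro h
    have : ((2 : ℕ) : ZMod p) = 0 := by exact_mod_cast h
    rw [ZMod.natCast_eq_zero_iff] at this
    exact hp2 ((Nat.prime_dvd_prime_iff_eq Fact.out Nat.prime_two).1 this)
  congr 1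
  refine card_bij (fun b _ => 2 * b + δ) ?_ ?_ ?_
  · intro b hb
    rw [mem_quadRoots] at hb
    simp only [Set.mem_toFinset, Set.mem_ofPred_eq]
    push_cast
    linear_combination 4 * hb
  · intro b _ b' _ h
    exact mul_left_cancel₀ h2 (add_right_cancel h)
  · intro y hy
    simp only [Set.mem_toFinset, Set.mem_ofPred_eq] at hy
    push_cast at hy
    have h4 : (4 : ZMod p) ≠ 0 := by
      rw [show (4 : ZMod p) = 2 * 2 by norm_num]
      exact mul_ne_zero h2 h2
    have e : 2 * ((y - δ) / 2) + (δ : ZMod p) = y := by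
      rw [mul_div_cancel₀ _ h2, sub_add_cancel]
    refine ⟨(y - δ) / 2, ?_, e⟩
    rw [mem_quadRoots]
    refine mul_left_cancel₀ h4 ?_
    rw [← e] at hy
    linear_combination hy

end IsDiscriminant

/-- The Dirichlet character given by a periodic, completely multiplicative integer function. -/
lemma exists_dirichletCharacter_eq_intCast {N : ℕ} [NeZero N] (f : ℕ → ℤ)
    (hper : ∀ a, f (a % N) = f a) (h1 : f 1 = 1) (hmul : ∀ a b, f (a * b) = f a * f b)
    (h0 : ∀ a, ¬ a.Coprime N → f a = 0) :
    ∃ χ : DirichletCharacter ℂ N, ∀ a : ℕ, χ a = f a := by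
  refine ⟨⟨⟨⟨fun x => f x.val, ?_⟩, ?_⟩, ?_⟩, ?_⟩
  · have : f (1 : ZMod N).val = 1 := by
      rw [← Nat.cast_one, ZMod.val_natCast, hper, h1]
    simp [this]
  · intro x y
    simp [ZMod.val_mul, hper, hmul]
  · intro x hx
    have : ¬ x.val.Coprime N := by
      rwa [← ZMod.isUnit_iff_coprime, ZMod.natCast_zmod_val]
    simp [h0 _ this]
  · intro a
    change (f (a : ZMod N).val : ℂ) = f a
    rw [ZMod.val_natCast, hper]

lemma jacobiSym_natAbs_eq {D : ℤ} (hD : D % 4 = 1) {b : ℕ} (hb : Odd b) :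
    jacobiSym b D.natAbs = jacobiSym D b := by
  rcases le_or_gt 0 D with h | h
  · obtain ⟨d, rfl⟩ := Int.eq_ofNat_of_zero_le h
    rw [Int.natAbs_natCast, jacobiSym.quadratic_reciprocity_one_mod_four (by omega) hb]
  · obtain ⟨d, rfl⟩ : ∃ d : ℕ, D = -d := ⟨D.natAbs, by omega⟩
    have hd : d % 4 = 3 := by omega
    have hd' : Odd d := Nat.odd_iff.2 (by omega)
    rw [Int.natAbs_neg, Int.natAbs_natCast, jacobiSym.neg _ hb]
    rcases Nat.odd_mod_four_iff.1 (Nat.odd_iff.1 hb) with h4 | h4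
    · rw [ZMod.χ₄_nat_one_mod_four h4, one_mul,
        jacobiSym.quadratic_reciprocity_one_mod_four h4 hd']
    · rw [ZMod.χ₄_nat_three_mod_four h4,
        jacobiSym.quadratic_reciprocity_three_mod_four h4 hd]
      ring

lemma exists_dirichletCharacter_of_mod_four_eq_one {D : ℤ} (hD : D % 4 = 1) :
    ∃ χ : DirichletCharacter ℂ D.natAbs, ∀ p : ℕ, p.Prime → (rho p D : ℂ) = 1 + χ p := by
  have hdisc : IsDiscriminant D := isDiscriminant_iff.2 (.inr hD)
  have hN : NeZero D.natAbs := ⟨by omega⟩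
  obtain ⟨χ, hχ⟩ := exists_dirichletCharacter_eq_intCast (N := D.natAbs)
    (fun a => jacobiSym a D.natAbs)
    (fun a => by rw [Int.natCast_mod, ← jacobiSym.mod_left]) (by simp [jacobiSym.one_left])
    (fun a b => by push_cast; exact jacobiSym.mul_left _ _ _)
    (fun a ha => by
      rw [jacobiSym.eq_zero_iff_not_coprime]
      rwa [Int.gcd_natCast_natCast])
  refine ⟨χ, fun p hp => ?_⟩
  rw [hχ]
  have := Fact.mk hp
  rcases eq_or_ne p 2 with rfl | hp2
  · have hodd : Odd D.natAbs := Nat.odd_iff.2 (by omega)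
    rw [Nat.cast_ofNat, jacobiSym.at_two hodd, ZMod.χ₈_nat_eq_if_mod_eight]
    rcases (by omega : D % 8 = 1 ∨ D % 8 = 5) with h8 | h8
    · rw [rho_two_of_mod_eight_eq_one h8, if_neg (by omega), if_pos (by omega)]
      norm_num
    · rw [rho_two_of_mod_eight_eq_five h8, if_neg (by omega), if_neg (by omega)]
      norm_num
  · rw [jacobiSym_natAbs_eq hD (hp.odd_of_ne_two hp2), ← jacobiSym.legendreSym.to_jacobiSym,
      add_comm]
    exact_mod_cast hdisc.rho_prime p hp2

lemma exists_dirichletCharacter_of_mod_four_eq_zero {D : ℤ} (hD : D % 4 = 0) (h0 : D ≠ 0) :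
    ∃ χ : DirichletCharacter ℂ (4 * D.natAbs),
      ∀ p : ℕ, p.Prime → (rho p D : ℂ) = 1 + χ p := by
  have hdisc : IsDiscriminant D := isDiscriminant_iff.2 (.inl hD)
  have hN : NeZero (4 * D.natAbs) := ⟨by omega⟩
  have hpar : ∀ a, Odd (a % (4 * D.natAbs)) ↔ Odd a := fun a => by
    rw [Nat.odd_iff, Nat.odd_iff, Nat.mod_mod_of_dvd _ ⟨2 * D.natAbs, by ring⟩]
  obtain ⟨χ, hχ⟩ := exists_dirichletCharacter_eq_intCast (N := 4 * D.natAbs)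
    (fun a => if Odd a then jacobiSym D a else 0)
    (fun a => by
      by_cases ha : Odd a
      · rw [if_pos ha, if_pos ((hpar a).2 ha), ← jacobiSym.mod_right D ha]
      · rw [if_neg ha, if_neg (mt (hpar a).1 ha)]) (by simp [jacobiSym.one_right])
    (fun a b => by
      by_cases ha : Odd a
      · by_cases hb : Odd b
        · rw [if_pos ha, if_pos hb, if_pos (ha.mul hb),
            jacobiSym.mul_right' D ha.pos.ne' hb.pos.ne']
        · rw [if_neg hb, if_neg (fun h => hb (Nat.odd_mul.1 h).2), mul_zero]
      · rw [if_neg ha, if_neg (fun h => ha (Nat.odd_mul.1 h).1), zero_mul])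
    (fun a ha => by
      split_ifs with h
      · have : NeZero a := ⟨h.pos.ne'⟩
        rw [jacobiSym.eq_zero_iff_not_coprime]
        intro h1
        refine ha (Nat.Coprime.mul_right ?_ ?_)
        · exact (Nat.coprime_two_right.2 h).pow_right 2
        · rw [Int.gcd_comm] at h1
          simpa [Int.gcd] using h1
      · rfl)
  refine ⟨χ, fun p hp => ?_⟩
  rw [hχ]
  have := Fact.mk hp
  rcases eq_or_ne p 2 with rfl | hp2
  · rw [rho_two_of_mod_four_eq_zero hD, if_neg (by decide)]
    norm_num
  · rw [if_pos (hp.odd_of_ne_two hp2), ← jacobiSym.legendreSym.to_jacobiSym, add_comm]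
    exact_mod_cast hdisc.rho_prime p hp2

lemma IsDiscriminant.exists_dirichletCharacter {D : ℤ} (hD : IsDiscriminant D) (h0 : D ≠ 0) :
    ∃ N : ℕ, N ≠ 0 ∧ N ≤ 4 * D.natAbs ∧ ∃ χ : DirichletCharacter ℂ N,
      ∀ p : ℕ, p.Prime → (rho p D : ℂ) = 1 + χ p := by
  rcases isDiscriminant_iff.1 hD with h | h
  · exact ⟨_, by omega, le_rfl, exists_dirichletCharacter_of_mod_four_eq_zero h h0⟩
  · exact ⟨_, by omega, by omega, exists_dirichletCharacter_of_mod_four_eq_one h⟩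

namespace IsDiscriminant

lemma rho_prime_of_dvd {Δ : ℤ} (h : IsDiscriminant Δ) {p : ℕ} (hp : p.Prime)
    (hpΔ : (p : ℤ) ∣ Δ) : rho p Δ = 1 := by
  have := Fact.mk hp
  rcases eq_or_ne p 2 with rfl | hp2
  · exact rho_two_of_mod_four_eq_zero (by rcases isDiscriminant_iff.1 h with h | h <;> omega)
  · have h1 := h.rho_prime p hp2
    rw [(legendreSym.eq_zero_iff p Δ).2 ((ZMod.intCast_zmod_eq_zero_iff_dvd _ _).2 hpΔ)] at h1
    exact_mod_cast h1

lemma rho_prime_of_not_dvd {Δ : ℤ} (h : IsDiscriminant Δ) {p : ℕ} (hp : p.Prime)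
    (hpΔ : ¬ (p : ℤ) ∣ Δ) : rho p Δ = 0 ∨ rho p Δ = 2 := by
  have := Fact.mk hp
  rcases eq_or_ne p 2 with rfl | hp2
  · have : Δ % 8 = 1 ∨ Δ % 8 = 5 := by rcases isDiscriminant_iff.1 h with h | h <;> omega
    rcases this with h8 | h8
    · exact .inr (rho_two_of_mod_eight_eq_one h8)
    · exact .inl (rho_two_of_mod_eight_eq_five h8)
  · have h1 := h.rho_prime p hp2
    have h0 : (Δ : ZMod p) ≠ 0 := fun h => hpΔ ((ZMod.intCast_zmod_eq_zero_iff_dvd _ _).1 h)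
    rcases legendreSym.eq_one_or_neg_one p h0 with h2 | h2
    · right; omega
    · left; omega

end IsDiscriminant

lemma hasSum_rho_prime_pow_of_forall_not {D : ℤ} (hD : IsDiscriminant D) {p : ℕ} (hp : p.Prime)
    (hDp : ∀ E, D = E * (p : ℤ) ^ 2 → ¬ IsDiscriminant E) {a : ℂ} (ha : (rho p D : ℂ) = 1 + a)
    {X : ℂ} (hX : ‖X‖ < 1) :
    HasSum (fun k => (rho (p ^ k) D : ℂ) * X ^ k) ((1 + X) / (1 - a * X)) := by
  by_cases hpD : (p : ℤ) ∣ D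
  · have h1 := hD.rho_prime_of_dvd hp hpD
    have ha0 : a = 0 := by
      rw [h1] at ha
      push_cast at ha
      linear_combination -ha
    have h2 : HasSum (fun k => (rho (p ^ k) D : ℂ) * X ^ k) _ :=
      hasSum_sum_of_ne_finset_zero (s := range 2) fun k hk => by
        rw [IsDiscriminant.rho_prime_pow_eq_zero hp hpD hDp (not_lt.1 (mt mem_range.2 hk))]
        simp
    simpa [sum_range_succ, h1, hD.rho_one, ha0] using h2
  · have hpow := fun k hk => hD.rho_prime_pow hp hpD (k := k) hk
    rcases hD.rho_prime_of_not_dvd hp hpD with h | h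
    · have ha1 : a = -1 := by
        rw [h] at ha
        push_cast at ha
        linear_combination -ha
      have hne : 1 + X ≠ 0 := by
        intro h0
        rw [show X = -1 by linear_combination h0] at hX
        simp at hX
      have h2 := hasSum_single (f := fun k => (rho (p ^ k) D : ℂ) * X ^ k) 0 (fun k hk => by
        rw [hpow k hk, h]
        simp)
      simpa [hD.rho_one, ha1, hne] using h2
    · have ha1 : a = 1 := by
        rw [h] at ha
        push_cast at ha
        linear_combination -ha
      have hne : 1 - X ≠ 0 := by
        intro h0
        rw [show X = 1 by linear_combination -h0] at hX
        simp at hX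
      have h2 := ((hasSum_geometric_of_norm_lt_one hX).mul_left 2).sub
        (hasSum_ite_eq (0 : ℕ) (1 : ℂ))
      have hf : (fun k => (rho (p ^ k) D : ℂ) * X ^ k) =
          fun k => 2 * X ^ k - if k = 0 then 1 else 0 := by
        ext k
        rcases eq_or_ne k 0 with rfl | hk
        · simp [hD.rho_one]
          norm_num
        · simp [hpow k hk, h, hk]
      have hv : (1 + X) / (1 - a * X) = 2 * (1 - X)⁻¹ - 1 := by
        rw [ha1, one_mul]
        field_simp
        ring
      rw [hf, hv]
      exact h2

/-- The correction to the Euler factor at `p` caused by a square factor `p ^ (2 * m)` of the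
discriminant, as a polynomial in `X = p ^ (-s)`. -/
def eulerCorrection (p : ℕ) (a X : ℂ) : ℕ → ℂ
  | 0 => 1
  | m + 1 => (1 - a * X) + p * X ^ 2 * eulerCorrection p a X m

lemma hasSum_rho_prime_pow {D : ℤ} (hD : IsDiscriminant D) {p : ℕ} (hp : p.Prime)
    (hDp : ∀ E, D = E * (p : ℤ) ^ 2 → ¬ IsDiscriminant E) {a : ℂ} (ha : (rho p D : ℂ) = 1 + a)
    {X : ℂ} (hX : ‖X‖ < 1) (haX : 1 - a * X ≠ 0) (m : ℕ) :
    HasSum (fun k => (rho (p ^ k) (D * ((p ^ m : ℕ) : ℤ) ^ 2) : ℂ) * X ^ k)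
      ((1 + X) / (1 - a * X) * eulerCorrection p a X m) := by
  induction m with
  | zero =>
    simpa [eulerCorrection] using hasSum_rho_prime_pow_of_forall_not hD hp hDp ha hX
  | succ m ih =>
    have hd : IsDiscriminant (D * ((p ^ m : ℕ) : ℤ) ^ 2) := hD.mul_sq _
    have e : D * ((p ^ (m + 1) : ℕ) : ℤ) ^ 2 = D * ((p ^ m : ℕ) : ℤ) ^ 2 * (p : ℤ) ^ 2 := by
      push_cast
      ring
    rw [e, ← hasSum_nat_add_iff' 2]
    have hf : (fun k => (rho (p ^ (k + 2)) (D * ((p ^ m : ℕ) : ℤ) ^ 2 * (p : ℤ) ^ 2) : ℂ) *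
        X ^ (k + 2)) =
        fun k => p * X ^ 2 * ((rho (p ^ k) (D * ((p ^ m : ℕ) : ℤ) ^ 2) : ℂ) * X ^ k) := by
      ext k
      rw [hd.rho_prime_pow_add_two_mul_sq hp]
      push_cast
      ring
    have hv : (1 + X) / (1 - a * X) * eulerCorrection p a X (m + 1) -
        ∑ i ∈ range 2, (rho (p ^ i) (D * ((p ^ m : ℕ) : ℤ) ^ 2 * (p : ℤ) ^ 2) : ℂ) * X ^ i =
        p * X ^ 2 * ((1 + X) / (1 - a * X) * eulerCorrection p a X m) := by
      rw [sum_range_succ, sum_range_one, pow_zero, pow_one, (hd.mul_sq _).rho_one,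
        hd.rho_prime_mul_sq hp, eulerCorrection, mul_add, div_mul_cancel₀ _ haX]
      push_cast
      ring
    rw [hf, hv]
    exact ih.mul_left _

lemma differentiable_eulerCorrection (p : ℕ) (a : ℂ) {f : ℂ → ℂ} (hf : Differentiable ℂ f)
    (m : ℕ) : Differentiable ℂ fun z => eulerCorrection p a (f z) m := by
  induction m with
  | zero => simp [eulerCorrection]
  | succ m ih =>
    simp only [eulerCorrection]
    fun_prop

lemma eulerCorrection_inv_ne_zero {p : ℕ} (hp : p ≠ 0) {a : ℝ} (ha : a ≤ 1) (m : ℕ) :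
    eulerCorrection p a (p : ℂ)⁻¹ m ≠ 0 := by
  have hp0 : (0 : ℝ) < p := by exact_mod_cast Nat.pos_of_ne_zero hp
  have hp1 : (1 : ℝ) ≤ p := by exact_mod_cast Nat.one_le_iff_ne_zero.2 hp
  have key : ∃ r : ℝ, 0 < r ∧ eulerCorrection p a (p : ℂ)⁻¹ m = r := by
    induction m with
    | zero => exact ⟨1, one_pos, by simp [eulerCorrection]⟩
    | succ m ih =>
      obtain ⟨r, hr, h⟩ := ih
      refine ⟨(1 - a * (p : ℝ)⁻¹) + p * (p : ℝ)⁻¹ ^ 2 * r, ?_, ?_⟩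
      · have h1 : a * (p : ℝ)⁻¹ ≤ 1 := by
          rw [← div_eq_mul_inv, div_le_one hp0]
          linarith
        have h2 : 0 < p * (p : ℝ)⁻¹ ^ 2 * r := by positivity
        linarith
      · rw [eulerCorrection, h]
        push_cast
        rfl
  obtain ⟨r, hr, h⟩ := key
  rw [h]
  exact_mod_cast hr.ne'

lemma norm_eulerCorrection_le {p : ℕ} (hp : 1 ≤ p) {a X : ℂ} (ha : ‖a‖ ≤ 1) {M : ℝ} (hM : 1 ≤ M)
    (hX : p * ‖X‖ ^ 2 ≤ M) (m : ℕ) : ‖eulerCorrection p a X m‖ ≤ (2 * m + 1) * M ^ m := by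
  have hp1 : (1 : ℝ) ≤ p := by exact_mod_cast hp
  have hXM : ‖X‖ ≤ M := by
    rcases le_or_gt ‖X‖ 1 with h | h
    · exact h.trans hM
    · nlinarith [norm_nonneg X, sq_nonneg ‖X‖]
  induction m with
  | zero => simp [eulerCorrection]
  | succ m ih =>
    have hMm : 1 ≤ M ^ m := one_le_pow₀ hM
    have h1 : ‖1 - a * X‖ ≤ 2 * M := by
      calc ‖1 - a * X‖ ≤ ‖(1 : ℂ)‖ + ‖a * X‖ := norm_sub_le _ _
        _ = 1 + ‖a‖ * ‖X‖ := by rw [norm_one, norm_mul]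
        _ ≤ 1 + 1 * M := by gcongr
        _ ≤ 2 * M := by linarith
    calc ‖eulerCorrection p a X (m + 1)‖
        ≤ ‖1 - a * X‖ + ‖p * X ^ 2 * eulerCorrection p a X m‖ := norm_add_le _ _
      _ = ‖1 - a * X‖ + p * ‖X‖ ^ 2 * ‖eulerCorrection p a X m‖ := by simp
      _ ≤ 2 * M + M * ((2 * m + 1) * M ^ m) := by gcongr
      _ ≤ 2 * (M * M ^ m) + M * ((2 * m + 1) * M ^ m) := by
          have : M ≤ M * M ^ m := le_mul_of_one_le_right (by linarith) hMm
          linarith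
      _ = _ := by push_cast; ring

lemma IsDiscriminant.exists_eq_mul_sq {Δ : ℤ} (h : IsDiscriminant Δ) (h0 : Δ ≠ 0) :
    ∃ (D : ℤ) (l : ℕ), l ≠ 0 ∧ Δ = D * (l : ℤ) ^ 2 ∧ IsDiscriminant D ∧
      ∀ p : ℕ, p.Prime → ∀ E, D = E * (p : ℤ) ^ 2 → ¬ IsDiscriminant E := by
  induction hn : Δ.natAbs using Nat.strong_induction_on generalizing Δ with
  | _ n ih =>
    by_cases hE : ∃ p : ℕ, p.Prime ∧ ∃ E, Δ = E * (p : ℤ) ^ 2 ∧ IsDiscriminant E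
    · obtain ⟨p, hp, E, rfl, hE⟩ := hE
      have hE0 : E ≠ 0 := left_ne_zero_of_mul h0
      have hlt : E.natAbs < n := by
        rw [← hn, Int.natAbs_mul, Int.natAbs_pow, Int.natAbs_natCast]
        exact lt_mul_of_one_lt_right (Int.natAbs_pos.2 hE0) (Nat.one_lt_pow two_ne_zero hp.one_lt)
      obtain ⟨D, l, hl, rfl, hD⟩ := ih _ hlt hE hE0 rfl
      exact ⟨D, l * p, mul_ne_zero hl hp.ne_zero, by push_cast; ring, hD⟩
    · push Not at hE
      exact ⟨Δ, 1, one_ne_zero, by simp, h, fun p hp E h => hE p hp E h⟩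

/-- The finite Euler product relating Zagier's `L`-function of discriminant `D * l ^ 2` to the
Dirichlet `L`-function attached to `D`. -/
noncomputable def eulerCorrectionProd {N : ℕ} (χ : DirichletCharacter ℂ N) (l : ℕ) (z : ℂ) : ℂ :=
  ∏ p ∈ l.primeFactors, eulerCorrection p (χ p) ((p : ℂ) ^ (-z)) (l.factorization p)

lemma differentiable_eulerCorrectionProd {N : ℕ} (χ : DirichletCharacter ℂ N) (l : ℕ) :
    Differentiable ℂ (eulerCorrectionProd χ l) := by
  unfold eulerCorrectionProd
  refine Differentiable.fun_finsetProd fun p hp => ?_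
  refine differentiable_eulerCorrection p _ (fun z => ?_) _
  have : (p : ℂ) ≠ 0 := Nat.cast_ne_zero.2 (Nat.prime_of_mem_primeFactors hp).ne_zero
  exact (differentiableAt_id.neg).const_cpow (.inl this)


lemma norm_eulerCorrectionProd_le {N : ℕ} (χ : DirichletCharacter ℂ N) {l : ℕ} (hl : l ≠ 0)
    (s : ℂ) : ‖eulerCorrectionProd χ l s‖ ≤
      (∏ p ∈ l.primeFactors, (2 * l.factorization p + 1 : ℝ)) *
        (l : ℝ) ^ max 0 (1 - 2 * s.re) := by
  set μ := max 0 (1 - 2 * s.re) with hμ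
  have hμ0 : 0 ≤ μ := le_max_left _ _
  have e : (l : ℝ) ^ μ = ∏ p ∈ l.primeFactors, ((p : ℝ) ^ μ) ^ l.factorization p := by
    conv_lhs => rw [← Nat.prod_factorization_pow_eq_self hl, Finsupp.prod, Nat.support_factorization]
    rw [Nat.cast_prod, ← Real.finsetProd_rpow _ _ (fun _ _ => by positivity)]
    refine prod_congr rfl fun p _ => ?_
    push_cast
    rw [← Real.rpow_natCast, ← Real.rpow_natCast, ← Real.rpow_mul (by positivity),
      ← Real.rpow_mul (by positivity), mul_comm]
  rw [e, ← prod_mul_distrib, eulerCorrectionProd, norm_prod]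
  refine prod_le_prod (fun _ _ => norm_nonneg _) fun p hp => ?_
  have hp1 := (Nat.prime_of_mem_primeFactors hp).one_le
  have hp1' : (1 : ℝ) ≤ p := by exact_mod_cast hp1
  refine norm_eulerCorrection_le hp1 (χ.norm_le_one _) (Real.one_le_rpow hp1' hμ0) ?_ _
  rw [norm_natCast_cpow_of_pos hp1, neg_re, ← Real.rpow_natCast, ← Real.rpow_mul (by positivity)]
  nth_rw 1 [← Real.rpow_one (p : ℝ)]
  rw [← Real.rpow_add (by linarith)]
  refine Real.rpow_le_rpow_of_exponent_le hp1' (le_trans (le_of_eq ?_) (le_max_right _ _))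
  push_cast
  ring

lemma IsDiscriminant.summable_norm_rho_mul_cpow {Δ : ℤ} (h : IsDiscriminant Δ) {z : ℂ}
    (hz : 2 < z.re) : Summable fun c : ℕ => ‖(rho c Δ : ℂ) * (c : ℂ) ^ (-z)‖ := by
  refine Summable.of_nonneg_of_le (fun _ => norm_nonneg _) (fun c => ?_)
    (Real.summable_nat_rpow.2 (show 1 - z.re < -1 by linarith))
  rcases Nat.eq_zero_or_pos c with rfl | hc
  · simp only [rho_zero, Nat.cast_zero, zero_mul, norm_zero]
    positivity
  · have hc' : (0 : ℝ) < c := by exact_mod_cast hc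
    rw [norm_mul, norm_natCast, norm_natCast_cpow_of_pos hc, sub_eq_add_neg, Real.rpow_add hc',
      Real.rpow_one, neg_re]
    gcongr
    exact h.rho_le c

lemma hasProd_eulerCorrection {N : ℕ} (χ : DirichletCharacter ℂ N) (l : ℕ) (z : ℂ) :
    HasProd (fun p : Nat.Primes =>
      eulerCorrection p (χ (p : ℕ)) (((p : ℕ) : ℂ) ^ (-z)) (l.factorization p))
      (eulerCorrectionProd χ l z) := by
  set g : ℕ → ℂ := fun p => eulerCorrection p (χ p) ((p : ℂ) ^ (-z)) (l.factorization p) with hg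
  have h1 : ∀ p ∉ l.primeFactors, g p = 1 := fun p hp => by
    rw [← Nat.support_factorization, Finsupp.notMem_support_iff] at hp
    simp [hg, hp, eulerCorrection]
  have h2 : HasProd g (∏ p ∈ l.primeFactors, g p) := hasProd_prod_of_ne_finset_one h1
  refine (hasProd_subtype_iff_of_mulSupport_subset (s := {p | p.Prime}) fun p hp => ?_).2 h2
  by_contra hp'
  exact hp (h1 p fun h => hp' (Nat.prime_of_mem_primeFactors h))

/-- Zagier's `L`-series of discriminant `D * l ^ 2` is the Dirichlet `L`-series attached to `D`
up to a finite Euler product. -/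
lemma riemannZeta_two_mul_mul_tsum_rho {D : ℤ} (hD : IsDiscriminant D)
    (hDp : ∀ p : ℕ, p.Prime → ∀ E, D = E * (p : ℤ) ^ 2 → ¬ IsDiscriminant E)
    {N : ℕ} {χ : DirichletCharacter ℂ N} (hχ : ∀ p : ℕ, p.Prime → (rho p D : ℂ) = 1 + χ p)
    {l : ℕ} (hl : l ≠ 0) {z : ℂ} (hz : 2 < z.re) :
    riemannZeta (2 * z) * ∑' c : ℕ, (rho c (D * (l : ℤ) ^ 2) : ℂ) * (c : ℂ) ^ (-z) =
      riemannZeta z * LSeries (fun n => χ n) z * eulerCorrectionProd χ l z := by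
  have hΔ : IsDiscriminant (D * (l : ℤ) ^ 2) := hD.mul_sq _
  set f : ℕ → ℂ := fun c => (rho c (D * (l : ℤ) ^ 2) : ℂ) * (c : ℂ) ^ (-z) with hf
  have hS := EulerProduct.eulerProduct_hasProd (f := f) (by simp [hf, hΔ.rho_one])
    (fun {m n} hmn => by
      simp only [hf, hΔ.rho_mul hmn]
      push_cast
      rw [natCast_mul_natCast_cpow]
      ring) (hΔ.summable_norm_rho_mul_cpow hz) (by simp [hf, rho_zero])
  have h2 := riemannZeta_eulerProduct_hasProd (s := 2 * z) (by simp; linarith)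
  have h1 := riemannZeta_eulerProduct_hasProd (s := z) (by linarith)
  have hL := DirichletCharacter.LSeries_eulerProduct_hasProd χ (s := z) (by linarith)
  have hloc : ∀ p : Nat.Primes, (1 - ((p : ℕ) : ℂ) ^ (-(2 * z)))⁻¹ * ∑' k : ℕ, f ((p : ℕ) ^ k) =
      (1 - ((p : ℕ) : ℂ) ^ (-z))⁻¹ * (1 - χ (p : ℕ) * ((p : ℕ) : ℂ) ^ (-z))⁻¹ *
        eulerCorrection p (χ (p : ℕ)) (((p : ℕ) : ℂ) ^ (-z)) (l.factorization p) := by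
    rintro ⟨p, hp⟩
    change (1 - (p : ℂ) ^ (-(2 * z)))⁻¹ * ∑' k : ℕ, f (p ^ k) =
      (1 - (p : ℂ) ^ (-z))⁻¹ * (1 - χ p * (p : ℂ) ^ (-z))⁻¹ *
        eulerCorrection p (χ p) ((p : ℂ) ^ (-z)) (l.factorization p)
    set X : ℂ := (p : ℂ) ^ (-z) with hXdef
    have hX2 : (p : ℂ) ^ (-(2 * z)) = X ^ 2 := by
      rw [hXdef, ← cpow_nat_mul]
      congr 1
      push_cast
      ring
    have hX : ‖X‖ < 1 := by
      rw [hXdef, norm_natCast_cpow_of_pos hp.pos]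
      exact Real.rpow_lt_one_of_one_lt_of_neg (by exact_mod_cast hp.one_lt) (by simp; linarith)
    have hne : ∀ a : ℂ, ‖a‖ ≤ 1 → 1 - a * X ≠ 0 := by
      intro a ha h0
      have : ‖a * X‖ < 1 := by
        rw [norm_mul]
        exact (mul_le_of_le_one_left (norm_nonneg _) ha).trans_lt hX
      rw [← sub_eq_zero.1 h0, norm_one] at this
      exact lt_irrefl _ this
    have hfX : ∀ k, f (p ^ k) =
        (rho (p ^ k) (D * ((p ^ l.factorization p : ℕ) : ℤ) ^ 2) : ℂ) * X ^ k := by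
      intro k
      have hcop : (l / p ^ l.factorization p).Coprime (p ^ k) :=
        ((Nat.coprime_ordCompl hp hl).symm).pow_right k
      have hcpow : ((p ^ k : ℕ) : ℂ) ^ (-z) = X ^ k := by
        induction k with
        | zero => simp
        | succ k ih =>
          rw [pow_succ, Nat.cast_mul, natCast_mul_natCast_cpow, pow_succ,
            ih ((Nat.coprime_ordCompl hp hl).symm.pow_right k)]
      simp only [hf, hcpow]
      rw [← (hD.mul_sq ((p ^ l.factorization p : ℕ) : ℤ)).rho_mul_sq_of_coprime hcop, mul_assoc D,
        ← mul_pow, ← Nat.cast_mul, Nat.ordProj_mul_ordCompl_eq_self]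
    have h1X := hne 1 (by simp)
    have hnX := hne (-1) (by simp)
    rw [one_mul] at h1X
    rw [neg_one_mul, sub_neg_eq_add] at hnX
    have haX := hne _ (χ.norm_le_one p)
    rw [tsum_congr hfX, (hasSum_rho_prime_pow hD hp (hDp p hp) (hχ p hp) hX haX _).tsum_eq, hX2,
      show 1 - X ^ 2 = (1 - X) * (1 + X) by ring, mul_inv, div_eq_mul_inv]
    field_simp
  refine (h2.mul hS).unique ?_
  simp_rw [hloc]
  exact (h1.mul hL).mul (hasProd_eulerCorrection χ l z)

lemma eulerCorrectionProd_one_apply_one_ne_zero {N : ℕ} (l : ℕ) :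
    eulerCorrectionProd (1 : DirichletCharacter ℂ N) l 1 ≠ 0 := by
  refine prod_ne_zero_iff.2 fun p hp => ?_
  have hp0 := (Nat.prime_of_mem_primeFactors hp).ne_zero
  rw [cpow_neg_one]
  by_cases h : IsUnit (p : ZMod N)
  · simpa [MulChar.one_apply h] using eulerCorrection_inv_ne_zero hp0 le_rfl (l.factorization p)
  · simpa [MulChar.map_nonunit _ h] using
      eulerCorrection_inv_ne_zero hp0 zero_le_one (l.factorization p)

lemma eqOn_of_eqOn_two_lt_re {F G : ℂ → ℂ} {U : Set ℂ} (hU : IsOpen U) (hU' : IsPreconnected U)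
    (h3 : (3 : ℂ) ∈ U) (hF : DifferentiableOn ℂ F U) (hG : DifferentiableOn ℂ G U)
    (h : ∀ z : ℂ, 2 < z.re → F z = G z) : Set.EqOn F G U := by
  refine (hF.analyticOnNhd hU).eqOn_of_preconnected_of_eventuallyEq (hG.analyticOnNhd hU) hU' h3 ?_
  filter_upwards [(isOpen_lt continuous_const continuous_re).mem_nhds
    (show (2 : ℝ) < (3 : ℂ).re by norm_num)] with z hz using h z hz

/-- The analytic continuation of Zagier's `L`-series of discriminant `D * l ^ 2`, away from the
possible pole of the Dirichlet `L`-function. -/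
lemma eqOn_LFunction_mul_eulerCorrectionProd {D : ℤ} (hD : IsDiscriminant D)
    (hDp : ∀ p : ℕ, p.Prime → ∀ E, D = E * (p : ℤ) ^ 2 → ¬ IsDiscriminant E)
    {N : ℕ} [NeZero N] {χ : DirichletCharacter ℂ N}
    (hχ : ∀ p : ℕ, p.Prime → (rho p D : ℂ) = 1 + χ p) {l : ℕ} (hl : l ≠ 0)
    {F : ℂ → ℂ} (hF : Differentiable ℂ F)
    (hFz : ∀ z : ℂ, 3 / 2 < z.re → F z = riemannZeta (2 * z) / riemannZeta z *
      ∑' c : ℕ, (rho c (D * (l : ℤ) ^ 2) : ℂ) * (c : ℂ) ^ (-z))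
    {U : Set ℂ} (hU : IsOpen U) (hU' : IsPreconnected U) (h3 : (3 : ℂ) ∈ U)
    (hL : ∀ z ∈ U, z ≠ 1 ∨ χ ≠ 1) :
    Set.EqOn F (fun z => χ.LFunction z * eulerCorrectionProd χ l z) U := by
  refine eqOn_of_eqOn_two_lt_re hU hU' h3 hF.differentiableOn (fun z hz => ?_) fun z hz => ?_
  · exact ((χ.differentiableAt_LFunction z (hL z hz)).mul
      (differentiable_eulerCorrectionProd χ l z)).differentiableWithinAt
  · have hζ : riemannZeta z ≠ 0 := riemannZeta_ne_zero_of_one_lt_re (by linarith)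
    rw [hFz z (by linarith), div_mul_eq_mul_div,
      riemannZeta_two_mul_mul_tsum_rho hD hDp hχ hl hz,
      χ.LFunction_eq_LSeries (by linarith : 1 < z.re), mul_assoc, mul_div_cancel_left₀ _ hζ]

lemma ne_one_of_eqOn_LFunction_mul_eulerCorrectionProd {N : ℕ} [NeZero N]
    {χ : DirichletCharacter ℂ N} {l : ℕ} {F : ℂ → ℂ} (hF : Continuous F)
    (h : Set.EqOn F (fun z => χ.LFunction z * eulerCorrectionProd χ l z) {1}ᶜ) : χ ≠ 1 := by
  rintro rfl
  have h1 : Filter.Tendsto (fun z => (z - 1) * F z) (nhdsWithin 1 {1}ᶜ) (nhds 0) := by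
    have : ContinuousAt (fun z => (z - 1) * F z) 1 := by fun_prop
    simpa using this.tendsto.mono_left nhdsWithin_le_nhds
  have h2 : Filter.Tendsto (fun z => (z - 1) * F z) (nhdsWithin 1 {1}ᶜ)
      (nhds ((∏ p ∈ N.primeFactors, (1 - (p : ℂ)⁻¹)) *
        eulerCorrectionProd (1 : DirichletCharacter ℂ N) l 1)) := by
    have hT : Filter.Tendsto (eulerCorrectionProd (1 : DirichletCharacter ℂ N) l)
        (nhdsWithin 1 {1}ᶜ) (nhds (eulerCorrectionProd (1 : DirichletCharacter ℂ N) l 1)) :=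
      ((differentiable_eulerCorrectionProd _ l).continuous.tendsto 1).mono_left nhdsWithin_le_nhds
    refine (DirichletCharacter.LFunctionTrivChar_residue_one.mul hT).congr' ?_
    filter_upwards [self_mem_nhdsWithin] with z hz
    rw [h hz, mul_assoc]
  refine mul_ne_zero (prod_ne_zero_iff.2 fun p hp => ?_)
    (eulerCorrectionProd_one_apply_one_ne_zero l) (tendsto_nhds_unique h2 h1)
  have hp1 := (Nat.prime_of_mem_primeFactors hp).one_lt
  rw [sub_ne_zero, ne_comm, inv_ne_one]
  exact_mod_cast hp1.ne'

/-- convexity-type bound `L(s, Δ) ≪_{s,ε} |Δ|^{max{0, 1/2-σ/2, 1/2-σ}+ε}` for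
non-square `Δ`, where `L(·, Δ)` is the entire continuation of
`(ζ(2z)/ζ(z)) ∑_{c≥1} ρ(c,Δ) c^{-z}`. -/
theorem statement_2 (s : ℂ) (ε : ℝ) (hε : 0 < ε) :
    ∃ C : ℝ, 0 < C ∧ ∀ Δ : ℤ, ¬ IsSquare Δ → ∀ F : ℂ → ℂ, Differentiable ℂ F →
      (∀ z : ℂ, 3 / 2 < z.re →
        F z = riemannZeta (2 * z) / riemannZeta z *
          ∑' c : ℕ, (rho c Δ : ℂ) * (c : ℂ) ^ (-z)) →
      ‖F s‖ ≤ C * |(Δ : ℝ)| ^ (max 0 (max (1 / 2 - s.re / 2) (1 / 2 - s.re)) + ε) := by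
  change ∃ C : ℝ, 0 < C ∧ ∀ Δ : ℤ, ¬ IsSquare Δ → ∀ F : ℂ → ℂ, Differentiable ℂ F →
      (∀ z : ℂ, 3 / 2 < z.re → F z = riemannZeta (2 * z) / riemannZeta z *
          ∑' c : ℕ, (rho c Δ : ℂ) * (c : ℂ) ^ (-z)) →
      ‖F s‖ ≤ C * |(Δ : ℝ)| ^ (convexityExponent s.re + ε)
  obtain ⟨C₁, hC₁, hL⟩ := exists_norm_LFunction_le s hε
  obtain ⟨C₂, hC₂, hdiv⟩ := exists_prod_two_mul_factorization_add_one_le (by linarith : 0 < 2 * ε)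
  set κ := convexityExponent s.re with hκ
  have hκ0 : 0 ≤ κ := le_max_left _ _
  have hκ2 : max 0 (1 - 2 * s.re) ≤ 2 * κ := by
    have : 1 / 2 - s.re ≤ κ := (le_max_right _ _).trans (le_max_right _ _)
    exact max_le (by linarith) (by linarith)
  refine ⟨C₁ * C₂ * 4 ^ (κ + ε) + 1, by positivity, fun Δ hΔ F hF hFz => ?_⟩
  have hΔ0 : Δ ≠ 0 := by
    rintro rfl
    exact hΔ IsSquare.zero
  by_cases hdisc : IsDiscriminant Δ
  · obtain ⟨D, l, hl, rfl, hD, hDp⟩ := hdisc.exists_eq_mul_sq hΔ0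
    obtain ⟨N, hN, hND, χ, hχ⟩ := hD.exists_dirichletCharacter (left_ne_zero_of_mul hΔ0)
    have : NeZero N := ⟨hN⟩
    have hχ1 : χ ≠ 1 := by
      refine ne_one_of_eqOn_LFunction_mul_eulerCorrectionProd hF.continuous (l := l)
        (eqOn_LFunction_mul_eulerCorrectionProd hD hDp hχ hl hF hFz isOpen_compl_singleton
          (isConnected_compl_singleton_of_one_lt_rank ?_ 1).isPreconnected ?_ fun z hz => .inl hz)
      · rw [Complex.rank_real_complex]
        exact Nat.one_lt_ofNat
      · norm_num
    have hFs := eqOn_LFunction_mul_eulerCorrectionProd hD hDp hχ hl hF hFz isOpen_univ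
      isPreconnected_univ (Set.mem_univ _) (fun _ _ => .inr hχ1) (Set.mem_univ s)
    have hl0 : (0 : ℝ) < l := by exact_mod_cast Nat.pos_of_ne_zero hl
    have hl1 : (1 : ℝ) ≤ l := by exact_mod_cast Nat.one_le_iff_ne_zero.2 hl
    have hND' : (N : ℝ) ≤ 4 * |(D : ℝ)| := by
      rw [← Int.cast_abs, Int.abs_eq_natAbs]
      exact_mod_cast hND
    have hT : ‖eulerCorrectionProd χ l s‖ ≤ C₂ * ((l : ℝ) ^ 2) ^ (κ + ε) := by
      calc _ ≤ _ := norm_eulerCorrectionProd_le χ hl s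
        _ ≤ C₂ * (l : ℝ) ^ (2 * ε) * (l : ℝ) ^ (2 * κ) := by
            gcongr
            exact hdiv l hl
        _ = _ := by
            rw [mul_assoc, ← Real.rpow_add hl0, ← Real.rpow_natCast, ← Real.rpow_mul hl0.le]
            congr 2
            push_cast
            ring
    calc ‖F s‖ = ‖χ.LFunction s‖ * ‖eulerCorrectionProd χ l s‖ := by rw [hFs, norm_mul]
      _ ≤ (C₁ * (4 * |(D : ℝ)|) ^ (κ + ε)) * (C₂ * ((l : ℝ) ^ 2) ^ (κ + ε)) := by
          have := hL N χ hχ1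
          gcongr
          refine this.trans ?_
          gcongr
      _ = C₁ * C₂ * 4 ^ (κ + ε) * |((D * (l : ℤ) ^ 2 : ℤ) : ℝ)| ^ (κ + ε) := by
          push_cast
          rw [abs_mul, abs_of_nonneg (by positivity : (0 : ℝ) ≤ (l : ℝ) ^ 2),
            Real.mul_rpow (by positivity) (by positivity),
            Real.mul_rpow (by positivity) (by positivity)]
          ring
      _ ≤ _ := by
          gcongr
          linarith
  · have hF0 : F s = 0 := by
      refine eqOn_of_eqOn_two_lt_re (G := fun _ => 0) isOpen_univ isPreconnected_univ
        (Set.mem_univ _) hF.differentiableOn (differentiableOn_const 0) (fun z hz => ?_)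
        (Set.mem_univ s)
      rw [hFz z (by linarith)]
      simp [rho_eq_zero hdisc]
    rw [hF0, norm_zero]
    positivity
end

section
/- Fix a complex number s with σ = Re(s), and fix ε > 0. There exists a constant C > 0 such that for every integer q > 1 and every primitive, nontrivial Dirichlet character χ of modulus q, the analytically continued Dirichlet L-function satisfies |L(s, χ)| ≤ C · q^{max{0, 1/2 − σ/2, 1/2 − σ} + ε}. -/
open Complex

open Set MeasureTheory in
theorem exists_norm_mellin_le {f : ℝ → ℂ} (hf : ∀ s, MellinConvergent f s) (a b : ℝ) :
    ∃ C : ℝ, ∀ s : ℂ, a ≤ s.re → s.re ≤ b → ‖mellin f s‖ ≤ C := by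
  have hint (c : ℝ) : IntegrableOn (fun t : ℝ ↦ t ^ (c - 1) * ‖f t‖) (Ioi 0) := by
    refine IntegrableOn.congr_fun (hf c).norm (fun t ht ↦ ?_) measurableSet_Ioi
    simp [norm_cpow_eq_rpow_re_of_pos (mem_Ioi.mp ht)]
  refine ⟨∫ t in Ioi (0 : ℝ), (t ^ (a - 1) * ‖f t‖ + t ^ (b - 1) * ‖f t‖), fun s ha hb ↦ ?_⟩
  refine norm_integral_le_of_norm_le ((hint a).add (hint b)) ?_
  filter_upwards [ae_restrict_mem measurableSet_Ioi] with t ht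
  have ht : 0 < t := ht
  rw [norm_smul, norm_cpow_eq_rpow_re_of_pos ht, ← add_mul, sub_re, one_re]
  gcongr
  rcases le_total t 1 with h | h
  · exact (Real.rpow_le_rpow_of_exponent_ge ht h (by linarith)).trans
      (le_add_of_nonneg_right (by positivity))
  · exact (Real.rpow_le_rpow_of_exponent_le h (by linarith)).trans
      (le_add_of_nonneg_left (by positivity))

namespace HurwitzZeta

theorem exists_norm_completedHurwitzZetaEven₀_le (x : UnitAddCircle) (a b : ℝ) :
    ∃ C : ℝ, ∀ s : ℂ, a ≤ s.re → s.re ≤ b → ‖completedHurwitzZetaEven₀ x s‖ ≤ C := by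
  obtain ⟨C, hC⟩ := exists_norm_mellin_le
    (fun s ↦ ((hurwitzEvenFEPair x).isStrongFEPair_toStrongFEPair.hasMellin s).1) (a / 2) (b / 2)
  refine ⟨C / 2, fun s ha hb ↦ ?_⟩
  have := hC (s / 2) (by simp; linarith) (by simp; linarith)
  rw [completedHurwitzZetaEven₀, norm_div, norm_ofNat]
  gcongr
  exact this

theorem exists_norm_completedHurwitzZetaOdd_le (x : UnitAddCircle) (a b : ℝ) :
    ∃ C : ℝ, ∀ s : ℂ, a ≤ s.re → s.re ≤ b → ‖completedHurwitzZetaOdd x s‖ ≤ C := by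
  obtain ⟨C, hC⟩ := exists_norm_mellin_le
    (fun s ↦ ((isStrong_hurwitzOddFEPair x).hasMellin s).1) ((a + 1) / 2) ((b + 1) / 2)
  refine ⟨C / 2, fun s ha hb ↦ ?_⟩
  have := hC ((s + 1) / 2) (by simp; linarith) (by simp; linarith)
  rw [completedHurwitzZetaOdd, (isStrong_hurwitzOddFEPair x).Λ_eq, norm_div, norm_ofNat]
  gcongr

end HurwitzZeta

theorem ZMod.exists_norm_completedLFunction₀_le {N : ℕ} [NeZero N] (Φ : ZMod N → ℂ) (a b : ℝ) :
    ∃ C : ℝ, ∀ s : ℂ, a ≤ s.re → s.re ≤ b → ‖ZMod.completedLFunction₀ Φ s‖ ≤ C := by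
  choose A hA using fun j : ZMod N ↦
    HurwitzZeta.exists_norm_completedHurwitzZetaEven₀_le (toAddCircle j) a b
  choose B hB using fun j : ZMod N ↦
    HurwitzZeta.exists_norm_completedHurwitzZetaOdd_le (toAddCircle j) a b
  refine ⟨(N : ℝ) ^ (-a) * ∑ j, ‖Φ j‖ * A j + (N : ℝ) ^ (-a) * ∑ j, ‖Φ j‖ * B j,
    fun s ha hb ↦ ?_⟩
  have hN : ‖(N : ℂ) ^ (-s)‖ ≤ (N : ℝ) ^ (-a) := by
    rw [norm_natCast_cpow_of_pos (NeZero.pos N), neg_re]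
    exact Real.rpow_le_rpow_of_exponent_le (mod_cast NeZero.one_le) (by linarith)
  have hsum {F : ZMod N → ℂ} {D : ZMod N → ℝ} (h : ∀ j, ‖F j‖ ≤ D j) :
      ‖∑ j, Φ j * F j‖ ≤ ∑ j, ‖Φ j‖ * D j := by
    refine norm_sum_le_of_le _ fun j _ ↦ ?_
    rw [norm_mul]
    gcongr
    exact h j
  refine (norm_add_le _ _).trans ?_
  rw [norm_mul, norm_mul]
  gcongr
  · exact hsum fun j ↦ hA j s ha hb
  · exact hsum fun j ↦ hB j s ha hb

theorem Complex.norm_Gamma_le_Gamma_re {s : ℂ} (hs : 0 < s.re) : ‖Gamma s‖ ≤ Real.Gamma s.re := by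
  rw [Gamma_eq_integral hs, Real.Gamma_eq_integral hs, GammaIntegral]
  refine MeasureTheory.norm_integral_le_of_norm_le (Real.GammaIntegral_convergent hs) ?_
  filter_upwards [MeasureTheory.ae_restrict_mem measurableSet_Ioi] with t ht
  simp [norm_cpow_eq_rpow_re_of_pos (Set.mem_Ioi.mp ht), Complex.norm_exp]

theorem Complex.norm_Gammaℝ_le {s : ℂ} (hs : 0 < s.re) : ‖Gammaℝ s‖ ≤ ‖Gammaℝ s.re‖ := by
  rw [Gammaℝ_def, Gammaℝ_def, norm_mul, norm_mul, norm_cpow_eq_rpow_re_of_pos Real.pi_pos,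
    norm_cpow_eq_rpow_re_of_pos Real.pi_pos]
  have h : 0 < (s / 2).re := by simpa using hs
  have h2 := norm_Gamma_le_Gamma_re h
  rw [show (s / 2).re = s.re / 2 by simp] at h2
  have h3 : ‖Gamma ((s.re : ℂ) / 2)‖ = Real.Gamma (s.re / 2) := by
    rw [← ofReal_ofNat, ← ofReal_div, Gamma_ofReal, norm_real, Real.norm_eq_abs,
      abs_of_pos (Real.Gamma_pos_of_pos (by linarith))]
  rw [h3]
  simp only [div_ofNat_re, neg_re, ofReal_re]
  gcongr

namespace DirichletCharacter

open ZMod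

variable {N : ℕ} [NeZero N]

theorem norm_gaussSum_of_isPrimitive {χ : DirichletCharacter ℂ N} (hχ : χ.IsPrimitive) :
    ‖gaussSum χ stdAddChar‖ = √N := by
  have h : (N : ℂ) = gaussSum χ stdAddChar * star (gaussSum χ stdAddChar) := by
    have h := congrFun (ZMod.dft_dft (χ : ZMod N → ℂ)) (-1)
    rw [dft_apply] at h
    simp only [hχ.fourierTransform_eq_inv_mul_gaussSum, smul_eq_mul, neg_neg, map_one,
      mul_one] at h
    rw [← h, star_gaussSum_eq, gaussSum, gaussSum, Finset.mul_sum]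
    refine Fintype.sum_equiv (Equiv.neg _) _ _ fun k ↦ ?_
    simp
    ring
  have h2 : (N : ℝ) = ‖gaussSum χ stdAddChar‖ ^ 2 := by
    rw [sq, ← Complex.norm_natCast, h, norm_mul, norm_star]
  rw [h2, Real.sqrt_sq (norm_nonneg _)]

theorem norm_rootNumber {χ : DirichletCharacter ℂ N} (hχ : χ.IsPrimitive) :
    ‖rootNumber χ‖ = 1 := by
  have hN : (0 : ℝ) < N := mod_cast NeZero.pos N
  have h : ‖(N : ℂ) ^ (1 / 2 : ℂ)‖ = √N := by
    rw [norm_natCast_cpow_of_pos (NeZero.pos N), Real.sqrt_eq_rpow]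
    simp
  rw [rootNumber, norm_div, norm_div, norm_pow, norm_I, one_pow, div_one,
    norm_gaussSum_of_isPrimitive hχ, h, div_self (Real.sqrt_pos.mpr hN).ne']

theorem norm_LFunction_le (χ : DirichletCharacter ℂ N) {s : ℂ} (hs : 1 < s.re) :
    ‖LFunction χ s‖ ≤ ∑' n : ℕ, ‖LSeries.term 1 s.re n‖ := by
  have hle (n : ℕ) : ‖LSeries.term (χ ·) s n‖ ≤ ‖LSeries.term 1 s.re n‖ := by
    rw [LSeries.norm_term_eq, LSeries.norm_term_eq]
    split_ifs
    · rfl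
    · simp only [Pi.one_apply, norm_one, ofReal_re]
      gcongr
      exact χ.norm_le_one _
  have hsum : Summable fun n ↦ ‖LSeries.term 1 s.re n‖ :=
    (LSeriesSummable_one_iff.mpr (by simpa using hs)).norm
  rw [LFunction_eq_LSeries χ hs, LSeries]
  exact tsum_of_norm_bounded hsum.hasSum hle

theorem norm_gammaFactor_le {M : ℕ} (χ : DirichletCharacter ℂ M) {s : ℂ} (hs : 0 < s.re) :
    ‖gammaFactor χ s‖ ≤ ‖Gammaℝ s.re‖ + ‖Gammaℝ (s.re + 1 : ℝ)‖ := by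
  rcases χ.even_or_odd with h | h
  · rw [h.gammaFactor_def]
    exact (norm_Gammaℝ_le hs).trans (le_add_of_nonneg_right (norm_nonneg _))
  · rw [h.gammaFactor_def]
    have := norm_Gammaℝ_le (s := s + 1) (by simp; linarith)
    simp only [add_re, one_re] at this
    exact this.trans (le_add_of_nonneg_left (norm_nonneg _))

theorem completedLFunction_eq_mul_gammaFactor (χ : DirichletCharacter ℂ N) {s : ℂ}
    (hs : 0 < s.re) : completedLFunction χ s = LFunction χ s * gammaFactor χ s := by
  have h0 : gammaFactor χ s ≠ 0 := by
    rcases χ.even_or_odd with h | h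
    · rw [h.gammaFactor_def]
      exact Gammaℝ_ne_zero_of_re_pos hs
    · rw [h.gammaFactor_def]
      exact Gammaℝ_ne_zero_of_re_pos (by simp; linarith)
  rw [LFunction_eq_completed_div_gammaFactor χ s (.inl fun h ↦ by simp [h] at hs),
    div_mul_cancel₀ _ h0]

theorem exists_norm_completedLFunction_le {σ : ℝ} (hσ : 1 < σ) :
    ∃ C : ℝ, 0 < C ∧ ∀ (N : ℕ) [NeZero N] (χ : DirichletCharacter ℂ N) (s : ℂ), s.re = σ →
      ‖completedLFunction χ s‖ ≤ C := by
  refine ⟨(∑' n : ℕ, ‖LSeries.term 1 σ n‖) * (‖Gammaℝ σ‖ + ‖Gammaℝ (σ + 1 : ℝ)‖) + 1,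
    by positivity, ?_⟩
  rintro N _ χ s rfl
  rw [completedLFunction_eq_mul_gammaFactor χ (by linarith), norm_mul]
  refine le_add_of_le_of_nonneg ?_ zero_le_one
  gcongr
  · exact norm_LFunction_le χ hσ
  · exact norm_gammaFactor_le χ (by linarith)

theorem norm_completedLFunction_one_sub {χ : DirichletCharacter ℂ N} (hχ : χ.IsPrimitive) (s : ℂ) :
    ‖completedLFunction χ s‖ = (N : ℝ) ^ (1 / 2 - s.re) * ‖completedLFunction χ⁻¹ (1 - s)‖ := by
  have h := hχ.completedLFunction_one_sub (1 - s)
  rw [sub_sub_cancel] at h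
  rw [h, norm_mul, norm_mul, norm_rootNumber hχ, mul_one, norm_natCast_cpow_of_pos (NeZero.pos N)]
  congr 2
  simp
  ring

theorem bddAbove_norm_completedLFunction {χ : DirichletCharacter ℂ N} (hχ : χ ≠ 1) (a b : ℝ) :
    BddAbove ((norm ∘ completedLFunction χ) '' HadamardThreeLines.verticalClosedStrip a b) := by
  obtain ⟨C, hC⟩ := ZMod.exists_norm_completedLFunction₀_le (χ : ZMod N → ℂ) a b
  refine ⟨C, ?_⟩
  rintro _ ⟨s, hs, rfl⟩
  have hN : N ≠ 1 := fun h ↦ hχ (level_one' _ h)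
  have h := ZMod.completedLFunction_eq (χ : ZMod N → ℂ) s
  rw [χ.map_zero' hN, χ.sum_eq_zero_of_ne_one hχ] at h
  simp only [mul_zero, zero_div, sub_zero] at h
  simpa [completedLFunction, h] using hC s hs.1 hs.2

theorem exists_norm_completedLFunction_le_rpow {δ : ℝ} (hδ : 0 < δ) :
    ∃ C : ℝ, 0 < C ∧ ∀ (N : ℕ) [NeZero N] (χ : DirichletCharacter ℂ N), χ.IsPrimitive → χ ≠ 1 →
      ∀ s : ℂ, -δ ≤ s.re → s.re ≤ 1 + δ →
        ‖completedLFunction χ s‖ ≤ C * (N : ℝ) ^ ((1 + δ - s.re) / 2) := by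
  obtain ⟨C, hC0, hC⟩ := exists_norm_completedLFunction_le (σ := 1 + δ) (by linarith)
  refine ⟨C, hC0, fun N _ χ hχ hχ1 s hs hs' ↦ ?_⟩
  have hN : (0 : ℝ) < N := mod_cast NeZero.pos N
  have h := HadamardThreeLines.norm_le_interp_of_mem_verticalClosedStrip'
    (f := completedLFunction χ) (z := s) (a := C * (N : ℝ) ^ (1 / 2 + δ)) (b := C)
    (l := -δ) (u := 1 + δ) (by linarith) ⟨hs, hs'⟩
    (differentiable_completedLFunction hχ1).diffContOnCl
    (bddAbove_norm_completedLFunction hχ1 _ _)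
    (fun z hz ↦ by
      have hz : z.re = -δ := hz
      rw [norm_completedLFunction_one_sub hχ, hz, mul_comm, sub_neg_eq_add]
      gcongr
      exact hC N _ _ (by simp [hz]))
    (fun z hz ↦ hC N χ z hz)
  refine h.trans_eq ?_
  rw [Real.mul_rpow hC0.le (by positivity), mul_right_comm, ← Real.rpow_add hC0,
    ← Real.rpow_mul hN.le, sub_add_cancel, Real.rpow_one]
  congr 2
  have hd : 1 + δ - -δ ≠ 0 := by linarith
  field_simp
  ring

theorem norm_LFunction_le_mul_completedLFunction {χ : DirichletCharacter ℂ N} (hχ : χ ≠ 1)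
    (s : ℂ) : ‖LFunction χ s‖ ≤
      (‖(Gammaℝ s)⁻¹‖ + ‖(Gammaℝ (s + 1))⁻¹‖) * ‖completedLFunction χ s‖ := by
  have hN : N ≠ 1 := fun h ↦ hχ (level_one' _ h)
  rw [LFunction_eq_completed_div_gammaFactor χ s (.inr hN), div_eq_inv_mul, norm_mul]
  gcongr
  rcases χ.even_or_odd with h | h
  · rw [h.gammaFactor_def]
    exact le_add_of_nonneg_right (norm_nonneg _)
  · rw [h.gammaFactor_def]
    exact le_add_of_nonneg_left (norm_nonneg _)

end DirichletCharacter

open DirichletCharacter in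
/-- convexity-type bound for Dirichlet `L`-functions of primitive nontrivial
characters: `|L(s,χ)| ≤ C q^{max{0, 1/2-σ/2, 1/2-σ}+ε}`. -/
theorem statement_3 (s : ℂ) (ε : ℝ) (hε : 0 < ε) :
    ∃ C : ℝ, 0 < C ∧ ∀ q : ℕ, ∀ hq : 1 < q, ∀ χ : DirichletCharacter ℂ q,
      χ.IsPrimitive → χ ≠ 1 →
      ‖@DirichletCharacter.LFunction q ⟨by omega⟩ χ s‖ ≤
        C * (q : ℝ) ^ (max 0 (max (1 / 2 - s.re / 2) (1 / 2 - s.re)) + ε) := by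
  set e := max 0 (max (1 / 2 - s.re / 2) (1 / 2 - s.re)) with he
  have he0 : 0 ≤ e := le_max_left _ _
  have he1 : 1 / 2 - s.re / 2 ≤ e := (le_max_left _ _).trans (le_max_right _ _)
  have he2 : 1 / 2 - s.re ≤ e := (le_max_right _ _).trans (le_max_right _ _)
  suffices H : ∃ C : ℝ, 0 < C ∧ ∃ r ≤ e + ε, ∀ (q : ℕ) [NeZero q] (χ : DirichletCharacter ℂ q),
      χ.IsPrimitive → χ ≠ 1 → ‖LFunction χ s‖ ≤ C * (q : ℝ) ^ r by
    obtain ⟨C, hC, r, hr, H⟩ := H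
    refine ⟨C, hC, fun q hq χ hχ hχ1 ↦ ?_⟩
    have : NeZero q := ⟨by omega⟩
    refine (H q χ hχ hχ1).trans ?_
    gcongr
    exact_mod_cast hq.le
  set G := ‖(Gammaℝ s)⁻¹‖ + ‖(Gammaℝ (s + 1))⁻¹‖
  have hG : 0 ≤ G := by positivity
  have key {C r : ℝ} (hC : 0 < C) (hr : r ≤ e + ε)
      (h : ∀ (q : ℕ) [NeZero q] (χ : DirichletCharacter ℂ q), χ.IsPrimitive → χ ≠ 1 →
        ‖completedLFunction χ s‖ ≤ C * (q : ℝ) ^ r) :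
      ∃ C : ℝ, 0 < C ∧ ∃ r ≤ e + ε, ∀ (q : ℕ) [NeZero q] (χ : DirichletCharacter ℂ q),
        χ.IsPrimitive → χ ≠ 1 → ‖LFunction χ s‖ ≤ C * (q : ℝ) ^ r := by
    refine ⟨(G + 1) * C, by positivity, r, hr, fun q _ χ hχ hχ1 ↦ ?_⟩
    refine (norm_LFunction_le_mul_completedLFunction hχ1 s).trans ?_
    rw [mul_assoc]
    exact mul_le_mul (by linarith) (h q χ hχ hχ1) (norm_nonneg _) (by linarith)
  rcases lt_or_ge 1 s.re with h1 | h1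
  · obtain ⟨C, hC, h⟩ := exists_norm_completedLFunction_le h1
    exact key hC (r := 0) (by linarith) fun q _ χ _ _ ↦ by simpa using h q χ s rfl
  rcases lt_or_ge s.re 0 with h0 | h0
  · obtain ⟨C, hC, h⟩ := exists_norm_completedLFunction_le (σ := 1 - s.re) (by linarith)
    refine key hC (r := 1 / 2 - s.re) (by linarith) fun q _ χ hχ _ ↦ ?_
    rw [norm_completedLFunction_one_sub hχ, mul_comm]
    gcongr
    exact h q _ _ (by simp)
  · obtain ⟨C, hC, h⟩ := exists_norm_completedLFunction_le_rpow hε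
    exact key hC (r := (1 + ε - s.re) / 2) (by linarith) fun q _ χ hχ hχ1 ↦
      h q χ hχ hχ1 s (by linarith) (by linarith)
end

section
/- Let N > 1 be a squarefree integer, let d be a positive divisor of N, and let n ≥ 0 be an integer. Then the integer (n N²/d)² − 4N is not the square of any integer. (In particular, for n = 0, −4N is not a square.) -/
/-- for `N > 1` squarefree, `d | N`, and `n ≥ 0`,
the integer `(n N²/d)² − 4N` is not a perfect square. -/
theorem statement_8 (N d n : ℕ) (hN : 1 < N) (hsf : Squarefree N)
    (hd : d ∣ N) (hd0 : 0 < d) :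
    ¬ IsSquare (((n * (N ^ 2 / d) : ℕ) : ℤ) ^ 2 - 4 * (N : ℤ)) := by
  rintro ⟨m, hm⟩
  obtain ⟨e, he⟩ := hd
  have hquot : N ^ 2 / d = N * e := by
    apply Nat.div_eq_of_eq_mul_right hd0
    rw [sq]
    nth_rewrite 2 [he]
    ring
  rw [hquot] at hm
  push_cast at hm
  have hNm : (N : ℤ) ∣ m := by
    have hsq : (N : ℤ) ∣ m ^ 2 := ⟨n ^ 2 * N * e ^ 2 - 4, by linear_combination -hm⟩
    exact ((Int.squarefree_natCast.mpr hsf).dvd_pow_iff_dvd two_ne_zero).mp hsq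
  obtain ⟨k, rfl⟩ := hNm
  have hN0 : (N : ℤ) ≠ 0 := by positivity
  have hfour : (N : ℤ) * ((n * e) ^ 2 - k ^ 2) = 4 := by
    apply mul_left_cancel₀ hN0
    linear_combination hm
  have hN4 : N ∣ 4 := by exact_mod_cast Dvd.intro _ hfour
  have hle : N ≤ 4 := Nat.le_of_dvd (by norm_num) hN4
  have hN2 : N = 2 := by
    have hne : N ≠ 4 := by
      rintro rfl
      exact absurd (hsf 2 (by norm_num)) (by decide)
    interval_cases N <;> omega
  have htwo : ((n : ℤ) * e) ^ 2 - k ^ 2 = 2 := by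
    rw [hN2] at hfour
    push_cast at hfour
    linarith
  rcases Int.even_or_odd' (n * e : ℤ) with ⟨a, ha | ha⟩ <;>
    rcases Int.even_or_odd' k with ⟨b, hb | hb⟩ <;>
    rw [ha, hb] at htwo <;> ring_nf at htwo <;> omega
end

section
/- Let N > 1 be a squarefree integer, and let Δ be an integer such that for every prime p dividing N: if p is odd then p divides Δ but p² does not, and if p = 2 then Δ ≡ 8 or 12 (mod 16). Then for every complex number s with Re(s) > 1, ∑_{c ≥ 1} ρ(c, Δ) c^{-s} = (∏_{p | N, p prime} (1 + p^{-s})) · ∑_{c ≥ 1, gcd(c,N)=1} ρ(c, Δ) c^{-s}, where both series converge absolutely. (Equivalently, in the paper's notation, L^{(N)}(s, Δ) = L(s, Δ) in this region.) -/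
open Complex Finset

theorem rho_eq_card_dvd (c : ℕ) (Δ : ℤ) :
    rho c Δ = ((Finset.range (2 * c)).filter
      (fun a : ℕ => (4 * (c : ℤ)) ∣ (a : ℤ) ^ 2 - Δ)).card := by
  unfold rho
  congr 1
  ext a
  simp only [Finset.mem_filter, Int.dvd_iff_emod_eq_zero]

/-- The solutions of `x ≡ r (mod d)`, `x ≡ -r (mod e)` below `d * e` number at most
`4 * |Δ|` if `r ^ 2 ≡ Δ (mod d * e)`. -/
theorem card_simultaneous_le {d e : ℕ} (hd : 0 < d) (he : 0 < e) {Δ r : ℤ} (hΔ : Δ ≠ 0)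
    (hr : ((d * e : ℕ) : ℤ) ∣ r ^ 2 - Δ) :
    ((Finset.range (d * e)).filter
      (fun x : ℕ => (d : ℤ) ∣ x - r ∧ (e : ℤ) ∣ x + r)).card ≤ 4 * Δ.natAbs := by
  set T := (Finset.range (d * e)).filter (fun x : ℕ => (d : ℤ) ∣ x - r ∧ (e : ℤ) ∣ x + r)
    with hT
  rcases T.eq_empty_or_nonempty with h | ⟨x, hx⟩
  · simp [h]
  have hLpos : 0 < Nat.lcm d e := Nat.lcm_pos hd he
  have hcard : T.card ≤ (Finset.range (Nat.gcd d e)).card := by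
    refine Finset.card_le_card_of_injOn (fun y => y / Nat.lcm d e) ?_ ?_
    · intro y hy
      simp only [hT, Finset.coe_filter, Finset.mem_range, Set.mem_ofPred_eq] at hy
      simp only [Finset.coe_range, Set.mem_Iio]
      rw [Nat.div_lt_iff_lt_mul hLpos, Nat.gcd_mul_lcm]
      exact hy.1
    · intro y hy z hz hyz
      simp only [hT, Finset.coe_filter, Finset.mem_range, Set.mem_ofPred_eq] at hy hz hyz
      have h1 : (d : ℤ) ∣ z - y := by
        have := dvd_sub hz.2.1 hy.2.1
        simpa using this
      have h2 : (e : ℤ) ∣ z - y := by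
        have := dvd_sub hz.2.2 hy.2.2
        simpa using this
      have h3 : y ≡ z [MOD Nat.lcm d e] := by
        rw [Nat.modEq_iff_dvd]
        have := lcm_dvd h1 h2
        rwa [← Int.coe_lcm, Int.lcm_natCast_natCast] at this
      rw [← Nat.div_add_mod y (Nat.lcm d e), ← Nat.div_add_mod z (Nat.lcm d e), hyz, h3]
  rw [Finset.card_range] at hcard
  refine hcard.trans ?_
  simp only [hT, Finset.mem_filter] at hx
  set g := Nat.gcd d e
  have gd : (g : ℤ) ∣ d := Int.natCast_dvd_natCast.2 (Nat.gcd_dvd_left d e)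
  have ge : (g : ℤ) ∣ e := Int.natCast_dvd_natCast.2 (Nat.gcd_dvd_right d e)
  have h2r : (g : ℤ) ∣ 2 * r := by
    have := dvd_sub (ge.trans hx.2.2) (gd.trans hx.2.1)
    have h : (x : ℤ) + r - (x - r) = 2 * r := by ring
    rwa [h] at this
  have hgg : (g : ℤ) * g ∣ r ^ 2 - Δ := (mul_dvd_mul gd ge).trans (by exact_mod_cast hr)
  have h4 : (g : ℤ) * g ∣ 4 * Δ := by
    have := dvd_sub (mul_dvd_mul h2r h2r) (hgg.mul_left 4)
    have h : 2 * r * (2 * r) - 4 * (r ^ 2 - Δ) = 4 * Δ := by ring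
    rwa [h] at this
  have h5 : g ∣ (4 * Δ).natAbs := Int.natCast_dvd.1 ((dvd_mul_right _ _).trans h4)
  have h6 := Nat.le_of_dvd (by omega) h5
  rwa [Int.natAbs_mul] at h6

theorem rho_le (c : ℕ) {Δ : ℤ} (hΔ : Δ ≠ 0) :
    rho c Δ ≤ (4 * c).divisors.card * (4 * Δ.natAbs) := by
  rw [rho_eq_card_dvd]
  set S := (Finset.range (2 * c)).filter (fun a : ℕ => (4 * (c : ℤ)) ∣ (a : ℤ) ^ 2 - Δ) with hS
  rcases S.eq_empty_or_nonempty with h | ⟨r, hr⟩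
  · simp [h]
  simp only [hS, Finset.mem_filter, Finset.mem_range] at hr
  have hc : 0 < c := by omega
  let T (d : ℕ) : Finset ℕ := (Finset.range (d * (4 * c / d))).filter
      (fun x : ℕ => (d : ℤ) ∣ x - r ∧ ((4 * c / d : ℕ) : ℤ) ∣ x + r)
  have hsub : S ⊆ (4 * c).divisors.biUnion T := by
    intro x hx
    simp only [hS, Finset.mem_filter, Finset.mem_range] at hx
    have hprod : 4 * (c : ℤ) ∣ ((x : ℤ) - r) * (x + r) := by
      have := dvd_sub hx.2 hr.2
      have h : (x : ℤ) ^ 2 - Δ - ((r : ℤ) ^ 2 - Δ) = (x - r) * (x + r) := by ring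
      rwa [h] at this
    have hgd : Int.gcd ((x : ℤ) - r) ((4 * c : ℕ) : ℤ) ∣ 4 * c := by
      exact_mod_cast Int.gcd_dvd_right ((x : ℤ) - r) ((4 * c : ℕ) : ℤ)
    set d := Int.gcd ((x : ℤ) - r) ((4 * c : ℕ) : ℤ) with hd
    have hdpos : 0 < d := Nat.pos_of_dvd_of_pos hgd (by omega)
    have hmul : d * (4 * c / d) = 4 * c := Nat.mul_div_cancel' hgd
    simp only [Finset.mem_biUnion, Nat.mem_divisors, T, Finset.mem_filter, Finset.mem_range]
    refine ⟨d, ⟨hgd, by omega⟩, by omega, Int.gcd_dvd_left _ _, ?_⟩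
    have hcop := Int.gcd_div_gcd_div_gcd (i := (x : ℤ) - r) (j := ((4 * c : ℕ) : ℤ)) hdpos
    rw [← hd] at hcop
    obtain ⟨u, hu⟩ : (d : ℤ) ∣ x - r := Int.gcd_dvd_left _ _
    have hdz : (d : ℤ) ≠ 0 := by exact_mod_cast hdpos.ne'
    have hmulz : ((4 * c : ℕ) : ℤ) = d * ((4 * c / d : ℕ) : ℤ) := by exact_mod_cast hmul.symm
    rw [hu, hmulz, Int.mul_ediv_cancel_left _ hdz, Int.mul_ediv_cancel_left _ hdz] at hcop
    have hprod' : (d : ℤ) * ((4 * c / d : ℕ) : ℤ) ∣ d * (u * (x + r)) := by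
      rw [← hmulz, ← mul_assoc, ← hu]
      exact_mod_cast hprod
    have h' := Int.dvd_of_mul_dvd_mul_left hdz hprod'
    exact Int.dvd_of_dvd_mul_right_of_gcd_one h' (by rwa [Int.gcd_comm])
  refine (Finset.card_le_card hsub).trans (Finset.card_biUnion_le_card_mul _ _ _ ?_)
  intro d hd
  have hdd := Nat.dvd_of_mem_divisors hd
  have hdpos : 0 < d := Nat.pos_of_mem_divisors hd
  refine card_simultaneous_le hdpos (Nat.div_pos (Nat.le_of_dvd (by omega) hdd) hdpos) hΔ ?_
  rw [Nat.mul_div_cancel' hdd]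
  exact_mod_cast hr.2

theorem summable_card_divisors_mul_rpow {σ : ℝ} (hσ : 1 < σ) :
    Summable (fun n : ℕ => (n.divisors.card : ℝ) * (n : ℝ) ^ (-σ)) := by
  have h1 : LSeriesSummable 1 (σ : ℂ) := LSeriesSummable_one_iff.2 (by simpa using hσ)
  have h := (h1.convolution h1).norm
  refine h.congr fun n => ?_
  rcases eq_or_ne n 0 with rfl | hn
  · simp
  rw [LSeries.norm_term_eq, if_neg hn, LSeries.convolution_def]
  simp [Real.rpow_neg, div_eq_mul_inv, ← Nat.map_div_right_divisors]

theorem summable_rho_mul_cpow {Δ : ℤ} (hΔ : Δ ≠ 0) {s : ℂ} (hs : 1 < s.re) :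
    Summable (fun c : ℕ => (rho c Δ : ℂ) * (c : ℂ) ^ (-s)) := by
  have hinj : Function.Injective (fun c : ℕ => 4 * c) := fun a b h => by
    simp only at h; omega
  have h := ((summable_card_divisors_mul_rpow hs).comp_injective hinj).mul_left
    ((4 * Δ.natAbs : ℕ) * (4 : ℝ) ^ s.re)
  refine Summable.of_norm_bounded h fun c => ?_
  rcases Nat.eq_zero_or_pos c with rfl | hc
  · simp [rho]
  have hle : (rho c Δ : ℝ) ≤ (4 * c).divisors.card * (4 * Δ.natAbs : ℕ) := by
    exact_mod_cast rho_le c hΔ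
  have h4 : (4 : ℝ) ^ s.re * (4 : ℝ) ^ (-s.re) = 1 := by
    rw [← Real.rpow_add (by norm_num)]; simp
  rw [norm_mul, Complex.norm_natCast, Complex.norm_natCast_cpow_of_pos hc, Complex.neg_re]
  simp only [Function.comp_apply]
  rw [Nat.cast_mul 4 c, Real.mul_rpow (by positivity) (by positivity), Nat.cast_ofNat]
  calc (rho c Δ : ℝ) * (c : ℝ) ^ (-s.re)
      ≤ ((4 * c).divisors.card * (4 * Δ.natAbs : ℕ)) * (c : ℝ) ^ (-s.re) := by gcongr
    _ = ((4 * c).divisors.card * (4 * Δ.natAbs : ℕ)) * (c : ℝ) ^ (-s.re)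
          * ((4 : ℝ) ^ s.re * (4 : ℝ) ^ (-s.re)) := by rw [h4, mul_one]
    _ = _ := by ring

/-- The condition on `Δ` at a prime `p`: `Δ` is exactly divisible by `p` if `p` is odd, and
`Δ ≡ 8, 12 (mod 16)` if `p = 2`. -/
def RamifiedAt (p : ℕ) (Δ : ℤ) : Prop :=
  (Odd p → ((p : ℤ) ∣ Δ ∧ ¬ ((p : ℤ) ^ 2 ∣ Δ))) ∧ (p = 2 → (Δ % 16 = 8 ∨ Δ % 16 = 12))

theorem RamifiedAt.rho_eq_zero {p : ℕ} {Δ : ℤ} (h : RamifiedAt p Δ) (hp : p.Prime) {c : ℕ}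
    (hc : p * p ∣ c) : rho c Δ = 0 := by
  rw [rho_eq_card_dvd, Finset.card_eq_zero, Finset.filter_eq_empty_iff]
  intro a _ ha
  have hc' : (p : ℤ) * p ∣ c := by exact_mod_cast hc
  rcases hp.eq_two_or_odd' with rfl | hodd
  · have h16 : (16 : ℤ) ∣ (a : ℤ) ^ 2 - Δ := (mul_dvd_mul_left 4 hc').trans ha
    have h1 := h.2 rfl
    have h2 : (a : ℤ) ^ 2 % 16 = Δ % 16 := by omega
    have h3 : (a : ℤ) % 16 < 16 := Int.emod_lt_of_pos _ (by norm_num)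
    have h4 : 0 ≤ (a : ℤ) % 16 := Int.emod_nonneg _ (by norm_num)
    rw [pow_two, Int.mul_emod] at h2
    interval_cases (a : ℤ) % 16 <;> omega
  · obtain ⟨h1, h2⟩ := h.1 hodd
    have h3 : (p : ℤ) * p ∣ (a : ℤ) ^ 2 - Δ := (hc'.mul_left 4).trans ha
    have h4 : (p : ℤ) ∣ (a : ℤ) ^ 2 := by
      have := dvd_add ((dvd_mul_right _ _).trans h3) h1
      simpa using this
    have h5 : (p : ℤ) ∣ a := (Nat.prime_iff_prime_int.1 hp).dvd_of_dvd_pow h4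
    apply h2
    have := dvd_sub (mul_dvd_mul h5 h5) h3
    have h6 : (a : ℤ) * a - (a ^ 2 - Δ) = Δ := by ring
    rw [h6] at this
    rwa [pow_two]

/-- If among the lifts to `range (p * M)` of each solution of an `M`-periodic condition exactly
one satisfies `Q`, then the condition has as many solutions as its conjunction with `Q`. -/
theorem card_filter_range_eq_of_unique_lift {p M : ℕ} (hM : 0 < M) (P Q : ℕ → Prop)
    [DecidablePred P] [DecidablePred Q]
    (himp : ∀ a, Q a → P (a % M))
    (hex : ∀ b < M, P b → ∃ a < p * M, a % M = b ∧ Q a)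
    (huniq : ∀ a a', a < p * M → a' < p * M → Q a → Q a' → a % M = a' % M → a = a') :
    ((Finset.range (p * M)).filter Q).card = ((Finset.range M).filter P).card := by
  refine Finset.card_bij (fun a _ => a % M) ?_ ?_ ?_
  · intro a ha
    simp only [Finset.mem_filter, Finset.mem_range] at ha ⊢
    exact ⟨Nat.mod_lt _ hM, himp a ha.2⟩
  · intro a ha a' ha' h
    simp only [Finset.mem_filter, Finset.mem_range] at ha ha'
    exact huniq a a' ha.1 ha'.1 ha.2 ha'.2 h
  · intro b hb
    simp only [Finset.mem_filter, Finset.mem_range] at hb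
    obtain ⟨a, h1, h2, h3⟩ := hex b hb.1 hb.2
    exact ⟨a, by simp [h1, h3], h2⟩

/-- Divisibility of `a ^ 2 - Δ` by `4 * m` depends only on `a` modulo `2 * m`. -/
theorem four_mul_dvd_sq_sub_iff {m : ℕ} {Δ a b : ℤ} (h : 2 * (m : ℤ) ∣ a - b) :
    4 * (m : ℤ) ∣ a ^ 2 - Δ ↔ 4 * (m : ℤ) ∣ b ^ 2 - Δ := by
  obtain ⟨k, hk⟩ := h
  refine (dvd_iff_dvd_of_dvd_sub ⟨m * k ^ 2 + b * k, ?_⟩)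
  obtain rfl : a = b + 2 * m * k := by linarith
  ring

theorem RamifiedAt.rho_mul {p : ℕ} {Δ : ℤ} (h : RamifiedAt p Δ) (hp : p.Prime) {m : ℕ}
    (hm : ¬ p ∣ m) : rho (p * m) Δ = rho m Δ := by
  have hm0 : 0 < m := Nat.pos_of_ne_zero (by rintro rfl; simp at hm)
  rw [rho_eq_card_dvd, rho_eq_card_dvd, mul_left_comm]
  have hper : ∀ a : ℕ, 4 * (m : ℤ) ∣ (a : ℤ) ^ 2 - Δ ↔
      4 * (m : ℤ) ∣ ((a % (2 * m) : ℕ) : ℤ) ^ 2 - Δ := fun a => by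
    refine four_mul_dvd_sq_sub_iff ?_
    have := Int.dvd_self_sub_emod (x := (a : ℤ)) (m := 2 * (m : ℤ))
    exact_mod_cast this
  have hdown : ∀ a : ℕ, 4 * ((p * m : ℕ) : ℤ) ∣ (a : ℤ) ^ 2 - Δ → 4 * (m : ℤ) ∣ (a : ℤ) ^ 2 - Δ :=
    fun a ha => (mul_dvd_mul_left 4 (by push_cast; exact dvd_mul_left _ _)).trans ha
  refine card_filter_range_eq_of_unique_lift (by omega) _ _
    (fun a ha => (hper a).1 (hdown a ha)) ?_ ?_
  all_goals rcases hp.eq_two_or_odd' with rfl | hodd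
  · intro b hb hPb
    have h8 := h.2 rfl
    have hmodd : m % 2 = 1 := by omega
    have hbe : b % 2 = 0 := by
      have h4 : (4 : ℤ) ∣ (b : ℤ) ^ 2 - Δ := (dvd_mul_right _ _).trans hPb
      have h5 : Even ((b : ℤ) ^ 2) := by rw [Int.even_iff]; omega
      have h6 : Even (b : ℤ) := (Int.even_pow.1 h5).1
      rw [Int.even_iff] at h6; omega
    obtain ⟨a, ha, hab, ha4⟩ : ∃ a < 2 * (2 * m), a % (2 * m) = b ∧
        (a : ℤ) % 4 = (Δ / 2) % 4 := by
      by_cases hc : (b : ℤ) % 4 = (Δ / 2) % 4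
      · exact ⟨b, by omega, Nat.mod_eq_of_lt hb, hc⟩
      · refine ⟨b + 2 * m, by omega, by simp [Nat.mod_eq_of_lt hb], ?_⟩
        push_cast
        omega
    refine ⟨a, ha, hab, ?_⟩
    have hPa : 4 * (m : ℤ) ∣ (a : ℤ) ^ 2 - Δ := by rw [hper, hab]; exact hPb
    have h8a : (8 : ℤ) ∣ (a : ℤ) ^ 2 - Δ := by
      obtain ⟨k, hk⟩ : ∃ k, (a : ℤ) = 4 * k + (Δ / 2) % 4 := ⟨a / 4, by omega⟩
      rcases h8 with h8 | h8
      · rw [show (Δ / 2) % 4 = 0 by omega] at hk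
        rw [hk]
        have : (8 : ℤ) ∣ Δ := by omega
        exact dvd_sub ⟨2 * k ^ 2, by ring⟩ this
      · rw [show (Δ / 2) % 4 = 2 by omega] at hk
        rw [hk, show (4 * k + 2) ^ 2 - Δ = 8 * (2 * k ^ 2 + 2 * k) + (4 - Δ) by ring]
        exact dvd_add (dvd_mul_right _ _) (by omega)
    have hcop : IsCoprime (8 : ℤ) (m : ℤ) := by
      have : Nat.Coprime (2 ^ 3) m :=
        Nat.Coprime.pow_left 3 (hp.coprime_iff_not_dvd.2 hm)
      exact_mod_cast Nat.isCoprime_iff_coprime.2 this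
    have := hcop.mul_dvd h8a ((dvd_mul_left _ _).trans hPa)
    push_cast
    rwa [show (4 : ℤ) * (2 * m) = 8 * m by ring]
  · intro b hb hPb
    have hp2 : Nat.Coprime (2 * m) p :=
      Nat.Coprime.mul_left hodd.coprime_two_left ((hp.coprime_iff_not_dvd.2 hm).symm)
    have hp4 : IsCoprime (p : ℤ) (4 * m : ℕ) := by
      refine Nat.isCoprime_iff_coprime.2 (Nat.Coprime.mul_right ?_ (hp.coprime_iff_not_dvd.2 hm))
      exact Nat.Coprime.pow_right 2 hodd.coprime_two_right
    obtain ⟨a, ha1, ha2⟩ := Nat.chineseRemainder hp2 b 0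
    refine ⟨a % (p * (2 * m)), Nat.mod_lt _ (by have := hp.pos; positivity), ?_, ?_⟩
    · rw [Nat.mod_mul_left_mod, ha1, Nat.mod_eq_of_lt hb]
    · set a' := a % (p * (2 * m)) with ha'
      have hab : a' % (2 * m) = b := by
        rw [ha', Nat.mod_mul_left_mod, ha1, Nat.mod_eq_of_lt hb]
      have hPa : 4 * (m : ℤ) ∣ (a' : ℤ) ^ 2 - Δ := by rw [hper, hab]; exact hPb
      have hpa : p ∣ a' := by
        rw [Nat.dvd_iff_mod_eq_zero, ha', Nat.mod_mul_right_mod, ha2, Nat.zero_mod]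
      have hpd : (p : ℤ) ∣ (a' : ℤ) ^ 2 - Δ :=
        dvd_sub (dvd_pow (Int.natCast_dvd_natCast.2 hpa) two_ne_zero) (h.1 hodd).1
      have := hp4.mul_dvd hpd (by exact_mod_cast hPa)
      push_cast at this ⊢
      rwa [mul_left_comm]
  · intro a a' ha ha' hQ hQ' haa
    have h8 := h.2 rfl
    have key : ∀ x : ℕ, 4 * ((2 * m : ℕ) : ℤ) ∣ (x : ℤ) ^ 2 - Δ → (x : ℤ) % 4 = (Δ / 2) % 4 := by
      intro x hx
      have h8x : (8 : ℤ) ∣ (x : ℤ) ^ 2 - Δ := by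
        refine dvd_trans ⟨m, ?_⟩ hx
        push_cast; ring
      have h2 : (x : ℤ) ^ 2 % 8 = Δ % 8 := by omega
      have h3 : (x : ℤ) % 8 < 8 := Int.emod_lt_of_pos _ (by norm_num)
      have h4 : 0 ≤ (x : ℤ) % 8 := Int.emod_nonneg _ (by norm_num)
      rw [pow_two, Int.mul_emod] at h2
      have h5 : (x : ℤ) % 4 = (x : ℤ) % 8 % 4 := by omega
      rw [h5]
      interval_cases (x : ℤ) % 8 <;> omega
    have hk := key a hQ
    have hk' := key a' hQ'
    have h1 := Nat.div_add_mod a (2 * m)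
    have h2 := Nat.div_add_mod a' (2 * m)
    have h3 : a / (2 * m) < 2 := (Nat.div_lt_iff_lt_mul (by omega)).2 ha
    have h4 : a' / (2 * m) < 2 := (Nat.div_lt_iff_lt_mul (by omega)).2 ha'
    interval_cases a / (2 * m) <;> interval_cases a' / (2 * m) <;> omega
  · intro a a' ha ha' hQ hQ' haa
    have key : ∀ x : ℕ, 4 * ((p * m : ℕ) : ℤ) ∣ (x : ℤ) ^ 2 - Δ → p ∣ x := by
      intro x hx
      have hpx : (p : ℤ) ∣ (x : ℤ) ^ 2 - Δ := by
        refine dvd_trans ⟨4 * m, ?_⟩ hx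
        push_cast; ring
      have := dvd_add hpx (h.1 hodd).1
      rw [sub_add_cancel] at this
      exact Int.natCast_dvd_natCast.1 ((Nat.prime_iff_prime_int.1 hp).dvd_of_dvd_pow this)
    have hcop : Nat.Coprime p (2 * m) :=
      Nat.Coprime.mul_right hodd.coprime_two_right (hp.coprime_iff_not_dvd.2 hm)
    have h1 : a ≡ a' [MOD p] :=
      ((Nat.modEq_zero_iff_dvd.2 (key a hQ)).trans (Nat.modEq_zero_iff_dvd.2 (key a' hQ')).symm)
    have h2 := (Nat.modEq_and_modEq_iff_modEq_mul hcop).1 ⟨h1, haa⟩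
    exact Nat.ModEq.eq_of_lt_of_lt h2 ha ha'

/-- Splitting off the Euler factor `1 + z` at `p` from a sum over the integers not divisible by
the elements of `S`. -/
theorem tsum_not_dvd_eq_one_add_mul {f : ℕ → ℂ} (hf : Summable f) {S : Finset ℕ} {p : ℕ} {z : ℂ}
    (hp : 0 < p) (hS : ∀ q ∈ S, Nat.Coprime q p)
    (hmul : ∀ m, ¬ p ∣ m → f (p * m) = z * f m) (hzero : ∀ c, p * p ∣ c → f c = 0) :
    (∑' c, if ∀ q ∈ S, ¬ q ∣ c then f c else 0) =
      (1 + z) * ∑' c, if ∀ q ∈ insert p S, ¬ q ∣ c then f c else 0 := by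
  classical
  have hsum : ∀ P : ℕ → Prop, [DecidablePred P] → Summable (fun c => if P c then f c else 0) := by
    intro P _
    exact (hf.indicator {c | P c}).congr fun c => by simp [Set.indicator]
  have hsplit : ∀ c, (if ∀ q ∈ S, ¬ q ∣ c then f c else 0) =
      (if ∀ q ∈ insert p S, ¬ q ∣ c then f c else 0) +
      (if p ∣ c ∧ ∀ q ∈ S, ¬ q ∣ c then f c else 0) := by
    intro c
    by_cases h1 : p ∣ c <;> simp [h1]
  have hinj : Function.Injective (fun m : ℕ => p * m) := fun a b h =>
    Nat.eq_of_mul_eq_mul_left hp h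
  have hsupp : Function.support (fun c => if p ∣ c ∧ ∀ q ∈ S, ¬ q ∣ c then f c else 0) ⊆
      Set.range (fun m : ℕ => p * m) := by
    intro c hc
    by_contra hn
    apply hc
    have : ¬ p ∣ c := fun ⟨m, hm⟩ => hn ⟨m, hm.symm⟩
    simp [this]
  rw [tsum_congr hsplit, Summable.tsum_add (hsum _) (hsum _), ← hinj.tsum_eq hsupp, add_mul,
    one_mul, ← tsum_mul_left]
  congr 1
  refine tsum_congr fun m => ?_
  by_cases hpm : p ∣ m
  · simp [hpm, hzero (p * m) (mul_dvd_mul_left p hpm)]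
  · have hq : (∀ q ∈ S, ¬ q ∣ p * m) ↔ ∀ q ∈ S, ¬ q ∣ m :=
      forall₂_congr fun q hq => not_congr (hS q hq).dvd_mul_left
    simp only [dvd_mul_right, true_and, hq, Finset.forall_mem_insert, hpm, not_false_eq_true,
      hmul m hpm, mul_ite, mul_zero]

theorem tsum_eq_prod_one_add_mul {f z : ℕ → ℂ} (hf : Summable f) (S : Finset ℕ)
    (hS : ∀ p ∈ S, p.Prime)
    (hmul : ∀ p ∈ S, ∀ m, ¬ p ∣ m → f (p * m) = z p * f m)
    (hzero : ∀ p ∈ S, ∀ c, p * p ∣ c → f c = 0) :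
    ∑' c, f c = (∏ p ∈ S, (1 + z p)) * ∑' c, if ∀ q ∈ S, ¬ q ∣ c then f c else 0 := by
  induction S using Finset.induction_on with
  | empty => simp
  | insert p S hpS ih =>
    simp only [Finset.forall_mem_insert] at hS hmul hzero
    rw [ih hS.2 hmul.2 hzero.2, tsum_not_dvd_eq_one_add_mul (p := p) hf hS.1.pos
      (fun q hq => (Nat.coprime_primes (hS.2 q hq) hS.1).2 (by rintro rfl; exact hpS hq))
      hmul.1 hzero.1, Finset.prod_insert hpS]
    ring

theorem RamifiedAt.ne_zero {p : ℕ} {Δ : ℤ} (h : RamifiedAt p Δ) (hp : p.Prime) : Δ ≠ 0 := by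
  rintro rfl
  rcases hp.eq_two_or_odd' with rfl | hodd
  · simpa using h.2 rfl
  · simpa using h.1 hodd

/-- for `N > 1` squarefree and `Δ` with `p ∥ Δ` for each odd prime `p | N`
and `Δ ≡ 8, 12 (mod 16)` if `2 | N`, one has, for `Re s > 1`,
`∑_{c≥1} ρ(c,Δ) c^{-s} = ∏_{p|N} (1+p^{-s}) · ∑_{(c,N)=1} ρ(c,Δ) c^{-s}`,
both series converging absolutely. -/
theorem statement_11 (N : ℕ) (hN : 1 < N) (hsf : Squarefree N) (Δ : ℤ)
    (hΔ : ∀ p : ℕ, p.Prime → p ∣ N →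
      (Odd p → ((p : ℤ) ∣ Δ ∧ ¬ ((p : ℤ) ^ 2 ∣ Δ))) ∧
      (p = 2 → (Δ % 16 = 8 ∨ Δ % 16 = 12)))
    (s : ℂ) (hs : 1 < s.re) :
    Summable (fun c : ℕ => (rho c Δ : ℂ) * (c : ℂ) ^ (-s)) ∧
    Summable (fun c : ℕ => if Nat.gcd c N = 1 then (rho c Δ : ℂ) * (c : ℂ) ^ (-s) else 0) ∧
    (∑' c : ℕ, (rho c Δ : ℂ) * (c : ℂ) ^ (-s)) =
      (∏ p ∈ N.primeFactors, (1 + (p : ℂ) ^ (-s))) *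
        ∑' c : ℕ, if Nat.gcd c N = 1 then (rho c Δ : ℂ) * (c : ℂ) ^ (-s) else 0 := by
  have hram : ∀ p : ℕ, p.Prime → p ∣ N → RamifiedAt p Δ := hΔ
  have hN0 : N ≠ 0 := by omega
  have hΔ0 : Δ ≠ 0 :=
    (hram _ (Nat.minFac_prime hN.ne') (Nat.minFac_dvd N)).ne_zero (Nat.minFac_prime hN.ne')
  have hsum := summable_rho_mul_cpow hΔ0 hs
  refine ⟨hsum, (hsum.indicator {c | Nat.gcd c N = 1}).congr fun c => by
    simp [Set.indicator], ?_⟩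
  have hgcd : ∀ c, Nat.gcd c N = 1 ↔ ∀ q ∈ N.primeFactors, ¬ q ∣ c := by
    intro c
    rw [← Nat.coprime_iff_gcd_eq_one, Nat.coprime_comm]
    constructor
    · intro h q hq hqc
      exact (Nat.prime_of_mem_primeFactors hq).one_lt.ne'
        (Nat.eq_one_of_dvd_coprimes h (Nat.dvd_of_mem_primeFactors hq) hqc)
    · intro h
      exact Nat.coprime_of_dvd fun k hk hkN hkc => h k (by simp [hk, hkN, hN0]) hkc
  simp only [hgcd]
  refine tsum_eq_prod_one_add_mul hsum N.primeFactors
    (fun p hp => Nat.prime_of_mem_primeFactors hp) ?_ ?_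
  · intro p hp m hm
    have hp' := Nat.prime_of_mem_primeFactors hp
    rw [(hram p hp' (Nat.dvd_of_mem_primeFactors hp)).rho_mul hp' hm, Nat.cast_mul,
      Complex.natCast_mul_natCast_cpow]
    ring
  · intro p hp c hc
    have hp' := Nat.prime_of_mem_primeFactors hp
    simp [(hram p hp' (Nat.dvd_of_mem_primeFactors hp)).rho_eq_zero hp' hc]
end
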